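/- arXiv:1901.01510 — 3 statements merged into one kernel-verified Lean document; each statement's English description precedes it below -/
import Mathlib

section
/- Let Ω ⊆ ℝ³ be measurable, let θ ∈ [0,1], let r ∈ [1,∞] and, for j = 1,2,3, let s_j, t_j satisfy 1 ≤ s_j ≤ r ≤ t_j ≤ ∞ and 1/r = θ/s_j + (1−θ)/t_j. Then for every measurable f : Ω → ℝ with ‖f‖_{L^{s⃗}(Ω)} < ∞ and ‖f‖_{L^{t⃗}(Ω)} < ∞ one has ‖f‖_{L^r(Ω)} ≤ ‖f‖_{L^{s⃗}(Ω)}^θ · ‖f‖_{L^{t⃗}(Ω)}^{1−θ}. -/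
open MeasureTheory ENNReal Set Metric Filter

noncomputable section

/-- Euclidean 3-space. -/
abbrev E3 : Type := EuclideanSpace ℝ (Fin 3)

/-- The point (x₁,x₂,x₃) of ℝ³. -/
def pt3 (x1 x2 x3 : ℝ) : E3 := (WithLp.equiv 2 (Fin 3 → ℝ)).symm ![x1, x2, x3]

/-- Anisotropic Lebesgue (quasi-)norm `‖f‖_{L^{q⃗}(Ω)}` with finite exponents:
iterated L^{q₁}, L^{q₂}, L^{q₃} norms in x₁, x₂, x₃ of f extended by 0 outside Ω. -/
def anisoNorm (q1 q2 q3 : ℝ) (Ω : Set E3) (f : E3 → ℝ) : ℝ≥0∞ :=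
  (∫⁻ x3 : ℝ, (∫⁻ x2 : ℝ, (∫⁻ x1 : ℝ,
      (ENNReal.ofReal |Ω.indicator f (pt3 x1 x2 x3)|) ^ q1) ^ (q2 / q1)) ^ (q3 / q2)) ^ (1 / q3)

/-- Partial derivative in the i-th coordinate direction. -/
def pd (i : Fin 3) (f : E3 → ℝ) (x : E3) : ℝ := fderiv ℝ f x (EuclideanSpace.single i 1)

/-- Laplacian. -/
def lap (f : E3 → ℝ) (x : E3) : ℝ := ∑ i : Fin 3, pd i (fun y => pd i f y) x

/-- One-dimensional Lebesgue norm with exponent in `[1,∞]`. -/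
def lpLine (q : ℝ≥0∞) (g : ℝ → ℝ≥0∞) : ℝ≥0∞ :=
  if q = ∞ then essSup g volume else (∫⁻ x : ℝ, (g x) ^ q.toReal) ^ (1 / q.toReal)

/-- Anisotropic Lebesgue norm `‖f‖_{L^{q⃗}(Ω)}` with exponents in `[1,∞]`. -/
def anisoNormE (q1 q2 q3 : ℝ≥0∞) (Ω : Set E3) (f : E3 → ℝ) : ℝ≥0∞ :=
  lpLine q3 (fun x3 => lpLine q2 (fun x2 => lpLine q1 (fun x1 =>
    ENNReal.ofReal |Ω.indicator f (pt3 x1 x2 x3)|)))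

theorem essSup_le_iff_aux (g : ℝ → ℝ≥0∞) (a : ℝ≥0∞) :
    essSup g volume ≤ a ↔ ∀ᵐ x, g x ≤ a := by
  constructor
  · intro h
    filter_upwards [ENNReal.ae_le_essSup g (μ := volume)] with x hx using hx.trans h
  · intro h
    exact essSup_le_of_ae_le a h

theorem measurable_lpLine {α : Type*} [MeasurableSpace α] (q : ℝ≥0∞) (G : α × ℝ → ℝ≥0∞)
    (hG : Measurable G) : Measurable (fun a => lpLine q (fun x => G (a, x))) := by
  unfold lpLine
  by_cases hq : q = ∞
  · simp only [hq, if_true]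
    refine measurable_of_Iic fun c => ?_
    have : (fun a => essSup (fun x => G (a, x)) volume) ⁻¹' Iic c
        = (fun a => (volume : Measure ℝ) (Prod.mk a ⁻¹' {p | c < G p})) ⁻¹' {0} := by
      ext a
      simp only [mem_preimage, mem_Iic, mem_singleton_iff, essSup_le_iff_aux, ae_iff, not_le]
      rfl
    rw [this]
    exact (measurable_measure_prodMk_left (measurableSet_lt measurable_const hG))
      (measurableSet_singleton 0)
  · simp only [hq, if_false]
    exact ((hG.pow_const _).lintegral_prod_right').pow_const _

theorem lpLine_mono (q : ℝ≥0∞) {g h : ℝ → ℝ≥0∞} (H : ∀ x, g x ≤ h x) :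
    lpLine q g ≤ lpLine q h := by
  unfold lpLine
  split_ifs
  · exact essSup_mono_ae (Eventually.of_forall H)
  · refine ENNReal.rpow_le_rpow (lintegral_mono fun x => ?_) (by positivity)
    exact ENNReal.rpow_le_rpow (H x) (by positivity)

theorem lpLine_holder (θ : ℝ) (hθ0 : 0 ≤ θ) (hθ1 : θ ≤ 1) (r s t : ℝ≥0∞)
    (hs : 1 ≤ s) (hsr : s ≤ r) (hrt : r ≤ t)
    (h : 1/r = ENNReal.ofReal θ / s + ENNReal.ofReal (1-θ) / t)
    (a b : ℝ → ℝ≥0∞) (ha : Measurable a) (hb : Measurable b) :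
    lpLine r (fun x => a x ^ θ * b x ^ (1-θ)) ≤ lpLine s a ^ θ * lpLine t b ^ (1-θ) := by
  have hs0 : s ≠ 0 := (zero_lt_one.trans_le hs).ne'
  have hr0 : r ≠ 0 := (zero_lt_one.trans_le (hs.trans hsr)).ne'
  have ht0 : t ≠ 0 := (zero_lt_one.trans_le (hs.trans (hsr.trans hrt))).ne'
  rcases hθ0.eq_or_lt with rfl | hθ0
  · have : r = t := by simpa using h
    simp [this]
  rcases hθ1.eq_or_lt with rfl | hθ1
  · have : r = s := by simpa using h
    simp [this]
  have hθ' : 0 < 1 - θ := by linarith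
  by_cases hr : r = ∞
  · have ht : t = ∞ := top_le_iff.mp (hr ▸ hrt)
    have hs' : s = ∞ := by
      subst hr
      simp only [one_div, ENNReal.inv_top] at h
      have := (add_eq_zero.mp h.symm).1
      rw [ENNReal.div_eq_zero_iff] at this
      rcases this with h | h
      · simp at h; linarith
      · exact h
    simp only [lpLine, hr, ht, hs', if_true]
    rw [essSup_le_iff_aux]
    filter_upwards [ENNReal.ae_le_essSup a (μ := volume), ENNReal.ae_le_essSup b (μ := volume)]
      with x h1 h2
    gcongr
  have hs' : s ≠ ∞ := fun h => hr (top_le_iff.mp (h ▸ hsr))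
  have hR : 0 < r.toReal := ENNReal.toReal_pos hr0 hr
  have hS : 0 < s.toReal := ENNReal.toReal_pos hs0 hs'
  have hreal : 1 / r.toReal = θ / s.toReal + (1-θ) / t.toReal := by
    have := congrArg ENNReal.toReal h
    rw [ENNReal.toReal_add (ENNReal.div_ne_top ENNReal.ofReal_ne_top hs0)
      (ENNReal.div_ne_top ENNReal.ofReal_ne_top ht0)] at this
    simpa [ENNReal.toReal_div, ENNReal.toReal_ofReal, hθ0.le, hθ'.le] using this
  have hRi : 0 ≤ 1 / r.toReal := by positivity
  by_cases ht : t = ∞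
  · simp only [lpLine, hr, hs', ht, if_true, if_false]
    rw [ht, ENNReal.toReal_top, _root_.div_zero, _root_.add_zero] at hreal
    have e1 : θ * r.toReal = s.toReal := by field_simp at hreal; linarith
    have key : ∫⁻ x, (a x ^ θ * b x ^ (1-θ)) ^ r.toReal
        ≤ (∫⁻ x, a x ^ s.toReal) * (essSup b volume) ^ ((1-θ) * r.toReal) := by
      rw [← lintegral_mul_const _ (ha.pow_const _)]
      apply lintegral_mono_ae
      filter_upwards [ENNReal.ae_le_essSup b (μ := volume)] with x hx
      rw [ENNReal.mul_rpow_of_nonneg _ _ hR.le, ← ENNReal.rpow_mul, ← ENNReal.rpow_mul, e1]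
      gcongr
    refine (ENNReal.rpow_le_rpow key hRi).trans (le_of_eq ?_)
    rw [ENNReal.mul_rpow_of_nonneg _ _ hRi, ← ENNReal.rpow_mul, ← ENNReal.rpow_mul, hreal]
    congr 2
    · ring
    · rw [← hreal]; field_simp
  · have hT : 0 < t.toReal := ENNReal.toReal_pos ht0 ht
    simp only [lpLine, hr, hs', ht, if_false]
    have hpq : θ * r.toReal / s.toReal + (1-θ) * r.toReal / t.toReal = 1 := by
      have : r.toReal * (1 / r.toReal) = 1 := by field_simp
      rw [hreal] at this
      refine Eq.trans ?_ this
      ring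
    have key := ENNReal.lintegral_mul_norm_pow_le (μ := volume)
      (ha.pow_const s.toReal).aemeasurable (hb.pow_const t.toReal).aemeasurable
      (p := θ * r.toReal / s.toReal) (q := (1-θ) * r.toReal / t.toReal)
      (by positivity) (by positivity) hpq
    have e : ∀ x, (a x ^ s.toReal) ^ (θ * r.toReal / s.toReal)
        * (b x ^ t.toReal) ^ ((1-θ) * r.toReal / t.toReal)
        = (a x ^ θ * b x ^ (1-θ)) ^ r.toReal := by
      intro x
      rw [ENNReal.mul_rpow_of_nonneg _ _ hR.le, ← ENNReal.rpow_mul, ← ENNReal.rpow_mul,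
        ← ENNReal.rpow_mul, ← ENNReal.rpow_mul]
      congr 2 <;> field_simp
    simp only [e] at key
    refine (ENNReal.rpow_le_rpow key hRi).trans (le_of_eq ?_)
    rw [ENNReal.mul_rpow_of_nonneg _ _ hRi, ← ENNReal.rpow_mul, ← ENNReal.rpow_mul,
      ← ENNReal.rpow_mul, ← ENNReal.rpow_mul]
    congr 2 <;> field_simp

theorem mp_pt3 : MeasurePreserving (fun z : ℝ × ℝ × ℝ => pt3 z.2.2 z.2.1 z.1) := by
  have m1 : MeasurePreserving (fun z : ℝ × ℝ × ℝ => (z.1, z.2.swap)) volume volume :=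
    (MeasurePreserving.id (volume : Measure ℝ)).prod
      (Measure.measurePreserving_swap (μ := (volume : Measure ℝ)) (ν := (volume : Measure ℝ)))
  have m2 : MeasurePreserving (fun z : ℝ × ℝ × ℝ => (z.1, MeasurableEquiv.finTwoArrow.symm z.2))
      volume volume :=
    (MeasurePreserving.id (volume : Measure ℝ)).prod
      ((volume_preserving_finTwoArrow ℝ).symm)
  have m3 := (volume_preserving_piFinSuccAbove (fun _ : Fin 3 => ℝ) 2).symm
  have m4 := (PiLp.volume_preserving_toLp (Fin 3))
  have := m4.comp (m3.comp (m2.comp m1))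
  have e : (fun z : ℝ × ℝ × ℝ => pt3 z.2.2 z.2.1 z.1) = (WithLp.toLp 2 ∘
      ⇑(MeasurableEquiv.piFinSuccAbove (fun _ : Fin 3 => ℝ) 2).symm ∘
        (fun z : ℝ × ℝ × ℝ => (z.1, MeasurableEquiv.finTwoArrow.symm z.2)) ∘
          fun z : ℝ × ℝ × ℝ => (z.1, z.2.swap)) := by
    funext z
    ext i
    fin_cases i <;> rfl
  rw [e]
  exact this

theorem eLpNorm_le_iter (r : ℝ≥0∞) (hr0 : r ≠ 0) (f : E3 → ℝ) (hf : Measurable f) :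
    eLpNorm f r volume ≤ lpLine r (fun x3 => lpLine r (fun x2 => lpLine r (fun x1 =>
      ENNReal.ofReal |f (pt3 x1 x2 x3)|))) := by
  have hG : Measurable (fun z : ℝ × ℝ × ℝ => ENNReal.ofReal |f (pt3 z.2.2 z.2.1 z.1)|) :=
    (hf.comp mp_pt3.measurable).norm.ennreal_ofReal
  have he : ∀ x : ℝ, ‖x‖ₑ = ENNReal.ofReal |x| := fun x => Real.enorm_eq_ofReal_abs x
  by_cases hr : r = ∞
  · subst hr
    simp only [lpLine, if_true, eLpNorm_exponent_top, eLpNormEssSup]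
    refine essSup_le_of_ae_le _ ?_
    set C := essSup (fun x3 => essSup (fun x2 => essSup (fun x1 =>
      ENNReal.ofReal |f (pt3 x1 x2 x3)|) volume) volume) volume with hC
    have hmeas : MeasurableSet {x : E3 | ENNReal.ofReal |f x| ≤ C} :=
      measurableSet_le hf.norm.ennreal_ofReal measurable_const
    have h3 := (essSup_le_iff_aux _ C).mp hC.ge
    have : ∀ᵐ z : ℝ × ℝ × ℝ, ENNReal.ofReal |f (pt3 z.2.2 z.2.1 z.1)| ≤ C := by
      have hm : MeasurableSet {z : ℝ × ℝ × ℝ | ENNReal.ofReal |f (pt3 z.2.2 z.2.1 z.1)| ≤ C} :=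
        measurableSet_le hG measurable_const
      refine (Measure.ae_prod_iff_ae_ae hm).mpr ?_
      filter_upwards [h3] with x3 hx3
      refine (Measure.ae_prod_iff_ae_ae (measurable_prodMk_left hm)).mpr ?_
      filter_upwards [(essSup_le_iff_aux _ C).mp hx3] with x2 hx2
      exact (essSup_le_iff_aux _ C).mp hx2
    rw [EventuallyLE]
    simp only [he]
    rw [← mp_pt3.map_eq]
    exact (ae_map_iff mp_pt3.measurable.aemeasurable hmeas).mpr this
  · have hR : 0 < r.toReal := ENNReal.toReal_pos hr0 hr
    rw [eLpNorm_eq_lintegral_rpow_enorm_toReal hr0 hr]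
    simp only [lpLine, hr, if_false, he]
    have hc : ∀ y : ℝ≥0∞, (y ^ (1 / r.toReal)) ^ r.toReal = y := fun y => by
      rw [← ENNReal.rpow_mul, one_div, inv_mul_cancel₀ hR.ne', ENNReal.rpow_one]
    simp only [hc]
    refine le_of_eq ?_
    congr 1
    have hF : Measurable (fun x => ENNReal.ofReal |f x| ^ r.toReal) :=
      hf.norm.ennreal_ofReal.pow_const _
    rw [← mp_pt3.lintegral_comp hF]
    have hG' := hG.pow_const r.toReal
    refine (lintegral_prod _ hG'.aemeasurable).trans ?_
    refine lintegral_congr fun x3 => ?_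
    exact lintegral_prod _ (hG'.comp measurable_prodMk_left).aemeasurable

/-- Lemma 2.1: interpolation between anisotropic Lebesgue norms: if `1 ≤ s_j ≤ r ≤ t_j ≤ ∞`
and `1/r = θ/s_j + (1−θ)/t_j` for each `j`, then
`‖f‖_{L^r(Ω)} ≤ ‖f‖_{L^{s⃗}(Ω)}^θ ‖f‖_{L^{t⃗}(Ω)}^{1−θ}`. -/
theorem aniso_interpolation
    (Ω : Set E3) (hΩ : MeasurableSet Ω)
    (θ : ℝ) (hθ0 : 0 ≤ θ) (hθ1 : θ ≤ 1)
    (r s1 s2 s3 t1 t2 t3 : ℝ≥0∞)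
    (hs1 : 1 ≤ s1) (hs2 : 1 ≤ s2) (hs3 : 1 ≤ s3)
    (hsr1 : s1 ≤ r) (hsr2 : s2 ≤ r) (hsr3 : s3 ≤ r)
    (hrt1 : r ≤ t1) (hrt2 : r ≤ t2) (hrt3 : r ≤ t3)
    (h1 : 1/r = ENNReal.ofReal θ / s1 + ENNReal.ofReal (1-θ) / t1)
    (h2 : 1/r = ENNReal.ofReal θ / s2 + ENNReal.ofReal (1-θ) / t2)
    (h3 : 1/r = ENNReal.ofReal θ / s3 + ENNReal.ofReal (1-θ) / t3)
    (f : E3 → ℝ) (hf : Measurable f)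
    (hfs : anisoNormE s1 s2 s3 Ω f < ∞) (hft : anisoNormE t1 t2 t3 Ω f < ∞) :
    eLpNorm (Ω.indicator f) r volume
      ≤ (anisoNormE s1 s2 s3 Ω f) ^ θ * (anisoNormE t1 t2 t3 Ω f) ^ (1-θ) := by
  have hg : Measurable (Ω.indicator f) := hf.indicator hΩ
  have hr0 : r ≠ 0 := (zero_lt_one.trans_le (hs1.trans hsr1)).ne'
  refine (eLpNorm_le_iter r hr0 _ hg).trans ?_
  unfold anisoNormE
  generalize Ω.indicator f = g at hg
  have hG : Measurable (fun z : (ℝ × ℝ) × ℝ => ENNReal.ofReal |g (pt3 z.2 z.1.2 z.1.1)|) := by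
    have : Measurable (fun z : (ℝ × ℝ) × ℝ => (z.1.1, z.1.2, z.2)) := by fun_prop
    exact (hg.comp (mp_pt3.measurable.comp this)).norm.ennreal_ofReal
  obtain ⟨A, hA⟩ : ∃ A : ℝ≥0∞ → ℝ × ℝ → ℝ≥0∞, ∀ q x3 x2, lpLine q (fun x1 =>
      ENNReal.ofReal |g (pt3 x1 x2 x3)|) = A q (x3, x2) :=
    ⟨fun q p => lpLine q (fun x1 => ENNReal.ofReal |g (pt3 x1 p.2 p.1)|), fun _ _ _ => rfl⟩
  have hm1 : ∀ q, Measurable (A q) := fun q => by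
    have h := measurable_lpLine q _ hG
    simp only [hA] at h
    exact h
  have hin : ∀ x3 x2, A r (x3, x2) ≤ A s1 (x3, x2) ^ θ * A t1 (x3, x2) ^ (1 - θ) := by
    intro x3 x2
    have hx : Measurable (fun x1 => ENNReal.ofReal |g (pt3 x1 x2 x3)|) :=
      hG.comp (measurable_prodMk_left (x := (x3, x2)))
    have h := lpLine_holder θ hθ0 hθ1 r s1 t1 hs1 hsr1 hrt1 h1 _ _ hx hx
    simp only [← ENNReal.rpow_add_of_nonneg _ _ hθ0 (sub_nonneg.mpr hθ1), add_sub_cancel,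
      ENNReal.rpow_one, hA] at h
    exact h
  simp only [hA]
  have hm2 : ∀ q q', Measurable (fun x3 : ℝ => lpLine q' (fun x2 => A q (x3, x2))) :=
    fun q q' => measurable_lpLine q' (A q) (hm1 q)
  refine le_trans (lpLine_mono r fun x3 => ?_)
    (lpLine_holder θ hθ0 hθ1 r s3 t3 hs3 hsr3 hrt3 h3 _ _ (hm2 s1 s2) (hm2 t1 t2))
  exact le_trans (lpLine_mono r fun x2 => hin x3 x2)
    (lpLine_holder θ hθ0 hθ1 r s2 t2 hs2 hsr2 hrt2 h2 _ _
      ((hm1 s1).comp measurable_prodMk_left) ((hm1 t1).comp measurable_prodMk_left))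
end
end

section
/- Let q⃗ = (q₁,q₂,q₃) with q_j ∈ [2,∞) for each j and 0 ≤ 1/q̄ − 1/2 ≤ 1, where 1/q̄ := 1/q₁+1/q₂+1/q₃. There exists a constant C, depending only on q⃗, such that for every f ∈ C_c^∞(ℝ³): ‖f‖_{L^{q⃗}(ℝ³)} ≤ C · ‖∂₁f‖_{L²(ℝ³)}^{(q₁−2)/(2q₁)} · ‖∂₂f‖_{L²(ℝ³)}^{(q₂−2)/(2q₂)} · ‖∂₃f‖_{L²(ℝ³)}^{(q₃−2)/(2q₃)} · ‖f‖_{L²(ℝ³)}^{1/q̄ − 1/2}, and consequently ‖f‖_{L^{q⃗}(ℝ³)} ≤ C · ‖∇f‖_{L²(ℝ³)}^{3/2 − 1/q̄} · ‖f‖_{L²(ℝ³)}^{1/q̄ − 1/2}. -/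
open MeasureTheory ENNReal Set Metric Filter

noncomputable section

/-- `L²` norm of a scalar function over a set. -/
def l2On (s : Set E3) (g : E3 → ℝ) : ℝ≥0∞ :=
  (∫⁻ x in s, (ENNReal.ofReal |g x|) ^ 2) ^ ((1:ℝ)/2)


/-- One-dimensional `L^p` norm of a nonnegative function. -/
def nrm (p : ℝ) (g : ℝ → ℝ≥0∞) : ℝ≥0∞ := (∫⁻ x, g x ^ p) ^ (1 / p)

/-- Iterated norm. -/
def nrm3 (q1 q2 q3 : ℝ) (u : ℝ → ℝ → ℝ → ℝ≥0∞) : ℝ≥0∞ :=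
  nrm q3 fun z => nrm q2 fun y => nrm q1 fun x => u x y z

/-- Joint measurability of a curried function of three variables. -/
def M3 (u : ℝ → ℝ → ℝ → ℝ≥0∞) : Prop := Measurable fun p : ℝ × ℝ × ℝ => u p.1 p.2.1 p.2.2

theorem M3.comp {α : Type*} [MeasurableSpace α] {u : ℝ → ℝ → ℝ → ℝ≥0∞} (hu : M3 u)
    {a b c : α → ℝ} (ha : Measurable a) (hb : Measurable b) (hc : Measurable c) :
    Measurable fun t => u (a t) (b t) (c t) :=
  Measurable.comp (g := fun p : ℝ × ℝ × ℝ => u p.1 p.2.1 p.2.2) hu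
    (ha.prodMk (hb.prodMk hc))

theorem meas_lint {α : Type*} [MeasurableSpace α] {F : α → ℝ → ℝ≥0∞}
    (hF : Measurable fun z : α × ℝ => F z.1 z.2) : Measurable fun a => ∫⁻ t, F a t :=
  Measurable.lintegral_prod_right hF

theorem meas_nrm {α : Type*} [MeasurableSpace α] {F : α → ℝ → ℝ≥0∞} {p : ℝ}
    (hF : Measurable fun z : α × ℝ => F z.1 z.2) : Measurable fun a => nrm p (fun t => F a t) := by
  unfold nrm
  exact (meas_lint (F := fun a t => F a t ^ p) (hF.pow_const p)).pow_const _

theorem nrm_mono {p : ℝ} (hp : 0 < p) {g h : ℝ → ℝ≥0∞} (H : ∀ x, g x ≤ h x) :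
    nrm p g ≤ nrm p h := by
  unfold nrm
  refine ENNReal.rpow_le_rpow (lintegral_mono fun x => ENNReal.rpow_le_rpow (H x) hp.le) ?_
  positivity

theorem nrm_one (g : ℝ → ℝ≥0∞) : nrm 1 g = ∫⁻ x, g x := by simp [nrm]

theorem nrm_pow {p a : ℝ} (ha : 0 < a) (g : ℝ → ℝ≥0∞) :
    nrm p (fun x => g x ^ a) = nrm (a * p) g ^ a := by
  unfold nrm
  simp_rw [← ENNReal.rpow_mul]
  congr 1
  field_simp

theorem nrm_div {q Q : ℝ} (hQ : 0 < Q) (g : ℝ → ℝ≥0∞) :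
    nrm q g ^ Q = nrm (q / Q) (fun x => g x ^ Q) := by
  rw [nrm_pow hQ, mul_div_cancel₀ _ hQ.ne']

theorem nrm_holder3 {p pA pB pD a b d : ℝ} (hp : 0 < p) (hpA : 0 < pA) (hpB : 0 < pB)
    (hpD : 0 < pD) (ha : 0 ≤ a) (hb : 0 ≤ b) (hd : 0 ≤ d)
    (hs : 1 / p = a / pA + b / pB + d / pD) (c : ℝ≥0∞) {A B D : ℝ → ℝ≥0∞}
    (hA : Measurable A) (hB : Measurable B) (hD : Measurable D) :
    nrm p (fun x => c * A x ^ a * B x ^ b * D x ^ d)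
      ≤ c * nrm pA A ^ a * nrm pB B ^ b * nrm pD D ^ d := by
  have e : ∀ x, (c * A x ^ a * B x ^ b * D x ^ d) ^ p
      = c ^ p * ((A x ^ pA) ^ (a * p / pA) * (B x ^ pB) ^ (b * p / pB)
        * (D x ^ pD) ^ (d * p / pD)) := by
    intro x
    rw [ENNReal.mul_rpow_of_nonneg _ _ hp.le, ENNReal.mul_rpow_of_nonneg _ _ hp.le,
      ENNReal.mul_rpow_of_nonneg _ _ hp.le]
    simp_rw [← ENNReal.rpow_mul]
    rw [mul_div_cancel₀ _ hpA.ne', mul_div_cancel₀ _ hpB.ne', mul_div_cancel₀ _ hpD.ne']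
    ring
  have hH := ENNReal.lintegral_prod_norm_pow_le (μ := (volume : Measure ℝ)) (Finset.univ : Finset (Fin 3))
    (f := ![fun x => A x ^ pA, fun x => B x ^ pB, fun x => D x ^ pD])
    (p := ![a * p / pA, b * p / pB, d * p / pD])
    (by
      intro i _
      fin_cases i
      · exact (hA.pow_const _).aemeasurable
      · exact (hB.pow_const _).aemeasurable
      · exact (hD.pow_const _).aemeasurable)
    (by
      simp only [Fin.sum_univ_three, Matrix.cons_val]
      have : p * (a / pA + b / pB + d / pD) = 1 := by rw [← hs]; field_simp
      rw [← this]; ring)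
    (by
      intro i _
      fin_cases i <;> simp <;> positivity)
  simp only [Fin.prod_univ_three, Matrix.cons_val] at hH
  unfold nrm
  simp_rw [e]
  rw [lintegral_const_mul]
  · refine (ENNReal.rpow_le_rpow (mul_le_mul_right hH _) (by positivity)).trans_eq ?_
    have hp' : 0 ≤ 1 / p := by positivity
    rw [ENNReal.mul_rpow_of_nonneg _ _ hp', ENNReal.mul_rpow_of_nonneg _ _ hp',
      ENNReal.mul_rpow_of_nonneg _ _ hp']
    simp_rw [← ENNReal.rpow_mul]
    rw [mul_one_div_cancel hp.ne', ENNReal.rpow_one, ← mul_assoc, ← mul_assoc]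
    have ex : ∀ t r : ℝ, t * p / r * (1 / p) = 1 / r * t := by intro t r; field_simp
    simp only [ex]
  · exact (((hA.pow_const _).pow_const _).mul ((hB.pow_const _).pow_const _)).mul
      ((hD.pow_const _).pow_const _)

theorem nrm_holder2 {p pA pB a : ℝ} (hp : 0 < p) (hpA : 0 < pA) (hpB : 0 < pB)
    (ha : 0 ≤ a) (hs : 1 / p = a / pA + 1 / pB) {A B : ℝ → ℝ≥0∞}
    (hA : Measurable A) (hB : Measurable B) :
    nrm p (fun x => A x ^ a * B x) ≤ nrm pA A ^ a * nrm pB B := by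
  have := nrm_holder3 hp hpA hpB one_pos ha zero_le_one le_rfl (by rw [hs]; ring) 1 hA hB
    (measurable_const (a := (1 : ℝ≥0∞)))
  simpa using this

theorem minkowski {p : ℝ} (hp : 1 ≤ p) {F : ℝ → ℝ → ℝ≥0∞}
    (hF : Measurable fun z : ℝ × ℝ => F z.1 z.2) :
    nrm p (fun x => ∫⁻ y, F x y) ≤ ∫⁻ y, nrm p (fun x => F x y) := by
  have hF' : Measurable fun z : ℝ × ℝ => F z.2 z.1 := hF.comp measurable_swap
  rcases hp.eq_or_lt with rfl | hp1
  · simp_rw [nrm_one]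
    exact (lintegral_lintegral_swap hF.aemeasurable).le
  have hp0 : 0 < p := by linarith
  set G : ℝ → ℝ≥0∞ := fun x => ∫⁻ y, F x y with hG
  have mG : Measurable G := meas_lint hF
  set T := ∫⁻ y, nrm p (fun x => F x y) with hT
  let Gn : ℕ → ℝ → ℝ≥0∞ := fun n => (Icc (-(n:ℝ)) n).indicator (fun x => min (G x) n)
  have mGn : ∀ n, Measurable (Gn n) := fun n =>
    (mG.min measurable_const).indicator measurableSet_Icc
  have leG : ∀ n x, Gn n x ≤ G x := by
    intro n x
    by_cases hx : x ∈ Icc (-(n:ℝ)) n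
    · simp [Gn, hx]
    · simp [Gn, hx]
  have mono : Monotone Gn := by
    intro m n hmn x
    have hmn' : (m:ℝ) ≤ n := by exact_mod_cast hmn
    have hmn2 : (m:ℝ≥0∞) ≤ n := by exact_mod_cast hmn
    by_cases hx : x ∈ Icc (-(m:ℝ)) m
    · have hx' : x ∈ Icc (-(n:ℝ)) n := ⟨by linarith [hx.1], by linarith [hx.2]⟩
      simp only [Gn, Set.indicator_of_mem hx, Set.indicator_of_mem hx']
      exact min_le_min le_rfl hmn2
    · simp [Gn, hx]
  have sup : ∀ x, ⨆ n, Gn n x = G x := by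
    intro x
    apply le_antisymm (iSup_le fun n => leG n x)
    refine le_of_forall_lt fun c hc => ?_
    obtain ⟨n1, hn1⟩ := ENNReal.exists_nat_gt hc.ne_top
    obtain ⟨n2, hn2⟩ := exists_nat_ge |x|
    have hx : x ∈ Icc (-((max n1 n2 : ℕ):ℝ)) ((max n1 n2 : ℕ):ℝ) := by
      rw [Set.mem_Icc, ← abs_le]; push_cast; exact hn2.trans (le_max_right _ _)
    refine lt_of_lt_of_le ?_ (le_iSup _ (max n1 n2))
    simp only [Gn, Set.indicator_of_mem hx]
    refine lt_min hc (hn1.trans_le ?_)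
    exact_mod_cast le_max_left _ _
  have fin : ∀ n, ∫⁻ x, Gn n x ^ p ≠ ⊤ := by
    intro n
    have : ∀ x, Gn n x ^ p ≤ (Icc (-(n:ℝ)) n).indicator (fun _ => (n:ℝ≥0∞) ^ p) x := by
      intro x
      by_cases hx : x ∈ Icc (-(n:ℝ)) n
      · simp only [Gn, Set.indicator_of_mem hx]
        exact ENNReal.rpow_le_rpow (min_le_right _ _) hp0.le
      · simp [Gn, hx, hp0]
    refine ((lintegral_mono this).trans_lt ?_).ne
    rw [lintegral_indicator_const measurableSet_Icc]
    refine ENNReal.mul_lt_top (ENNReal.rpow_lt_top_of_nonneg hp0.le (by simp)) (by simp)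
  have key : ∀ n, nrm p (Gn n) ≤ T := by
    intro n
    set I := ∫⁻ x, Gn n x ^ p with hI
    have h1 : I ≤ T * I ^ ((p - 1) / p) := by
      calc I ≤ ∫⁻ x, G x * Gn n x ^ (p - 1) := by
            refine lintegral_mono fun x => ?_
            have : Gn n x ^ p = Gn n x * Gn n x ^ (p - 1) := by
              conv_lhs => rw [show p = 1 + (p - 1) by ring]
              rw [ENNReal.rpow_add_of_nonneg _ _ zero_le_one (by linarith), ENNReal.rpow_one]
            simp only [this]
            exact mul_le_mul_left (leG n x) _
        _ = ∫⁻ x, ∫⁻ y, F x y * Gn n x ^ (p - 1) := by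
            refine lintegral_congr fun x => ?_
            rw [lintegral_mul_const]
            exact hF.comp (by fun_prop : Measurable fun y : ℝ => (x, y))
        _ = ∫⁻ y, ∫⁻ x, F x y * Gn n x ^ (p - 1) := by
            refine lintegral_lintegral_swap ?_
            exact (hF.mul (((mGn n).comp measurable_fst).pow_const _)).aemeasurable
        _ ≤ ∫⁻ y, nrm p (fun x => F x y) * I ^ ((p - 1) / p) := by
            refine lintegral_mono fun y => ?_
            have hc : p.HolderConjugate (p / (p - 1)) := Real.HolderConjugate.conjExponent hp1
            have := ENNReal.lintegral_mul_le_Lp_mul_Lq (volume : Measure ℝ) hc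
              (f := fun x => F x y) (g := fun x => Gn n x ^ (p - 1))
              (hF.comp (by fun_prop : Measurable fun x : ℝ => (x, y))).aemeasurable
              ((mGn n).pow_const _).aemeasurable
            simp only [Pi.mul_apply] at this
            refine this.trans_eq ?_
            unfold nrm
            rw [hI]
            have hne : p - 1 ≠ 0 := by linarith
            simp_rw [← ENNReal.rpow_mul]
            rw [mul_div_cancel₀ _ hne, one_div_div]
        _ = T * I ^ ((p - 1) / p) := by
            rw [lintegral_mul_const]
            exact meas_nrm hF'
    rcases eq_or_ne I 0 with h0 | h0
    · unfold nrm
      rw [← hI, h0, ENNReal.zero_rpow_of_pos (by positivity)]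
      exact zero_le
    · have e : I = I ^ (1 / p) * I ^ ((p - 1) / p) := by
        rw [← ENNReal.rpow_add _ _ h0 (fin n)]
        conv_lhs => rw [← ENNReal.rpow_one I]
        congr 1; field_simp; ring
      have a0 : I ^ ((p - 1) / p) ≠ 0 := by
        exact (ENNReal.rpow_pos (pos_iff_ne_zero.2 h0) (fin n)).ne'
      have a1 : I ^ ((p - 1) / p) ≠ ⊤ :=
        ENNReal.rpow_ne_top_of_nonneg (div_nonneg (by linarith) hp0.le) (fin n)
      exact (ENNReal.mul_le_mul_iff_left a0 a1).1 (e.symm.trans_le h1)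
  have lim : ∫⁻ x, G x ^ p = ⨆ n, ∫⁻ x, Gn n x ^ p := by
    rw [← lintegral_iSup (fun n => (mGn n).pow_const p)]
    · refine lintegral_congr fun x => ?_
      rw [← sup x]
      exact (ENNReal.orderIsoRpow p hp0).map_iSup _
    · intro m n h x
      exact ENNReal.rpow_le_rpow (mono h x) hp0.le
  have : ∫⁻ x, G x ^ p ≤ T ^ p := by
    rw [lim]
    refine iSup_le fun n => ?_
    have := ENNReal.rpow_le_rpow (key n) hp0.le
    unfold nrm at this
    rwa [← ENNReal.rpow_mul, one_div_mul_cancel hp0.ne', ENNReal.rpow_one] at this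
  unfold nrm
  have h := ENNReal.rpow_le_rpow this (by positivity : 0 ≤ 1 / p)
  rwa [← ENNReal.rpow_mul, mul_one_div_cancel hp0.ne', ENNReal.rpow_one] at h

theorem nrm3_holder {r1 r2 r3 q1 q2 q3 γ : ℝ} (hr1 : 0 < r1) (hr2 : 0 < r2) (hr3 : 0 < r3)
    (hq1 : 0 < q1) (hq2 : 0 < q2) (hq3 : 0 < q3) (hγ : 0 < γ)
    (e1 : 1 / r1 = γ / q1 + 1 / 2) (e2 : 1 / r2 = γ / q2 + 1 / 2) (e3 : 1 / r3 = γ / q3 + 1 / 2)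
    {u d : ℝ → ℝ → ℝ → ℝ≥0∞} (hu : M3 u) (hd : M3 d) :
    nrm3 r1 r2 r3 (fun x y z => u x y z ^ γ * d x y z)
      ≤ nrm3 q1 q2 q3 u ^ γ * nrm3 2 2 2 d := by
  unfold nrm3
  have m1 : ∀ (p : ℝ) {w : ℝ → ℝ → ℝ → ℝ≥0∞} (_ : M3 w) (z : ℝ),
      Measurable fun y => nrm p fun x => w x y z := fun p w hw z =>
    meas_nrm (F := fun y x => w x y z) (hw.comp (by fun_prop) (by fun_prop) (by fun_prop))
  have m2 : ∀ (p q : ℝ) {w : ℝ → ℝ → ℝ → ℝ≥0∞} (_ : M3 w),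
      Measurable fun z => nrm q fun y => nrm p fun x => w x y z := fun p q w hw =>
    meas_nrm (F := fun z y => nrm p fun x => w x y z)
      (meas_nrm (F := fun (t : ℝ × ℝ) x => w x t.2 t.1)
        (hw.comp (by fun_prop) (by fun_prop) (by fun_prop)))
  calc _ ≤ nrm r3 (fun z => nrm r2 fun y =>
          (nrm q1 fun x => u x y z) ^ γ * nrm 2 fun x => d x y z) := by
        refine nrm_mono hr3 fun z => nrm_mono hr2 fun y => ?_
        exact nrm_holder2 hr1 hq1 two_pos hγ.le e1
          (hu.comp (by fun_prop) (by fun_prop) (by fun_prop))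
          (hd.comp (by fun_prop) (by fun_prop) (by fun_prop))
    _ ≤ nrm r3 (fun z => (nrm q2 fun y => nrm q1 fun x => u x y z) ^ γ *
          nrm 2 fun y => nrm 2 fun x => d x y z) := by
        refine nrm_mono hr3 fun z => ?_
        exact nrm_holder2 hr2 hq2 two_pos hγ.le e2 (m1 _ hu z) (m1 _ hd z)
    _ ≤ _ := nrm_holder2 hr3 hq3 two_pos hγ.le e3 (m2 _ _ hu) (m2 _ _ hd)

/-- The abstract data for the inequality. -/
structure Dat (u d1 d2 d3 : ℝ → ℝ → ℝ → ℝ≥0∞) : Prop where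
  mu : M3 u
  m1 : M3 d1
  m2 : M3 d2
  m3 : M3 d3
  bd : ∃ M R : ℝ, ∀ x y z, u x y z ≤ (Icc (-R) R).indicator (fun _ => ENNReal.ofReal M) x ∧
    u x y z ≤ (Icc (-R) R).indicator (fun _ => ENNReal.ofReal M) y ∧
    u x y z ≤ (Icc (-R) R).indicator (fun _ => ENNReal.ofReal M) z
  i1 : ∀ γ : ℝ, 1 ≤ γ → ∀ x y z,
    u x y z ^ (γ + 1) ≤ ENNReal.ofReal (γ + 1) * ∫⁻ t, u t y z ^ γ * d1 t y z
  i2 : ∀ γ : ℝ, 1 ≤ γ → ∀ x y z,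
    u x y z ^ (γ + 1) ≤ ENNReal.ofReal (γ + 1) * ∫⁻ t, u x t z ^ γ * d2 x t z
  i3 : ∀ γ : ℝ, 1 ≤ γ → ∀ x y z,
    u x y z ^ (γ + 1) ≤ ENNReal.ofReal (γ + 1) * ∫⁻ t, u x y t ^ γ * d3 x y t

theorem nrm_box_ne_top {p R : ℝ} (hp : 0 < p) {K : ℝ≥0∞} (hK : K ≠ ⊤) :
    nrm p ((Icc (-R) R).indicator (fun _ => K)) ≠ ⊤ := by
  unfold nrm
  refine ENNReal.rpow_ne_top_of_nonneg (by positivity) ?_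
  have : ∀ x, ((Icc (-R) R).indicator (fun _ => K) x) ^ p
      = (Icc (-R) R).indicator (fun _ => K ^ p) x := by
    intro x
    by_cases hx : x ∈ Icc (-R) R
    · simp [hx]
    · simp [hx, hp]
  simp_rw [this]
  rw [lintegral_indicator_const measurableSet_Icc]
  exact ENNReal.mul_ne_top (ENNReal.rpow_ne_top_of_nonneg hp.le hK) (by simp)

theorem nrm_zero {p : ℝ} (hp : 0 < p) : nrm p (fun _ => 0) = 0 := by
  simp [nrm, hp]

theorem nrm_ind_le {p R y : ℝ} (hp : 0 < p) {K : ℝ≥0∞} {g : ℝ → ℝ≥0∞} 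
    (h1 : nrm p g ≤ K) (h2 : ∀ x, g x ≤ (Icc (-R) R).indicator (fun _ => ⊤) y) :
    nrm p g ≤ (Icc (-R) R).indicator (fun _ => K) y := by
  by_cases hy : y ∈ Icc (-R) R
  · simpa [hy] using h1
  · have : g = fun _ => 0 := by
      funext x
      have := h2 x
      simpa [hy] using this
    rw [this, nrm_zero hp]
    exact zero_le

theorem Dat.ne_top {u d1 d2 d3 : ℝ → ℝ → ℝ → ℝ≥0∞} (D : Dat u d1 d2 d3) {q1 q2 q3 : ℝ}
    (hq1 : 0 < q1) (hq2 : 0 < q2) (hq3 : 0 < q3) : nrm3 q1 q2 q3 u ≠ ⊤ := by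
  obtain ⟨M, R, h⟩ := D.bd
  have top : ∀ t, (Icc (-R) R).indicator (fun _ => ENNReal.ofReal M) t
      ≤ (Icc (-R) R).indicator (fun _ => ⊤) t := fun t =>
    Set.indicator_le_indicator le_top
  set K1 := nrm q1 ((Icc (-R) R).indicator (fun _ => ENNReal.ofReal M)) with hK1
  have k1 : K1 ≠ ⊤ := nrm_box_ne_top hq1 (by simp)
  have b1 : ∀ y z, nrm q1 (fun x => u x y z) ≤ K1 := fun y z => nrm_mono hq1 fun x => (h x y z).1
  set K2 := nrm q2 ((Icc (-R) R).indicator (fun _ => K1)) with hK2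
  have k2 : K2 ≠ ⊤ := nrm_box_ne_top hq2 k1
  have b2 : ∀ z, nrm q2 (fun y => nrm q1 (fun x => u x y z)) ≤ K2 := fun z =>
    nrm_mono hq2 fun y => nrm_ind_le hq1 (b1 y z) fun x => ((h x y z).2.1).trans (top y)
  refine ne_top_of_le_ne_top (nrm_box_ne_top hq3 k2 (R := R)) (nrm_mono hq3 fun z => ?_)
  refine nrm_ind_le hq2 (b2 z) fun y => ?_
  refine (nrm_ind_le hq1 (le_top) fun x => ((h x y z).2.2).trans (top z))

/-- Integral form of the exponents. -/
theorem core {q1 q2 q3 : ℝ} (hq3 : 2 ≤ q3) (h32 : q3 ≤ q2) (h21 : q2 ≤ q1)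
    (h0 : 0 ≤ 1/q1 + 1/q2 + 1/q3 - 1/2) : ∃ c : ℝ≥0∞, c ≠ ⊤ ∧ ∀ u d1 d2 d3, Dat u d1 d2 d3 →
    nrm3 q1 q2 q3 u ^ (2:ℝ) ≤ c * nrm3 2 2 2 u ^ (2 * (1/q1 + 1/q2 + 1/q3 - 1/2))
      * nrm3 2 2 2 d1 ^ (2 * ((q1 - 2)/(2*q1))) * nrm3 2 2 2 d2 ^ (2 * ((q2 - 2)/(2*q2)))
      * nrm3 2 2 2 d3 ^ (2 * ((q3 - 2)/(2*q3))) := by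
  have hq2 : 2 ≤ q2 := by linarith
  have hq1 : 2 ≤ q1 := by linarith
  have p1 : 0 < q1 := by linarith
  have p2 : 0 < q2 := by linarith
  have p3 : 0 < q3 := by linarith
  set s0 := 1/q1 + 1/q2 + 1/q3 - 1/2 with hs0
  set s1 := (q1 - 2)/(2*q1) with hs1
  set s2 := (q2 - 2)/(2*q2) with hs2
  set s3 := (q3 - 2)/(2*q3) with hs3
  have n1 : 0 ≤ s1 := div_nonneg (by linarith) (by linarith)
  have n2 : 0 ≤ s2 := div_nonneg (by linarith) (by linarith)
  have n3 : 0 ≤ s3 := div_nonneg (by linarith) (by linarith)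
  obtain ⟨Q, hQ⟩ : ∃ Q, Q = (q1 + q2 + q3) / 2 - 1 := ⟨_, rfl⟩
  have pQ : 0 < Q := by rw [hQ]; linarith
  have eQ : Q = 2 * s0 + (q1/2+1) * (2*s1) + (q2/2+1) * (2*s2) + (q3/2+1) * (2*s3) := by
    rw [hQ, hs0, hs1, hs2, hs3]; field_simp; ring
  have eQ2 : Q = 2 + q1/2 * (2*s1) + q2/2 * (2*s2) + q3/2 * (2*s3) := by
    rw [hQ, hs1, hs2, hs3]; field_simp; ring
  have pR : ∀ {a b : ℝ}, 0 < a → 0 < b → 0 < 2 * b / (a + b) := fun ha hb => by positivity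
  have f1 : 1 / (q1 / Q) = 2 * s0 / 2 + 2 * s2 / (2 * q1 / (q2 + q1))
      + 2 * s3 / (2 * q1 / (q3 + q1)) := by
    rw [hQ, hs0, hs2, hs3]; field_simp; ring
  have f2 : 1 / (q2 / Q) = 2 * s0 / 2 + 2 * s1 / (2 * q2 / (q1 + q2))
      + 2 * s3 / (2 * q2 / (q3 + q2)) := by
    rw [hQ, hs0, hs1, hs3]; field_simp; ring
  have f3 : 1 / (q3 / Q) = 2 * s0 / 2 + 2 * s1 / (2 * q3 / (q1 + q3))
      + 2 * s2 / (2 * q3 / (q2 + q3)) := by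
    rw [hQ, hs0, hs1, hs2]; field_simp; ring
  have gR : ∀ {a b : ℝ}, 0 < a → 0 < b → 1 / (2 * b / (a + b)) = a / 2 / b + 1 / 2 :=
    fun ha hb => by field_simp
  have g1 : ∀ {a : ℝ}, 0 < a → (1:ℝ) / 1 = a / 2 / a + 1 / 2 := fun ha => by field_simp; norm_num
  clear_value s0 s1 s2 s3
  set c : ℝ≥0∞ := ENNReal.ofReal (q1/2+1) ^ (2*s1) * ENNReal.ofReal (q2/2+1) ^ (2*s2)
    * ENNReal.ofReal (q3/2+1) ^ (2*s3) with hc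
  have cT : c ≠ ⊤ := by
    refine ENNReal.mul_ne_top (ENNReal.mul_ne_top ?_ ?_) ?_ <;>
    exact ENNReal.rpow_ne_top_of_nonneg (by positivity) (by simp)
  refine ⟨c, cT, fun u d1 d2 d3 D => ?_⟩
  -- the functions G_i
  set h1 : ℝ → ℝ → ℝ → ℝ≥0∞ := fun x y z => u x y z ^ (q1/2) * d1 x y z with hh1
  set h2 : ℝ → ℝ → ℝ → ℝ≥0∞ := fun x y z => u x y z ^ (q2/2) * d2 x y z with hh2
  set h3 : ℝ → ℝ → ℝ → ℝ≥0∞ := fun x y z => u x y z ^ (q3/2) * d3 x y z with hh3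
  have mh1 : M3 h1 := (Measurable.pow_const D.mu _).mul D.m1
  have mh2 : M3 h2 := (Measurable.pow_const D.mu _).mul D.m2
  have mh3 : M3 h3 := (Measurable.pow_const D.mu _).mul D.m3
  set G1 : ℝ → ℝ → ℝ≥0∞ := fun y z => ∫⁻ x, h1 x y z with hG1
  set G2 : ℝ → ℝ → ℝ≥0∞ := fun x z => ∫⁻ y, h2 x y z with hG2
  set G3 : ℝ → ℝ → ℝ≥0∞ := fun x y => ∫⁻ z, h3 x y z with hG3
  have mG1 : Measurable fun t : ℝ × ℝ => G1 t.1 t.2 :=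
    meas_lint (F := fun (t : ℝ × ℝ) x => h1 x t.1 t.2)
      (mh1.comp (by fun_prop) (by fun_prop) (by fun_prop))
  have mG2 : Measurable fun t : ℝ × ℝ => G2 t.1 t.2 :=
    meas_lint (F := fun (t : ℝ × ℝ) x => h2 t.1 x t.2)
      (mh2.comp (by fun_prop) (by fun_prop) (by fun_prop))
  have mG3 : Measurable fun t : ℝ × ℝ => G3 t.1 t.2 :=
    meas_lint (F := fun (t : ℝ × ℝ) x => h3 t.1 t.2 x)
      (mh3.comp (by fun_prop) (by fun_prop) (by fun_prop))
  have sl : ∀ {g : ℝ → ℝ → ℝ≥0∞}, (Measurable fun t : ℝ × ℝ => g t.1 t.2) →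
      ∀ z, Measurable fun y => g y z := fun hg z =>
    hg.comp (by fun_prop : Measurable fun y : ℝ => (y, z))
  have sw : ∀ {g : ℝ → ℝ → ℝ≥0∞}, (Measurable fun t : ℝ × ℝ => g t.1 t.2) →
      Measurable fun t : ℝ × ℝ => g t.2 t.1 := fun hg => hg.comp measurable_swap
  have pw : ∀ x y z, u x y z ^ Q ≤
      c * G1 y z ^ (2*s1) * u x y z ^ (2*s0) * G2 x z ^ (2*s2) * G3 x y ^ (2*s3) := by
    intro x y z
    have i1 := D.i1 (q1/2) (by linarith) x y z
    have i2 := D.i2 (q2/2) (by linarith) x y z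
    have i3 := D.i3 (q3/2) (by linarith) x y z
    have a1 : 0 ≤ (q1/2+1) * (2*s1) := by positivity
    have a2 : 0 ≤ (q2/2+1) * (2*s2) := by positivity
    have a3 : 0 ≤ (q3/2+1) * (2*s3) := by positivity
    have b1 := ENNReal.rpow_le_rpow i1 (by positivity : 0 ≤ 2 * s1)
    have b2 := ENNReal.rpow_le_rpow i2 (by positivity : 0 ≤ 2 * s2)
    have b3 := ENNReal.rpow_le_rpow i3 (by positivity : 0 ≤ 2 * s3)
    rw [ENNReal.mul_rpow_of_nonneg _ _ (by positivity)] at b1 b2 b3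
    rw [eQ, ENNReal.rpow_add_of_nonneg _ _ (by positivity) a3,
      ENNReal.rpow_add_of_nonneg _ _ (by positivity) a2,
      ENNReal.rpow_add_of_nonneg _ _ (by positivity) a1]
    rw [ENNReal.rpow_mul _ (q1/2+1), ENNReal.rpow_mul _ (q2/2+1), ENNReal.rpow_mul _ (q3/2+1)]
    refine (mul_le_mul' (mul_le_mul' (mul_le_mul' le_rfl b1) b2) b3).trans_eq ?_
    rw [hc]
    ring
  -- step 1
  set H2 : ℝ → ℝ≥0∞ := fun z => nrm (2 * q1 / (q2 + q1)) fun x => G2 x z with hH2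
  set H3 : ℝ → ℝ≥0∞ := fun y => nrm (2 * q1 / (q3 + q1)) fun x => G3 x y with hH3
  have mH2 : Measurable H2 := meas_nrm (F := fun z x => G2 x z) (sw mG2)
  have mH3 : Measurable H3 := meas_nrm (F := fun z x => G3 x z) (sw mG3)
  have st1 : ∀ y z, (nrm q1 fun x => u x y z) ^ Q ≤ 
      c * H2 z ^ (2*s2) * (nrm 2 fun x => u x y z) ^ (2*s0) * G1 y z ^ (2*s1) 
        * H3 y ^ (2*s3) := by
    intro y z
    rw [nrm_div pQ]
    refine (nrm_mono (by positivity) fun x => pw x y z).trans ?_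
    refine (nrm_holder3 (by positivity) two_pos (pR p2 p1) (pR p3 p1) (by positivity)
      (by positivity) (by positivity) f1 _
      (D.mu.comp (by fun_prop) (by fun_prop) (by fun_prop)) (sl mG2 z) (sl mG3 y)).trans_eq ?_
    ring
  have mu2 : Measurable fun t : ℝ × ℝ => nrm 2 fun x => u x t.1 t.2 :=
    meas_nrm (F := fun (t : ℝ × ℝ) x => u x t.1 t.2)
      (D.mu.comp (by fun_prop) (by fun_prop) (by fun_prop))
  set J1 : ℝ → ℝ≥0∞ := fun z => nrm (2 * q2 / (q1 + q2)) fun y => G1 y z with hJ1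
  have mJ1 : Measurable J1 := meas_nrm (F := fun z x => G1 x z) (sw mG1)
  set J3 : ℝ≥0∞ := nrm (2 * q2 / (q3 + q2)) H3 with hJ3
  have st2 : ∀ z, (nrm q2 fun y => nrm q1 fun x => u x y z) ^ Q ≤ 
      c * J3 ^ (2*s3) * (nrm 2 fun y => nrm 2 fun x => u x y z) ^ (2*s0) * J1 z ^ (2*s1) 
        * H2 z ^ (2*s2) := by
    intro z
    rw [nrm_div pQ]
    refine (nrm_mono (by positivity) fun y => st1 y z).trans ?_
    refine (nrm_holder3 (by positivity) two_pos (pR p1 p2) (pR p3 p2) (by positivity)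
      (by positivity) (by positivity) f2 _ (sl (g := fun y z => nrm 2 fun x => u x y z) mu2 z) (sl mG1 z) mH3).trans_eq ?_
    ring
  have st3 : nrm3 q1 q2 q3 u ^ Q ≤ 
      c * J3 ^ (2*s3) * (nrm3 2 2 2 u) ^ (2*s0) * (nrm (2 * q3 / (q1 + q3)) J1) ^ (2*s1) 
        * (nrm (2 * q3 / (q2 + q3)) H2) ^ (2*s2) := by
    unfold nrm3
    rw [nrm_div pQ]
    refine (nrm_mono (by positivity) fun z => st2 z).trans ?_
    exact (nrm_holder3 (by positivity) two_pos (pR p1 p3) (pR p2 p3) (by positivity)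
      (by positivity) (by positivity) f3 _ (meas_nrm (F := fun z y => nrm 2 fun x => u x y z)
        (sw (g := fun y z => nrm 2 fun x => u x y z) mu2)) mJ1 mH2)
  -- bounds
  set N := nrm3 q1 q2 q3 u with hN
  have k1 : nrm (2 * q3 / (q1 + q3)) J1 ≤ N ^ (q1/2) * nrm3 2 2 2 d1 := by
    refine le_trans (le_of_eq ?_) (nrm3_holder (r1 := 1) one_pos (pR p1 p2) (pR p1 p3) p1 p2 p3
      (by positivity) (g1 p1) (gR p1 p2) (gR p1 p3) D.mu D.m1)
    simp only [nrm3, nrm_one, hJ1, hG1, hh1]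
  have k2 : nrm (2 * q3 / (q2 + q3)) H2 ≤ N ^ (q2/2) * nrm3 2 2 2 d2 := by
    refine le_trans ?_ (nrm3_holder (r2 := 1) (pR p2 p1) one_pos (pR p2 p3) p1 p2 p3
      (by positivity) (gR p2 p1) (g1 p2) (gR p2 p3) D.mu D.m2)
    refine nrm_mono (pR p2 p3) fun z => ?_
    rw [nrm_one]
    refine minkowski ?_ (F := fun x y => h2 x y z) 
      (mh2.comp (by fun_prop) (by fun_prop) (by fun_prop))
    rw [le_div_iff₀ (by positivity)]; linarith
  have k3 : J3 ≤ N ^ (q3/2) * nrm3 2 2 2 d3 := by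
    refine le_trans ?_ (nrm3_holder (r3 := 1) (pR p3 p1) (pR p3 p2) one_pos p1 p2 p3
      (by positivity) (gR p3 p1) (gR p3 p2) (g1 p3) D.mu D.m3)
    unfold nrm3
    rw [nrm_one]
    refine (nrm_mono (pR p3 p2) (h := fun y => ∫⁻ z, nrm (2 * q1 / (q3 + q1)) 
      fun x => h3 x y z) fun y => ?_).trans ?_
    · refine minkowski ?_ (F := fun x z => h3 x y z) 
        (mh3.comp (by fun_prop) (by fun_prop) (by fun_prop))
      rw [le_div_iff₀ (by positivity)]; linarith
    · refine minkowski ?_ (F := fun y z => nrm (2 * q1 / (q3 + q1)) fun x => h3 x y z) 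
        (meas_nrm (F := fun (t : ℝ × ℝ) x => h3 x t.1 t.2)
          (mh3.comp (by fun_prop) (by fun_prop) (by fun_prop)))
      rw [le_div_iff₀ (by positivity)]; linarith
  rcases eq_or_ne N 0 with N0 | N0
  · rw [N0, ENNReal.zero_rpow_of_pos two_pos]; exact zero_le
  have NT : N ≠ ⊤ := D.ne_top p1 p2 p3
  have b1 := ENNReal.rpow_le_rpow k1 (by positivity : 0 ≤ 2 * s1)
  have b2 := ENNReal.rpow_le_rpow k2 (by positivity : 0 ≤ 2 * s2)
  have b3 := ENNReal.rpow_le_rpow k3 (by positivity : 0 ≤ 2 * s3)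
  rw [ENNReal.mul_rpow_of_nonneg _ _ (by positivity), ← ENNReal.rpow_mul] at b1 b2 b3
  have fin := st3.trans (mul_le_mul' (mul_le_mul' (mul_le_mul' (mul_le_mul' (le_refl c) b3)
    le_rfl) b1) b2)
  rw [eQ2, ENNReal.rpow_add_of_nonneg _ _ (by positivity) (by positivity),
      ENNReal.rpow_add_of_nonneg _ _ (by positivity) (by positivity),
      ENNReal.rpow_add_of_nonneg _ _ (by positivity) (by positivity)] at fin
  set A := N ^ (q1 / 2 * (2 * s1)) * N ^ (q2 / 2 * (2 * s2)) * N ^ (q3 / 2 * (2 * s3)) with hA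
  have A0 : A ≠ 0 := mul_ne_zero (mul_ne_zero (ENNReal.rpow_pos (pos_iff_ne_zero.2 N0) NT).ne'
    (ENNReal.rpow_pos (pos_iff_ne_zero.2 N0) NT).ne') (ENNReal.rpow_pos (pos_iff_ne_zero.2 N0) NT).ne'
  have AT : A ≠ ⊤ := by
    refine ENNReal.mul_ne_top (ENNReal.mul_ne_top ?_ ?_) ?_ <;>
    exact ENNReal.rpow_ne_top_of_nonneg (by positivity) NT
  refine (ENNReal.mul_le_mul_iff_left A0 AT).1 ?_
  calc _ = _ := by rw [hA]; ring
    _ ≤ _ := fin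
    _ = _ := by rw [hA]; ring

theorem nrm_swap {q r : ℝ} (hq : 0 < q) (hqr : q ≤ r) {F : ℝ → ℝ → ℝ≥0∞}
    (hF : Measurable fun z : ℝ × ℝ => F z.1 z.2) :
    nrm r (fun y => nrm q fun x => F x y) ≤ nrm q (fun x => nrm r fun y => F x y) := by
  have key : nrm r (fun y => nrm q fun x => F x y) ^ q
      ≤ nrm q (fun x => nrm r fun y => F x y) ^ q := by
    rw [nrm_div hq, nrm_div hq, div_self hq.ne', nrm_one]
    have e : ∀ y, (nrm q fun x => F x y) ^ q = ∫⁻ x, F x y ^ q := by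
      intro y
      rw [nrm_div hq, div_self hq.ne', nrm_one]
    simp_rw [e, nrm_div hq]
    exact minkowski ((one_le_div hq).2 hqr) (F := fun y x => F x y ^ q)
      ((hF.comp measurable_swap).pow_const q)
  exact (ENNReal.rpow_le_rpow_iff hq).1 key

theorem nrm3_swap12 {q1 q2 q3 : ℝ} (h1 : 0 < q1) (h12 : q1 ≤ q2) (h3 : 0 < q3)
    {u : ℝ → ℝ → ℝ → ℝ≥0∞} (hu : M3 u) :
    nrm3 q1 q2 q3 u ≤ nrm3 q2 q1 q3 (fun x y z => u y x z) := by
  refine nrm_mono h3 fun z => ?_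
  exact nrm_swap h1 h12 (F := fun x y => u x y z)
    (hu.comp (by fun_prop) (by fun_prop) (by fun_prop))

theorem nrm3_swap23 {q1 q2 q3 : ℝ} (h2 : 0 < q2) (h23 : q2 ≤ q3)
    {u : ℝ → ℝ → ℝ → ℝ≥0∞} (hu : M3 u) :
    nrm3 q1 q2 q3 u ≤ nrm3 q1 q3 q2 (fun x y z => u x z y) := by
  exact nrm_swap h2 h23 (F := fun y z => nrm q1 fun x => u x y z)
    (meas_nrm (F := fun (t : ℝ × ℝ) x => u x t.1 t.2)
      (hu.comp (by fun_prop) (by fun_prop) (by fun_prop)))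

theorem M3.swap12 {u : ℝ → ℝ → ℝ → ℝ≥0∞} (hu : M3 u) : M3 (fun x y z => u y x z) :=
  hu.comp (by fun_prop) (by fun_prop) (by fun_prop)

theorem M3.swap23 {u : ℝ → ℝ → ℝ → ℝ≥0∞} (hu : M3 u) : M3 (fun x y z => u x z y) :=
  hu.comp (by fun_prop) (by fun_prop) (by fun_prop)

theorem nrm3_two_swap12 {u : ℝ → ℝ → ℝ → ℝ≥0∞} (hu : M3 u) :
    nrm3 2 2 2 (fun x y z => u y x z) = nrm3 2 2 2 u :=
  le_antisymm (nrm3_swap12 two_pos le_rfl two_pos hu.swap12)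
    (nrm3_swap12 two_pos le_rfl two_pos hu)

theorem nrm3_two_swap23 {u : ℝ → ℝ → ℝ → ℝ≥0∞} (hu : M3 u) :
    nrm3 2 2 2 (fun x y z => u x z y) = nrm3 2 2 2 u :=
  le_antisymm (nrm3_swap23 two_pos le_rfl hu.swap23)
    (nrm3_swap23 two_pos le_rfl hu)

theorem Dat.swap12 {u d1 d2 d3 : ℝ → ℝ → ℝ → ℝ≥0∞} (D : Dat u d1 d2 d3) :
    Dat (fun x y z => u y x z) (fun x y z => d2 y x z) (fun x y z => d1 y x z)
      (fun x y z => d3 y x z) where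
  mu := D.mu.swap12
  m1 := D.m2.swap12
  m2 := D.m1.swap12
  m3 := D.m3.swap12
  bd := by
    obtain ⟨M, R, h⟩ := D.bd
    exact ⟨M, R, fun x y z => ⟨(h y x z).2.1, (h y x z).1, (h y x z).2.2⟩⟩
  i1 := fun γ hγ x y z => D.i2 γ hγ y x z
  i2 := fun γ hγ x y z => D.i1 γ hγ y x z
  i3 := fun γ hγ x y z => D.i3 γ hγ y x z

theorem Dat.swap23 {u d1 d2 d3 : ℝ → ℝ → ℝ → ℝ≥0∞} (D : Dat u d1 d2 d3) :
    Dat (fun x y z => u x z y) (fun x y z => d1 x z y) (fun x y z => d3 x z y)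
      (fun x y z => d2 x z y) where
  mu := D.mu.swap23
  m1 := D.m1.swap23
  m2 := D.m3.swap23
  m3 := D.m2.swap23
  bd := by
    obtain ⟨M, R, h⟩ := D.bd
    exact ⟨M, R, fun x y z => ⟨(h x z y).1, (h x z y).2.2, (h x z y).2.1⟩⟩
  i1 := fun γ hγ x y z => D.i1 γ hγ x z y
  i2 := fun γ hγ x y z => D.i3 γ hγ x z y
  i3 := fun γ hγ x y z => D.i2 γ hγ x z y

/-- The abstract inequality for a given triple of exponents. -/
def Ineq (q1 q2 q3 : ℝ) : Prop :=
  ∃ c : ℝ≥0∞, c ≠ ⊤ ∧ ∀ u d1 d2 d3, Dat u d1 d2 d3 →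
    nrm3 q1 q2 q3 u ^ (2:ℝ) ≤ c * nrm3 2 2 2 u ^ (2 * (1/q1 + 1/q2 + 1/q3 - 1/2))
      * nrm3 2 2 2 d1 ^ (2 * ((q1 - 2)/(2*q1))) * nrm3 2 2 2 d2 ^ (2 * ((q2 - 2)/(2*q2)))
      * nrm3 2 2 2 d3 ^ (2 * ((q3 - 2)/(2*q3)))

theorem Ineq.swap12 {q1 q2 q3 : ℝ} (h1 : 0 < q1) (h12 : q1 ≤ q2) (h3 : 0 < q3)
    (H : Ineq q2 q1 q3) : Ineq q1 q2 q3 := by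
  obtain ⟨c, hc, H⟩ := H
  refine ⟨c, hc, fun u d1 d2 d3 D => ?_⟩
  refine (ENNReal.rpow_le_rpow (nrm3_swap12 h1 h12 h3 D.mu) zero_le_two).trans
    ((H _ _ _ _ D.swap12).trans_eq ?_)
  rw [nrm3_two_swap12 D.mu, nrm3_two_swap12 D.m1, nrm3_two_swap12 D.m2, nrm3_two_swap12 D.m3,
    add_comm (1 / q2) (1 / q1)]
  ring

theorem Ineq.swap23 {q1 q2 q3 : ℝ} (h2 : 0 < q2) (h23 : q2 ≤ q3)
    (H : Ineq q1 q3 q2) : Ineq q1 q2 q3 := by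
  obtain ⟨c, hc, H⟩ := H
  refine ⟨c, hc, fun u d1 d2 d3 D => ?_⟩
  refine (ENNReal.rpow_le_rpow (nrm3_swap23 h2 h23 D.mu) zero_le_two).trans
    ((H _ _ _ _ D.swap23).trans_eq ?_)
  rw [nrm3_two_swap23 D.mu, nrm3_two_swap23 D.m1, nrm3_two_swap23 D.m2, nrm3_two_swap23 D.m3,
    add_right_comm (1 / q1) (1 / q3)]
  ring

theorem ineq_all {q1 q2 q3 : ℝ} (hq1 : 2 ≤ q1) (hq2 : 2 ≤ q2) (hq3 : 2 ≤ q3)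
    (h0 : 0 ≤ 1/q1 + 1/q2 + 1/q3 - 1/2) : Ineq q1 q2 q3 := by
  have A : ∀ {a b c : ℝ}, 2 ≤ a → 2 ≤ b → 2 ≤ c → 0 ≤ 1/a + 1/b + 1/c - 1/2 → b ≤ a → c ≤ b →
      Ineq a b c := fun ha hb hc h hab hbc => core hc hbc hab h
  -- smallest-last insertion
  have B : ∀ {a b c : ℝ}, 2 ≤ a → 2 ≤ b → 2 ≤ c → 0 ≤ 1/a + 1/b + 1/c - 1/2 → c ≤ a → c ≤ b →
      Ineq a b c := by
    intro a b c ha hb hc h hca hcb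
    rcases le_total b a with hba | hab
    · exact A ha hb hc h hba hcb
    · exact Ineq.swap12 (by linarith) hab (by linarith) (A hb ha hc (by linarith) hab hca)
  have Cc : ∀ {a b c : ℝ}, 2 ≤ a → 2 ≤ b → 2 ≤ c → 0 ≤ 1/a + 1/b + 1/c - 1/2 → b ≤ a →
      Ineq a b c := by
    intro a b c ha hb hc h hba
    rcases le_total c b with hcb | hbc
    · exact B ha hb hc h (hcb.trans hba) hcb
    · exact Ineq.swap23 (by linarith) hbc (B ha hc hb (by linarith) hba hbc)
  rcases le_total q2 q1 with h | h
  · exact Cc hq1 hq2 hq3 h0 h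
  · exact Ineq.swap12 (by linarith) h (by linarith) (Cc hq2 hq1 hq3 (by linarith) h)

theorem one_dim {g : ℝ → ℝ} (hg : ContDiff ℝ 1 g) (hc : HasCompactSupport g) {γ : ℝ} (hγ : 1 ≤ γ)
    (x : ℝ) : ENNReal.ofReal |g x| ^ (γ + 1) ≤
      ENNReal.ofReal (γ + 1) * ∫⁻ t, ENNReal.ofReal |g t| ^ γ * ENNReal.ofReal |deriv g t| := by
  have h1 : 1 < γ + 1 := by linarith
  have hC : ContDiff ℝ 1 (fun t => ‖g t‖ ^ (γ + 1)) := hg.norm_rpow h1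
  have hs : HasCompactSupport (fun t => ‖g t‖ ^ (γ + 1)) :=
    hc.comp_left (g := fun y : ℝ => ‖y‖ ^ (γ + 1)) (by
      simp only [norm_zero]; exact Real.zero_rpow (by linarith))
  have h := HasCompactSupport.enorm_le_lintegral_Ici_deriv hC hs x
  have hd : ∀ t, HasDerivAt (fun t => ‖g t‖ ^ (γ + 1))
      ((γ + 1) * |g t| ^ (γ + 1 - 2) * g t * deriv g t) t := fun t =>
    (hasDerivAt_abs_rpow (g t) h1).comp t (hg.differentiable one_ne_zero t).hasDerivAt
  have hl : ENNReal.ofReal |g x| ^ (γ + 1) = ‖‖g x‖ ^ (γ + 1)‖ₑ := by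
    rw [Real.enorm_eq_ofReal (by positivity), ENNReal.ofReal_rpow_of_nonneg (abs_nonneg _)
      (by linarith), Real.norm_eq_abs]
  rw [hl]
  refine h.trans ((setLIntegral_le_lintegral _ _).trans ?_)
  rw [← lintegral_const_mul' _ _ (by simp)]
  refine lintegral_mono fun t => le_of_eq ?_
  rw [(hd t).deriv, Real.enorm_eq_ofReal_abs, ENNReal.ofReal_rpow_of_nonneg (abs_nonneg _)
      (by linarith), ← ENNReal.ofReal_mul (by positivity), ← ENNReal.ofReal_mul (by linarith)]
  congr 1
  rw [abs_mul, abs_mul, abs_mul, abs_of_pos (by linarith : 0 < γ + 1), abs_of_nonneg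
    (Real.rpow_nonneg (abs_nonneg (g t)) _)]
  have : |g t| ^ (γ + 1 - 2) * |g t| = |g t| ^ γ := by
    rcases (abs_nonneg (g t)).eq_or_lt with h0 | h0
    · rw [← h0, mul_zero, Real.zero_rpow (by linarith)]
    · rw [← Real.rpow_add_one h0.ne']; congr 1; ring
  rw [← this]; ring

theorem line_ineq {f : E3 → ℝ} (hf : ContDiff ℝ 1 f) (hc : HasCompactSupport f) (i : Fin 3)
    (p : E3) {γ : ℝ} (hγ : 1 ≤ γ) (x : ℝ) :
    ENNReal.ofReal |f (p + x • EuclideanSpace.single i (1:ℝ))| ^ (γ + 1) ≤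
      ENNReal.ofReal (γ + 1) * ∫⁻ t : ℝ, ENNReal.ofReal |f (p + t • EuclideanSpace.single i (1:ℝ))| ^ γ *
        ENNReal.ofReal |pd i f (p + t • EuclideanSpace.single i (1:ℝ))| := by
  set e : E3 := EuclideanSpace.single i 1 with he
  have hL : ∀ t, HasDerivAt (fun t : ℝ => p + t • e) e t := by
    intro t
    simpa using ((hasDerivAt_id t).smul_const e).const_add p
  have hd : ∀ t, deriv (fun t : ℝ => f (p + t • e)) t = pd i f (p + t • e) := by
    intro t
    exact (((hf.differentiable one_ne_zero) _).hasFDerivAt.comp_hasDerivAt t (hL t)).deriv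
  have hcl : HasCompactSupport (fun t : ℝ => f (p + t • e)) := by
    obtain ⟨R, hR⟩ := hc.isCompact.isBounded.subset_closedBall (0 : E3)
    refine HasCompactSupport.of_support_subset_isCompact
      (isCompact_Icc (a := -(R + ‖p‖)) (b := R + ‖p‖)) ?_
    intro t ht
    have h1 := hR (subset_tsupport f ht)
    rw [mem_closedBall_zero_iff] at h1
    have h2 : ‖t • e‖ ≤ ‖p + t • e‖ + ‖p‖ := by
      have := norm_sub_le (p + t • e) p
      simpa using this
    have h3 : ‖t • e‖ = |t| := by
      rw [norm_smul, he]; simp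
    rw [h3] at h2
    rw [Set.mem_Icc, ← abs_le]
    linarith
  have := one_dim (g := fun t : ℝ => f (p + t • e)) (by fun_prop) hcl hγ x
  simp only [hd] at this
  exact this

theorem pt3_e0 (x y z : ℝ) : pt3 x y z = pt3 0 y z + x • EuclideanSpace.single 0 1 := by
  ext i; fin_cases i <;> simp [pt3]

theorem pt3_e1 (x y z : ℝ) : pt3 x y z = pt3 x 0 z + y • EuclideanSpace.single 1 1 := by
  ext i; fin_cases i <;> simp [pt3]

theorem pt3_e2 (x y z : ℝ) : pt3 x y z = pt3 x y 0 + z • EuclideanSpace.single 2 1 := by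
  ext i; fin_cases i <;> simp [pt3]

theorem pt3_cont : Continuous fun p : ℝ × ℝ × ℝ => pt3 p.1 p.2.1 p.2.2 := by
  unfold pt3
  refine (PiLp.continuous_toLp 2 (fun _ : Fin 3 => ℝ)).comp (continuous_pi fun i => ?_)
  fin_cases i <;> simp <;> fun_prop

theorem cont_M3 {g : E3 → ℝ} (hg : Continuous g) :
    M3 fun x y z => ENNReal.ofReal |g (pt3 x y z)| :=
  (ENNReal.continuous_ofReal.comp (continuous_abs.comp (hg.comp pt3_cont))).measurable

theorem lint_E3 {w : E3 → ℝ≥0∞} (hw : Measurable w) :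
    ∫⁻ x, w x = ∫⁻ z, ∫⁻ y, ∫⁻ x, w (pt3 x y z) := by
  have a := (PiLp.volume_preserving_toLp (Fin 3)).lintegral_comp hw
  rw [← a]
  have b := (volume_preserving_piFinSuccAbove (fun _ : Fin 3 => ℝ) 2).symm
  have hw2 : Measurable fun v : Fin 3 → ℝ => w (WithLp.toLp 2 v) :=
    hw.comp (PiLp.continuous_toLp 2 (fun _ : Fin 3 => ℝ)).measurable
  rw [← b.lintegral_comp hw2]
  rw [Measure.volume_eq_prod, lintegral_prod _ (by
    exact (hw2.comp (MeasurableEquiv.measurable _)).aemeasurable)]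
  refine lintegral_congr fun z => ?_
  have c := (volume_preserving_finTwoArrow ℝ).symm
  have hw3 : Measurable fun v : Fin 2 → ℝ => w (WithLp.toLp 2
      ((MeasurableEquiv.piFinSuccAbove (fun _ : Fin 3 => ℝ) 2).symm (z, v))) :=
    (hw2.comp (MeasurableEquiv.measurable _)).comp (by fun_prop : Measurable fun v : Fin 2 → ℝ => (z, v))
  rw [← c.lintegral_comp hw3]
  rw [Measure.volume_eq_prod, lintegral_prod_symm _ (by
    exact (hw3.comp (MeasurableEquiv.measurable _)).aemeasurable)]
  refine lintegral_congr fun y => lintegral_congr fun x => ?_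
  congr 1
  ext i
  fin_cases i <;> rfl

theorem l2On_eq {g : E3 → ℝ} (hg : Continuous g) :
    l2On univ g = nrm3 2 2 2 (fun x y z => ENNReal.ofReal |g (pt3 x y z)|) := by
  unfold l2On nrm3 nrm
  simp_rw [← ENNReal.rpow_mul]
  simp only [one_div, inv_mul_cancel₀ (two_ne_zero (α := ℝ)), ENNReal.rpow_one, ENNReal.rpow_two,
    Measure.restrict_univ]
  rw [lint_E3 (w := fun x => ENNReal.ofReal |g x| ^ 2)
    (((ENNReal.continuous_ofReal.comp (continuous_abs.comp hg)).measurable).pow_const 2)]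

theorem anisoNorm_eq {q1 q2 q3 : ℝ} (f : E3 → ℝ) :
    anisoNorm q1 q2 q3 univ f = nrm3 q1 q2 q3 (fun x y z => ENNReal.ofReal |f (pt3 x y z)|) := by
  unfold anisoNorm nrm3 nrm
  simp_rw [← ENNReal.rpow_mul, Set.indicator_univ]
  simp only [one_div_mul_eq_div]

theorem pd_cont {f : E3 → ℝ} (hf : ContDiff ℝ 1 f) (i : Fin 3) : Continuous fun x => pd i f x :=
  (hf.continuous_fderiv one_ne_zero).clm_apply continuous_const

theorem dat_of {f : E3 → ℝ} (hf : ContDiff ℝ 1 f) (hc : HasCompactSupport f) :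
    Dat (fun x y z => ENNReal.ofReal |f (pt3 x y z)|)
      (fun x y z => ENNReal.ofReal |pd 0 f (pt3 x y z)|)
      (fun x y z => ENNReal.ofReal |pd 1 f (pt3 x y z)|)
      (fun x y z => ENNReal.ofReal |pd 2 f (pt3 x y z)|) where
  mu := cont_M3 hf.continuous
  m1 := cont_M3 (pd_cont hf 0)
  m2 := cont_M3 (pd_cont hf 1)
  m3 := cont_M3 (pd_cont hf 2)
  bd := by
    obtain ⟨M, hM⟩ := hc.exists_bound_of_continuous hf.continuous
    obtain ⟨R, hR⟩ := hc.isCompact.isBounded.subset_closedBall (0 : E3)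
    refine ⟨M, R, fun x y z => ?_⟩
    by_cases h0 : f (pt3 x y z) = 0
    · simp [h0]
    have h1 := hR (subset_tsupport f h0)
    rw [mem_closedBall_zero_iff] at h1
    have hx : x ∈ Icc (-R) R := by
      rw [Set.mem_Icc, ← abs_le]
      exact (PiLp.norm_apply_le (pt3 x y z) 0).trans h1
    have hy : y ∈ Icc (-R) R := by
      rw [Set.mem_Icc, ← abs_le]
      exact (PiLp.norm_apply_le (pt3 x y z) 1).trans h1
    have hz : z ∈ Icc (-R) R := by
      rw [Set.mem_Icc, ← abs_le]
      exact (PiLp.norm_apply_le (pt3 x y z) 2).trans h1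
    have := ENNReal.ofReal_le_ofReal (hM (pt3 x y z))
    rw [Real.norm_eq_abs] at this
    simp only [Set.indicator_of_mem hx, Set.indicator_of_mem hy, Set.indicator_of_mem hz]
    exact ⟨this, this, this⟩
  i1 := fun γ hγ x y z => by
    have := line_ineq hf hc 0 (pt3 0 y z) hγ x
    simpa only [← pt3_e0] using this
  i2 := fun γ hγ x y z => by
    have := line_ineq hf hc 1 (pt3 x 0 z) hγ y
    simpa only [← pt3_e1] using this
  i3 := fun γ hγ x y z => by
    have := line_ineq hf hc 2 (pt3 x y 0) hγ z
    simpa only [← pt3_e2] using this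

theorem l2On_pd_le {f : E3 → ℝ} (i : Fin 3) :
    l2On univ (fun x => pd i f x) ≤ l2On univ (fun x => ‖fderiv ℝ f x‖) := by
  unfold l2On
  refine ENNReal.rpow_le_rpow (lintegral_mono fun x => ?_) (by norm_num)
  refine pow_le_pow_left' (ENNReal.ofReal_le_ofReal ?_) 2
  rw [abs_norm]
  have := (fderiv ℝ f x).le_opNorm (EuclideanSpace.single i 1)
  simpa [pd] using this

/-- Lemma 2.2: anisotropic Sobolev inequality on ℝ³: for `q_j ∈ [2,∞)` with
`0 ≤ 1/q̄ − 1/2 ≤ 1`,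
`‖f‖_{L^{q⃗}} ≤ C ‖∂₁f‖_{L²}^{(q₁−2)/(2q₁)} ‖∂₂f‖_{L²}^{(q₂−2)/(2q₂)} ‖∂₃f‖_{L²}^{(q₃−2)/(2q₃)} ‖f‖_{L²}^{1/q̄−1/2}`
and consequently `‖f‖_{L^{q⃗}} ≤ C ‖∇f‖_{L²}^{3/2−1/q̄} ‖f‖_{L²}^{1/q̄−1/2}`. -/
theorem aniso_sobolev
    (q1 q2 q3 : ℝ) (hq1 : 2 ≤ q1) (hq2 : 2 ≤ q2) (hq3 : 2 ≤ q3)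
    (h0 : 0 ≤ 1/q1 + 1/q2 + 1/q3 - 1/2) (h1 : 1/q1 + 1/q2 + 1/q3 - 1/2 ≤ 1) :
    ∃ C : ℝ, 0 < C ∧
      ∀ f : E3 → ℝ, ContDiff ℝ (⊤ : ℕ∞) f → HasCompactSupport f →
        anisoNorm q1 q2 q3 univ f
          ≤ ENNReal.ofReal C
              * (l2On univ (fun x => pd 0 f x)) ^ ((q1 - 2)/(2*q1))
              * (l2On univ (fun x => pd 1 f x)) ^ ((q2 - 2)/(2*q2))
              * (l2On univ (fun x => pd 2 f x)) ^ ((q3 - 2)/(2*q3))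
              * (l2On univ f) ^ (1/q1 + 1/q2 + 1/q3 - 1/2)
        ∧ anisoNorm q1 q2 q3 univ f
          ≤ ENNReal.ofReal C
              * (l2On univ (fun x => ‖fderiv ℝ f x‖)) ^ (3/2 - (1/q1 + 1/q2 + 1/q3))
              * (l2On univ f) ^ (1/q1 + 1/q2 + 1/q3 - 1/2) := by
  obtain ⟨c, hc, H⟩ := ineq_all hq1 hq2 hq3 h0
  have p1 : 0 < q1 := by linarith
  have p2 : 0 < q2 := by linarith
  have p3 : 0 < q3 := by linarith
  have n1 : 0 ≤ (q1 - 2)/(2*q1) := div_nonneg (by linarith) (by linarith)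
  have n2 : 0 ≤ (q2 - 2)/(2*q2) := div_nonneg (by linarith) (by linarith)
  have n3 : 0 ≤ (q3 - 2)/(2*q3) := div_nonneg (by linarith) (by linarith)
  have cs : c ^ ((1:ℝ)/2) ≠ ⊤ := ENNReal.rpow_ne_top_of_nonneg (by norm_num) hc
  refine ⟨(c ^ ((1:ℝ)/2)).toReal + 1, by positivity, fun f hf hs => ?_⟩
  have hf1 : ContDiff ℝ 1 f := hf.of_le (by exact_mod_cast le_top)
  have hC : c ^ ((1:ℝ)/2) ≤ ENNReal.ofReal ((c ^ ((1:ℝ)/2)).toReal + 1) := by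
    conv_lhs => rw [← ENNReal.ofReal_toReal cs]
    exact ENNReal.ofReal_le_ofReal (by linarith)
  have key : anisoNorm q1 q2 q3 univ f
          ≤ ENNReal.ofReal ((c ^ ((1:ℝ)/2)).toReal + 1)
              * (l2On univ (fun x => pd 0 f x)) ^ ((q1 - 2)/(2*q1))
              * (l2On univ (fun x => pd 1 f x)) ^ ((q2 - 2)/(2*q2))
              * (l2On univ (fun x => pd 2 f x)) ^ ((q3 - 2)/(2*q3))
              * (l2On univ f) ^ (1/q1 + 1/q2 + 1/q3 - 1/2) := by
    have h := H _ _ _ _ (dat_of hf1 hs)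
    rw [← anisoNorm_eq, ← l2On_eq hf1.continuous, ← l2On_eq (pd_cont hf1 0),
      ← l2On_eq (pd_cont hf1 1), ← l2On_eq (pd_cont hf1 2)] at h
    have h' := ENNReal.rpow_le_rpow h (by norm_num : (0:ℝ) ≤ 1/2)
    have hh : (0:ℝ) ≤ 1/2 := by norm_num
    rw [ENNReal.mul_rpow_of_nonneg _ _ hh, ENNReal.mul_rpow_of_nonneg _ _ hh,
      ENNReal.mul_rpow_of_nonneg _ _ hh, ENNReal.mul_rpow_of_nonneg _ _ hh] at h'
    simp only [← ENNReal.rpow_mul] at h'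
    have e : ∀ t : ℝ, 2 * t * (1/2) = t := fun t => by ring
    simp only [e] at h'
    rw [show (2:ℝ) * (1/2) = 1 by norm_num, ENNReal.rpow_one] at h'
    refine h'.trans ((mul_le_mul' (mul_le_mul' (mul_le_mul' (mul_le_mul' hC le_rfl) le_rfl)
      le_rfl) le_rfl).trans_eq ?_)
    ring
  refine ⟨key, key.trans ?_⟩
  have es : 3/2 - (1/q1 + 1/q2 + 1/q3) = (q1 - 2)/(2*q1) + (q2 - 2)/(2*q2) + (q3 - 2)/(2*q3) := by
    field_simp; ring
  rw [es, ENNReal.rpow_add_of_nonneg _ _ (by positivity) n3,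
    ENNReal.rpow_add_of_nonneg _ _ n1 n2, ← mul_assoc, ← mul_assoc]
  gcongr <;> exact l2On_pd_le _
end
end

section
/- Let q⃗ = (q₁,q₂,q₃) with q_j ∈ [2,∞) for each j and 0 ≤ 1/q̄ − 1/2 ≤ 1, where 1/q̄ := 1/q₁+1/q₂+1/q₃. There exists a constant C, depending only on q⃗, such that for every ϱ > 0 and every f ∈ C^∞(ℝ³): ‖f‖_{L^{q⃗}(B(ϱ))} ≤ C · ‖∇f‖_{L²(B(√2 ϱ))}^{3/2 − 1/q̄} · ‖f‖_{L²(B(√2 ϱ))}^{1/q̄ − 1/2} + C · ϱ^{−(3/2 − 1/q̄)} · ‖f‖_{L²(B(√2 ϱ))}. -/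
open MeasureTheory ENNReal Set Metric Filter

noncomputable section

/-! ### One-dimensional kernels -/

lemma lintegral_pow_Ioc (β X : ℝ) (hβ : -1 < β) (hX : 0 ≤ X) :
    ∫⁻ t in Ioc 0 X, ENNReal.ofReal (t ^ β) = ENNReal.ofReal (X ^ (β + 1) / (β + 1)) := by
  have hi : IntervalIntegrable (fun x : ℝ => x ^ β) volume 0 X :=
    intervalIntegral.intervalIntegrable_rpow' hβ
  rw [intervalIntegrable_iff_integrableOn_Ioc_of_le hX] at hi
  rw [← ofReal_integral_eq_lintegral_ofReal hi, ← intervalIntegral.integral_of_le hX,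
    integral_rpow (Or.inl hβ), Real.zero_rpow (by linarith), sub_zero]
  filter_upwards [ae_restrict_mem measurableSet_Ioc] with t ht
  exact Real.rpow_nonneg ht.1.le _

/-- truncated power kernel -/
def ker1 (b R z : ℝ) : ℝ≥0∞ := if |z| < R then (ENNReal.ofReal |z|) ^ (-b) else 0

lemma measurable_ker1 (b R : ℝ) : Measurable (ker1 b R) := by
  unfold ker1
  refine Measurable.ite (measurableSet_lt (by fun_prop) measurable_const) (by fun_prop)
    measurable_const

lemma ker1_neg (b R z : ℝ) : ker1 b R (-z) = ker1 b R z := by simp [ker1]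

lemma ker1_int (b R : ℝ) (hb : b < 1) (hR : 0 < R) :
    ∫⁻ z, ker1 b R z ≤ ENNReal.ofReal (2 / (1 - b) * R ^ (1 - b)) := by
  set g : ℝ → ℝ≥0∞ := (Ioc 0 R).indicator (fun t => ENNReal.ofReal (t ^ (-b))) with hg
  have hgm : Measurable g := by
    refine Measurable.indicator (by fun_prop) measurableSet_Ioc
  have hgi : ∫⁻ z, g z = ENNReal.ofReal (R ^ (1 - b) / (1 - b)) := by
    rw [hg, lintegral_indicator measurableSet_Ioc, lintegral_pow_Ioc _ _ (by linarith) hR.le]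
    congr 2 <;> ring_nf
  calc ∫⁻ z, ker1 b R z ≤ ∫⁻ z, (g z + g (-z)) := by
        refine lintegral_mono_ae ?_
        have : ∀ᵐ z : ℝ, z ≠ 0 := by simp [ae_iff, measure_singleton]
        filter_upwards [this] with z hz
        unfold ker1
        split_ifs with h
        · rcases lt_or_gt_of_ne hz with h' | h'
          · rw [abs_of_neg h'] at h ⊢
            have : g (-z) = ENNReal.ofReal ((-z) ^ (-b)) := by
              rw [hg, indicator_of_mem]; exact ⟨by linarith, h.le⟩
            rw [this, ENNReal.ofReal_rpow_of_pos (by linarith)]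
            exact le_add_self
          · rw [abs_of_pos h'] at h ⊢
            have : g z = ENNReal.ofReal (z ^ (-b)) := by
              rw [hg, indicator_of_mem]; exact ⟨by linarith, h.le⟩
            rw [this, ENNReal.ofReal_rpow_of_pos (by linarith)]
            exact le_self_add
        · exact zero_le
    _ = ENNReal.ofReal (2 / (1 - b) * R ^ (1 - b)) := by
        rw [lintegral_add_left hgm, lintegral_neg_eq_self (fun z => g z), hgi,
          ← ENNReal.ofReal_add]
        · congr 1; ring
        all_goals exact div_nonneg (Real.rpow_nonneg hR.le _) (by linarith)

/-- integral of the power kernel over a set. -/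
lemma pow_set_int (l : ℝ) (hl0 : 0 < l) (hl : l < 1) (B : Set ℝ) (x : ℝ) :
    ∫⁻ y in B, (ENNReal.ofReal |x - y|) ^ (-l) ≤
      ENNReal.ofReal (2 / (1 - l) + 1) * (volume B) ^ (1 - l) := by
  by_cases h0 : volume B = 0
  · rw [Measure.restrict_eq_zero.2 h0]; simp
  by_cases ht : volume B = ∞
  · rw [ht, ENNReal.top_rpow_of_pos (by linarith), ENNReal.mul_top]
    · exact le_top
    · have : 0 < 2 / (1 - l) := div_pos two_pos (by linarith)
      simp only [ne_eq, ENNReal.ofReal_eq_zero, not_le]; linarith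
  set v := (volume B).toReal with hv
  have hvB : volume B = ENNReal.ofReal v := (ENNReal.ofReal_toReal ht).symm
  have hv0 : 0 < v := ENNReal.toReal_pos h0 ht
  calc ∫⁻ y in B, (ENNReal.ofReal |x - y|) ^ (-l)
      ≤ ∫⁻ y in B, (ker1 l v (x - y) + ENNReal.ofReal (v ^ (-l))) := by
        refine lintegral_mono fun y => ?_
        unfold ker1
        split_ifs with h
        · exact le_self_add
        · rw [zero_add]
          push Not at h
          rw [ENNReal.ofReal_rpow_of_pos (by linarith)]
          apply ENNReal.ofReal_le_ofReal
          exact Real.rpow_le_rpow_of_nonpos hv0 h (by linarith)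
    _ = (∫⁻ y in B, ker1 l v (x - y)) + ENNReal.ofReal (v ^ (-l)) * volume B := by
        rw [lintegral_add_right _ measurable_const, setLIntegral_const]
    _ ≤ (∫⁻ y, ker1 l v y) + ENNReal.ofReal (v ^ (-l)) * volume B := by
        refine add_le_add ?_ le_rfl
        refine (setLIntegral_le_lintegral _ _).trans ?_
        rw [lintegral_sub_left_eq_self (fun z => ker1 l v z)]
    _ ≤ ENNReal.ofReal (2 / (1 - l) * v ^ (1 - l)) + ENNReal.ofReal (v ^ (-l)) * volume B := by
        gcongr; exact ker1_int l v hl hv0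
    _ = _ := by
        have h2 : 0 < 2 / (1 - l) := div_pos two_pos (by linarith)
        have h3 := Real.rpow_nonneg hv0.le (1 - l)
        have h4 := Real.rpow_nonneg hv0.le (- l)
        rw [hvB, ENNReal.ofReal_rpow_of_pos hv0, ← ENNReal.ofReal_mul h4,
          ← ENNReal.ofReal_mul (by linarith), ← ENNReal.ofReal_add (by positivity) (by positivity)]
        congr 1
        have : v ^ (1 - l) = v ^ (-l) * v := by
          rw [show 1 - l = -l + 1 by ring, Real.rpow_add hv0, Real.rpow_one]
        rw [add_mul, one_mul, this]

/-! ### Layer cake -/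

lemma layer_cake_pow (p : ℝ) (hp : 1 ≤ p) (A : ℝ≥0∞) :
    ∫⁻ s in Ioi (0:ℝ), (if ENNReal.ofReal s < A then ENNReal.ofReal (s ^ (p - 1)) else 0) ≤ A ^ p := by
  by_cases hA : A = ∞
  · rw [hA, ENNReal.top_rpow_of_pos (by linarith)]; exact le_top
  set a := A.toReal
  have ha : A = ENNReal.ofReal a := (ENNReal.ofReal_toReal hA).symm
  have ha0 : 0 ≤ a := ENNReal.toReal_nonneg
  calc _ ≤ ∫⁻ s in Ioi (0:ℝ), (Ioc 0 a).indicator (fun s => ENNReal.ofReal (s ^ (p - 1))) s := by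
        refine setLIntegral_mono' measurableSet_Ioi fun s hs => ?_
        split_ifs with h
        · rw [ha] at h
          have := (ENNReal.ofReal_lt_ofReal_iff_of_nonneg (le_of_lt hs)).1 h
          rw [indicator_of_mem]
          exact ⟨hs, this.le⟩
        · exact zero_le
    _ ≤ ∫⁻ s, (Ioc 0 a).indicator (fun s => ENNReal.ofReal (s ^ (p - 1))) s :=
        setLIntegral_le_lintegral _ _
    _ = ENNReal.ofReal (a ^ (p - 1 + 1) / (p - 1 + 1)) := by
        rw [lintegral_indicator measurableSet_Ioc, lintegral_pow_Ioc _ _ (by linarith) ha0]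
    _ ≤ _ := by
        rw [ha, ENNReal.ofReal_rpow_of_nonneg ha0 (by linarith)]
        apply ENNReal.ofReal_le_ofReal
        rw [sub_add_cancel]
        exact div_le_self (Real.rpow_nonneg ha0 _) hp

lemma layer_cake_one (A : ℝ≥0∞) :
    ∫⁻ s in Ioi (0:ℝ), (if ENNReal.ofReal s < A then (1:ℝ≥0∞) else 0) = A := by
  have hm : MeasurableSet {s : ℝ | ENNReal.ofReal s < A} :=
    measurableSet_lt (by fun_prop) measurable_const
  have : (fun s : ℝ => if ENNReal.ofReal s < A then (1:ℝ≥0∞) else 0)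
      = {s : ℝ | ENNReal.ofReal s < A}.indicator 1 := by
    ext s; simp [indicator]
  rw [this, lintegral_indicator_one hm, Measure.restrict_apply hm]
  by_cases hA : A = ∞
  · have : {s : ℝ | ENNReal.ofReal s < A} ∩ Ioi 0 = Ioi 0 := by ext s; simp [hA]
    rw [this, hA]; simp
  · have : {s : ℝ | ENNReal.ofReal s < A} ∩ Ioi 0 = Ioo 0 A.toReal := by
      ext s
      simp only [mem_inter_iff, mem_ofPred_eq, mem_Ioi, mem_Ioo]
      constructor
      · rintro ⟨h1, h2⟩; exact ⟨h2, (ENNReal.ofReal_lt_iff_lt_toReal h2.le hA).1 h1⟩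
      · rintro ⟨h1, h2⟩; exact ⟨(ENNReal.ofReal_lt_iff_lt_toReal h1.le hA).2 h2, h1⟩
    rw [this, Real.volume_Ioo, sub_zero, ENNReal.ofReal_toReal hA]

/-- one half of the layer cake decomposition of a product -/
def half (θ : ℝ) (A B : ℝ≥0∞) : ℝ≥0∞ :=
  ∫⁻ s in Ioi (0:ℝ), (if ENNReal.ofReal s < A then (1:ℝ≥0∞) else 0) *
    ∫⁻ t in Ioc 0 (s ^ θ), (if ENNReal.ofReal t < B then (1:ℝ≥0∞) else 0)

lemma mul_le_half (θ : ℝ) (hθ : 0 < θ) (A B : ℝ≥0∞) : A * B ≤ half θ A B + half θ⁻¹ B A := by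
  have hmA : Measurable fun s : ℝ => (if ENNReal.ofReal s < A then (1:ℝ≥0∞) else 0) :=
    Measurable.ite (measurableSet_lt (by fun_prop) measurable_const) measurable_const
      measurable_const
  have hmB : Measurable fun s : ℝ => (if ENNReal.ofReal s < B then (1:ℝ≥0∞) else 0) :=
    Measurable.ite (measurableSet_lt (by fun_prop) measurable_const) measurable_const
      measurable_const
  set α := fun s : ℝ => (if ENNReal.ofReal s < A then (1:ℝ≥0∞) else 0) with hα
  set β := fun s : ℝ => (if ENNReal.ofReal s < B then (1:ℝ≥0∞) else 0) with hβ
  have key : A * B = ∫⁻ s in Ioi (0:ℝ), ∫⁻ t in Ioi (0:ℝ), α s * β t := by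
    conv_lhs => rw [← layer_cake_one A, ← layer_cake_one B]
    rw [← lintegral_mul_const _ hmA]
    refine lintegral_congr fun s => ?_
    rw [lintegral_const_mul _ hmB]
  -- split
  set χ : ℝ → ℝ → ℝ≥0∞ := fun s t => if t ≤ s ^ θ then 1 else 0
  set ψ : ℝ → ℝ → ℝ≥0∞ := fun s t => if s ≤ t ^ θ⁻¹ then 1 else 0
  have hχ : Measurable (Function.uncurry χ) :=
    Measurable.ite (measurableSet_le (by fun_prop) (by fun_prop)) measurable_const measurable_const
  have hψ : Measurable (Function.uncurry ψ) :=
    Measurable.ite (measurableSet_le (by fun_prop) (by fun_prop)) measurable_const measurable_const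
  have hα2 : Measurable fun z : ℝ × ℝ => α z.1 := hmA.comp measurable_fst
  have hβ2 : Measurable fun z : ℝ × ℝ => β z.2 := hmB.comp measurable_snd
  have h1 : ∫⁻ s in Ioi (0:ℝ), ∫⁻ t in Ioi (0:ℝ), α s * β t * χ s t = half θ A B := by
    unfold half
    refine setLIntegral_congr_fun measurableSet_Ioi fun s hs => ?_
    rw [← lintegral_const_mul _ hmB, ← lintegral_indicator measurableSet_Ioi,
      ← lintegral_indicator measurableSet_Ioc]
    refine lintegral_congr fun t => ?_
    by_cases h0 : 0 < t <;> by_cases h2 : t ≤ s ^ θ <;> simp [indicator, h0, h2, χ, α, β]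
  have h2 : ∫⁻ s in Ioi (0:ℝ), ∫⁻ t in Ioi (0:ℝ), α s * β t * ψ s t = half θ⁻¹ B A := by
    rw [lintegral_lintegral_swap]
    · unfold half
      refine setLIntegral_congr_fun measurableSet_Ioi fun s hs => ?_
      rw [← lintegral_const_mul _ hmA, ← lintegral_indicator measurableSet_Ioi,
        ← lintegral_indicator measurableSet_Ioc]
      refine lintegral_congr fun t => ?_
      simp only [mul_comm (α _) (β s)]
      by_cases h0 : 0 < t <;> by_cases h2 : t ≤ s ^ θ⁻¹ <;>
        simp [indicator, h0, h2, ψ, α, β]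
    · exact ((hα2.mul hβ2).mul hψ).aemeasurable
  rw [key, ← h1, ← h2]
  have m1 : Measurable fun s => ∫⁻ t in Ioi (0:ℝ), α s * β t * χ s t :=
    Measurable.lintegral_prod_right' (f := fun z : ℝ × ℝ => α z.1 * β z.2 * χ z.1 z.2)
      ((hα2.mul hβ2).mul hχ)
  rw [← lintegral_add_left m1]
  refine setLIntegral_mono' measurableSet_Ioi fun s hs => ?_
  have m2 : Measurable fun t => α s * β t * χ s t :=
    (((hα2.mul hβ2).mul hχ)).comp (measurable_const.prodMk measurable_id)
  rw [← lintegral_add_left m2]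
  refine setLIntegral_mono' measurableSet_Ioi fun t ht => ?_
  rw [← mul_add]
  have : 1 ≤ χ s t + ψ s t := by
    by_cases h : t ≤ s ^ θ
    · simp [χ, h]
    · have : s ≤ t ^ θ⁻¹ := by
        push Not at h
        rw [Real.le_rpow_inv_iff_of_pos (le_of_lt hs) (le_of_lt ht) hθ]
        exact h.le
      simp [ψ, this]
  calc α s * β t = α s * β t * 1 := (mul_one _).symm
    _ ≤ _ := by gcongr

/-! ### One-dimensional Hardy-Littlewood-Sobolev inequality, bilinear form -/

lemma hls_half (p r l : ℝ) (hp : 1 ≤ p) (hr : 1 ≤ r) (hl0 : 0 < l) (hl : l < 1)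
    (hrl : r * (1 - l) < 1) (hpr : 1 / p + 1 / r + l = 2) :
    ∃ C : ℝ, 0 < C ∧ ∀ F G : ℝ → ℝ≥0∞, Measurable F → Measurable G →
      ∫⁻ x, F x ^ p ≤ 1 → ∫⁻ y, G y ^ r ≤ 1 →
      ∫⁻ x, ∫⁻ y, half (p / r) (F x) (G y) * (ENNReal.ofReal |x - y|) ^ (-l) ≤
        ENNReal.ofReal C := by
  set e : ℝ := -((r - 1) * (1 - l) / l) with he
  have he1 : -1 < e := by
    rw [he, neg_lt_neg_iff, div_lt_one hl0]; nlinarith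
  set c : ℝ := (1 / (e + 1)) ^ l with hc
  have hc0 : 0 < c := Real.rpow_pos_of_pos (div_pos one_pos (by linarith)) _
  set C1 : ℝ := 2 / (1 - l) + 1 with hC1
  have hC10 : 0 < C1 := by
    have : 0 < 2 / (1 - l) := div_pos two_pos (by linarith)
    linarith
  refine ⟨C1 * c, mul_pos hC10 hc0, fun F G hF hG hF1 hG1 => ?_⟩
  have hGm : MeasurableSet {z : ℝ × ℝ | ENNReal.ofReal z.1 < G z.2} :=
    measurableSet_lt (by fun_prop) (by fun_prop)
  set β : ℝ → ℝ → ℝ≥0∞ := fun t y => if ENNReal.ofReal t < G y then 1 else 0 with hβ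
  have hβm : Measurable (fun z : ℝ × ℝ => β z.1 z.2) :=
    Measurable.ite hGm measurable_const measurable_const
  set v : ℝ → ℝ≥0∞ := fun t => volume {y | ENNReal.ofReal t < G y} with hv
  have hsec : ∀ t : ℝ, MeasurableSet {y | ENNReal.ofReal t < G y} := fun t =>
    measurableSet_lt measurable_const hG
  have hvβ : ∀ t, v t = ∫⁻ y, β t y := by
    intro t
    have : (fun y => β t y) = {y | ENNReal.ofReal t < G y}.indicator 1 := by
      ext y; simp [β, indicator]
    rw [this, lintegral_indicator_one (hsec t)]
  have hvm : Measurable v := by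
    have : v = fun t => ∫⁻ y, β t y := funext hvβ
    rw [this]; exact hβm.lintegral_prod_right'
  have hV : ∫⁻ t in Ioi (0:ℝ), v t * ENNReal.ofReal (t ^ (r - 1)) ≤ 1 := by
    calc ∫⁻ t in Ioi (0:ℝ), v t * ENNReal.ofReal (t ^ (r - 1))
        = ∫⁻ t in Ioi (0:ℝ), ∫⁻ y, β t y * ENNReal.ofReal (t ^ (r - 1)) := by
          refine lintegral_congr fun t => ?_
          rw [hvβ, lintegral_mul_const]
          exact hβm.comp (measurable_const.prodMk measurable_id)
      _ = ∫⁻ y, ∫⁻ t in Ioi (0:ℝ), β t y * ENNReal.ofReal (t ^ (r - 1)) := by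
          rw [lintegral_lintegral_swap]
          exact (hβm.mul (by fun_prop)).aemeasurable
      _ ≤ ∫⁻ y, G y ^ r := by
          refine lintegral_mono fun y => ?_
          refine le_trans (le_of_eq ?_) (layer_cake_pow r hr (G y))
          refine lintegral_congr fun t => ?_
          simp [β]
      _ ≤ 1 := hG1
  -- the integral in t
  have hW : ∀ s : ℝ, 0 < s → ∫⁻ t in Ioc 0 (s ^ (p / r)), v t ^ (1 - l) ≤
      ENNReal.ofReal (c * s ^ (p - 1)) := by
    intro s hs
    set X := s ^ (p / r) with hX
    have hX0 : 0 < X := Real.rpow_pos_of_pos hs _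
    calc ∫⁻ t in Ioc 0 X, v t ^ (1 - l)
        = ∫⁻ t in Ioc 0 X, (v t * ENNReal.ofReal (t ^ (r - 1))) ^ (1 - l)
            * (ENNReal.ofReal (t ^ e)) ^ l := by
          refine setLIntegral_congr_fun measurableSet_Ioc fun t ht => ?_
          have ht0 : 0 < t := ht.1
          rw [ENNReal.mul_rpow_of_nonneg _ _ (by linarith : 0 ≤ 1 - l), mul_assoc,
            ENNReal.ofReal_rpow_of_pos (Real.rpow_pos_of_pos ht0 _),
            ENNReal.ofReal_rpow_of_pos (Real.rpow_pos_of_pos ht0 _), ← Real.rpow_mul ht0.le,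
            ← Real.rpow_mul ht0.le, ← ENNReal.ofReal_mul (Real.rpow_nonneg ht0.le _),
            ← Real.rpow_add ht0]
          have : (r - 1) * (1 - l) + e * l = 0 := by rw [he]; field_simp; ring
          rw [this]; simp
      _ ≤ (∫⁻ t in Ioc 0 X, v t * ENNReal.ofReal (t ^ (r - 1))) ^ (1 - l)
            * (∫⁻ t in Ioc 0 X, ENNReal.ofReal (t ^ e)) ^ l := by
          refine ENNReal.lintegral_mul_norm_pow_le ?_ ?_ (by linarith) hl0.le (by ring)
          · exact (hvm.mul (by fun_prop)).aemeasurable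
          · fun_prop
      _ ≤ 1 ^ (1 - l) * (ENNReal.ofReal (X ^ (e + 1) / (e + 1))) ^ l := by
          rw [lintegral_pow_Ioc _ _ he1 hX0.le]
          refine mul_le_mul_left ?_ _
          refine ENNReal.rpow_le_rpow ?_ (by linarith)
          exact (lintegral_mono_set Ioc_subset_Ioi_self).trans hV
      _ = ENNReal.ofReal (c * s ^ (p - 1)) := by
          have h1 : 0 < 1 / (e + 1) := div_pos one_pos (by linarith)
          have h2 : 0 < X ^ (e + 1) := Real.rpow_pos_of_pos hX0 _
          rw [ENNReal.one_rpow, one_mul, div_eq_mul_one_div,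
            ENNReal.ofReal_rpow_of_pos (by positivity), Real.mul_rpow h2.le h1.le, mul_comm, hX,
            ← Real.rpow_mul hs.le, ← Real.rpow_mul hs.le]
          congr 3
          have h3 : (e + 1) * l = 1 - r * (1 - l) := by rw [he]; field_simp; ring
          rw [mul_assoc, h3]
          have hp0 : p ≠ 0 := by linarith
          have hr0 : r ≠ 0 := by linarith
          have : l = 2 - 1 / p - 1 / r := by linarith
          rw [this]; field_simp; ring
  -- pointwise in x
  have hx : ∀ x, ∫⁻ y, half (p / r) (F x) (G y) * (ENNReal.ofReal |x - y|) ^ (-l) ≤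
      ENNReal.ofReal (C1 * c) * F x ^ p := by
    intro x
    set α : ℝ → ℝ≥0∞ := fun s => if ENNReal.ofReal s < F x then 1 else 0 with hα
    have hαm : Measurable α := Measurable.ite (measurableSet_lt (by fun_prop) measurable_const)
      measurable_const measurable_const
    set K : ℝ → ℝ≥0∞ := fun y => (ENNReal.ofReal |x - y|) ^ (-l) with hK
    have hKm : Measurable K := by fun_prop
    -- measurability of the parametrized inner integral
    set χ : ℝ → ℝ → ℝ≥0∞ := fun s t => if 0 < t ∧ t ≤ s ^ (p / r) then 1 else 0 with hχ
    have hχm : Measurable (fun z : ℝ × ℝ => χ z.1 z.2) :=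
      Measurable.ite (((measurableSet_lt (f := fun _ : ℝ × ℝ => (0:ℝ)) (g := fun z => z.2)
        measurable_const (by fun_prop)).inter
        (measurableSet_le (f := fun z : ℝ × ℝ => z.2) (g := fun z => z.1 ^ (p / r))
          (by fun_prop) (by fun_prop))).congr (by ext z; simp)) measurable_const measurable_const
    have hhalf : ∀ y, half (p / r) (F x) (G y) =
        ∫⁻ s in Ioi (0:ℝ), ∫⁻ t, α s * (χ s t * β t y) := by
      intro y
      unfold half
      refine lintegral_congr fun s => ?_
      have hb : Measurable fun t => β t y := hβm.comp (measurable_id.prodMk measurable_const)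
      have hch : Measurable fun t => χ s t := hχm.comp (measurable_const.prodMk measurable_id)
      rw [lintegral_const_mul (α s) (f := fun t => χ s t * β t y) (hch.mul hb), ← lintegral_indicator measurableSet_Ioc]
      congr 1
      refine lintegral_congr fun t => ?_
      by_cases h : 0 < t ∧ t ≤ s ^ (p / r)
      · simp [indicator, χ, h, β]
      · simp only [indicator, mem_Ioc, h, χ, β, if_false, zero_mul]
    have hm3 : Measurable fun z : (ℝ × ℝ) × ℝ => α z.1.2 * (χ z.1.2 z.2 * β z.2 z.1.1) :=
      (hαm.comp (by fun_prop)).mul ((hχm.comp (g := fun z : ℝ × ℝ => χ z.1 z.2)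
        (f := fun z : (ℝ × ℝ) × ℝ => (z.1.2, z.2)) (by fun_prop)).mul
        (hβm.comp (g := fun z : ℝ × ℝ => β z.1 z.2)
        (f := fun z : (ℝ × ℝ) × ℝ => (z.2, z.1.1)) (by fun_prop)))
    have hm2 : Measurable fun z : ℝ × ℝ => ∫⁻ t, α z.2 * (χ z.2 t * β t z.1) :=
      hm3.lintegral_prod_right'
    calc ∫⁻ y, half (p / r) (F x) (G y) * K y
        = ∫⁻ y, ∫⁻ s in Ioi (0:ℝ), (∫⁻ t, α s * (χ s t * β t y)) * K y := by
          refine lintegral_congr fun y => ?_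
          rw [hhalf, lintegral_mul_const]
          exact hm2.comp (measurable_const.prodMk measurable_id)
      _ = ∫⁻ s in Ioi (0:ℝ), ∫⁻ y, (∫⁻ t, α s * (χ s t * β t y)) * K y := by
          rw [lintegral_lintegral_swap]
          exact (hm2.mul (hKm.comp measurable_fst)).aemeasurable
      _ ≤ ∫⁻ s in Ioi (0:ℝ), α s * ENNReal.ofReal (C1 * c * s ^ (p - 1)) := by
          refine setLIntegral_mono' measurableSet_Ioi fun s hs => ?_
          have hs0 : (0:ℝ) < s := hs
          have hm4 : Measurable fun z : ℝ × ℝ => α s * (χ s z.2 * β z.2 z.1) :=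
            hm3.comp (g := fun z : (ℝ × ℝ) × ℝ => α z.1.2 * (χ z.1.2 z.2 * β z.2 z.1.1))
              (f := fun z : ℝ × ℝ => ((z.1, s), z.2)) (by fun_prop)
          calc ∫⁻ y, (∫⁻ t, α s * (χ s t * β t y)) * K y
              = ∫⁻ y, ∫⁻ t, α s * (χ s t * β t y) * K y := by
                refine lintegral_congr fun y => ?_
                rw [lintegral_mul_const]
                exact hm4.comp (measurable_const.prodMk measurable_id)
            _ = ∫⁻ t, ∫⁻ y, α s * (χ s t * β t y) * K y := by
                rw [lintegral_lintegral_swap]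
                exact (hm4.mul (hKm.comp measurable_fst)).aemeasurable
            _ ≤ ∫⁻ t, α s * (χ s t * (ENNReal.ofReal C1 * v t ^ (1 - l))) := by
                refine lintegral_mono fun t => ?_
                have hb : Measurable fun y => β t y :=
                  hβm.comp (measurable_const.prodMk measurable_id)
                have : ∀ y, α s * (χ s t * β t y) * K y = α s * χ s t * (β t y * K y) := by
                  intro y; ring
                simp only [this]
                rw [lintegral_const_mul _ (f := fun y => β t y * K y) (hb.mul hKm), mul_assoc]
                refine mul_le_mul_right (mul_le_mul_right ?_ _) _
                refine le_trans (le_of_eq ?_) (pow_set_int l hl0 hl _ x)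
                rw [← lintegral_indicator (hsec t)]
                refine lintegral_congr fun y => ?_
                by_cases h : ENNReal.ofReal t < G y <;> simp [indicator, β, h, K]
            _ = α s * (ENNReal.ofReal C1 * ∫⁻ t in Ioc 0 (s ^ (p / r)), v t ^ (1 - l)) := by
                have hch : Measurable fun t => χ s t :=
                  hχm.comp (measurable_const.prodMk measurable_id)
                rw [lintegral_const_mul]
                · congr 1
                  rw [← lintegral_const_mul _ (by fun_prop),
                    ← lintegral_indicator measurableSet_Ioc]
                  refine lintegral_congr fun t => ?_
                  by_cases h : 0 < t ∧ t ≤ s ^ (p / r)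
                  · simp [indicator, χ, h]
                  · simp only [indicator, mem_Ioc, h, χ, if_false, zero_mul]
                · exact hch.mul (by fun_prop)
            _ ≤ α s * (ENNReal.ofReal C1 * ENNReal.ofReal (c * s ^ (p - 1))) :=
                mul_le_mul_right (mul_le_mul_right (hW s hs0) _) _
            _ = _ := by
                rw [← ENNReal.ofReal_mul hC10.le, mul_assoc C1]
      _ = ENNReal.ofReal (C1 * c) * ∫⁻ s in Ioi (0:ℝ),
            (if ENNReal.ofReal s < F x then ENNReal.ofReal (s ^ (p - 1)) else 0) := by
          rw [← lintegral_const_mul]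
          · refine lintegral_congr fun s => ?_
            rw [ENNReal.ofReal_mul (mul_pos hC10 hc0).le]
            by_cases h : ENNReal.ofReal s < F x <;> simp [α, h]
          · exact Measurable.ite (measurableSet_lt (by fun_prop) measurable_const)
              (by fun_prop) measurable_const
      _ ≤ _ := mul_le_mul_right (layer_cake_pow p hp _) _
  calc _ ≤ ∫⁻ x, ENNReal.ofReal (C1 * c) * F x ^ p := lintegral_mono hx
    _ = ENNReal.ofReal (C1 * c) * ∫⁻ x, F x ^ p := lintegral_const_mul _ (by fun_prop)
    _ ≤ ENNReal.ofReal (C1 * c) * 1 := mul_le_mul_right hF1 _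
    _ = _ := mul_one _

lemma measurable_half (θ : ℝ) : Measurable fun z : ℝ≥0∞ × ℝ≥0∞ => half θ z.1 z.2 := by
  have hχm : Measurable fun z : ℝ × ℝ => (if 0 < z.2 ∧ z.2 ≤ z.1 ^ θ then (1:ℝ≥0∞) else 0) :=
      Measurable.ite (((measurableSet_lt (f := fun _ : ℝ × ℝ => (0:ℝ)) (g := fun z => z.2)
        measurable_const (by fun_prop)).inter
        (measurableSet_le (f := fun z : ℝ × ℝ => z.2) (g := fun z => z.1 ^ θ)
          (by fun_prop) (by fun_prop))).congr (by ext z; simp)) measurable_const measurable_const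
  have hβm : Measurable fun z : ℝ × ℝ≥0∞ => (if ENNReal.ofReal z.1 < z.2 then (1:ℝ≥0∞) else 0) :=
    Measurable.ite (measurableSet_lt (by fun_prop) (by fun_prop)) measurable_const measurable_const
  have h : ∀ A B, half θ A B = ∫⁻ s in Ioi (0:ℝ), (if ENNReal.ofReal s < A then (1:ℝ≥0∞) else 0) *
      ∫⁻ t, (if 0 < t ∧ t ≤ s ^ θ then (1:ℝ≥0∞) else 0) *
        (if ENNReal.ofReal t < B then (1:ℝ≥0∞) else 0) := by
    intro A B
    unfold half
    refine lintegral_congr fun s => ?_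
    congr 1
    rw [← lintegral_indicator measurableSet_Ioc]
    refine lintegral_congr fun t => ?_
    by_cases h : 0 < t ∧ t ≤ s ^ θ
    · simp [indicator, h]
    · simp only [indicator, mem_Ioc, h, if_false, zero_mul]
  simp only [h]
  have m1 : Measurable fun z : (ℝ≥0∞ × ℝ≥0∞) × ℝ =>
      ∫⁻ t, (if 0 < t ∧ t ≤ z.2 ^ θ then (1:ℝ≥0∞) else 0) *
        (if ENNReal.ofReal t < z.1.2 then (1:ℝ≥0∞) else 0) := by
    have : Measurable fun w : ((ℝ≥0∞ × ℝ≥0∞) × ℝ) × ℝ =>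
      (if 0 < w.2 ∧ w.2 ≤ w.1.2 ^ θ then (1:ℝ≥0∞) else 0) *
        (if ENNReal.ofReal w.2 < w.1.1.2 then (1:ℝ≥0∞) else 0) :=
      (hχm.comp (f := fun w : ((ℝ≥0∞ × ℝ≥0∞) × ℝ) × ℝ => (w.1.2, w.2)) (by fun_prop)).mul
      (hβm.comp (f := fun w : ((ℝ≥0∞ × ℝ≥0∞) × ℝ) × ℝ => (w.2, w.1.1.2)) (by fun_prop))
    exact this.lintegral_prod_right'
  have m2 : Measurable fun z : (ℝ≥0∞ × ℝ≥0∞) × ℝ =>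
      (if ENNReal.ofReal z.2 < z.1.1 then (1:ℝ≥0∞) else 0) :=
    hβm.comp (f := fun z : (ℝ≥0∞ × ℝ≥0∞) × ℝ => (z.2, z.1.1)) (by fun_prop)
  exact (m2.mul m1).lintegral_prod_right'

lemma hls_normalized (p r l : ℝ) (hp : 1 ≤ p) (hr : 1 ≤ r) (hl0 : 0 < l) (hl : l < 1)
    (hpl : p * (1 - l) < 1) (hrl : r * (1 - l) < 1) (hpr : 1 / p + 1 / r + l = 2) :
    ∃ C : ℝ, 0 < C ∧ ∀ F G : ℝ → ℝ≥0∞, Measurable F → Measurable G →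
      ∫⁻ x, F x ^ p ≤ 1 → ∫⁻ y, G y ^ r ≤ 1 →
      ∫⁻ x, ∫⁻ y, F x * G y * (ENNReal.ofReal |x - y|) ^ (-l) ≤ ENNReal.ofReal C := by
  obtain ⟨C1, hC1, H1⟩ := hls_half p r l hp hr hl0 hl hrl hpr
  obtain ⟨C2, hC2, H2⟩ := hls_half r p l hr hp hl0 hl hpl (by linarith)
  refine ⟨C1 + C2, by linarith, fun F G hF hG hF1 hG1 => ?_⟩
  have hm1 : Measurable fun z : ℝ × ℝ =>
      half (p / r) (F z.1) (G z.2) * (ENNReal.ofReal |z.1 - z.2|) ^ (-l) :=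
    ((measurable_half (p / r)).comp (f := fun z : ℝ × ℝ => (F z.1, G z.2)) (by fun_prop)).mul
      (by fun_prop)
  have hm2 : Measurable fun z : ℝ × ℝ =>
      half (r / p) (G z.2) (F z.1) * (ENNReal.ofReal |z.1 - z.2|) ^ (-l) :=
    ((measurable_half (r / p)).comp (f := fun z : ℝ × ℝ => (G z.2, F z.1)) (by fun_prop)).mul
      (by fun_prop)
  calc ∫⁻ x, ∫⁻ y, F x * G y * (ENNReal.ofReal |x - y|) ^ (-l)
      ≤ ∫⁻ x, ∫⁻ y, (half (p / r) (F x) (G y) * (ENNReal.ofReal |x - y|) ^ (-l)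
          + half (r / p) (G y) (F x) * (ENNReal.ofReal |x - y|) ^ (-l)) := by
        refine lintegral_mono fun x => lintegral_mono fun y => ?_
        rw [← add_mul]
        refine mul_le_mul_left ?_ _
        have := mul_le_half (p / r) (by positivity) (F x) (G y)
        rwa [inv_div] at this
    _ = (∫⁻ x, ∫⁻ y, half (p / r) (F x) (G y) * (ENNReal.ofReal |x - y|) ^ (-l))
        + ∫⁻ x, ∫⁻ y, half (r / p) (G y) (F x) * (ENNReal.ofReal |x - y|) ^ (-l) := by
        rw [← lintegral_add_left hm1.lintegral_prod_right']
        refine lintegral_congr fun x => ?_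
        rw [lintegral_add_left]
        exact hm1.comp (measurable_const.prodMk measurable_id)
    _ ≤ ENNReal.ofReal C1 + ENNReal.ofReal C2 := by
        refine add_le_add (H1 F G hF hG hF1 hG1) ?_
        rw [lintegral_lintegral_swap hm2.aemeasurable]
        simp_rw [fun x y : ℝ => abs_sub_comm y x] 
        exact H2 G F hG hF hG1 hF1
    _ = _ := (ENNReal.ofReal_add hC1.le hC2.le).symm

lemma lintegral_bil_zero_left (F G : ℝ → ℝ≥0∞) (K : ℝ → ℝ → ℝ≥0∞) (p : ℝ) (hp : 0 < p)
    (hF : Measurable F) (h : ∫⁻ x, F x ^ p = 0) :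
    ∫⁻ x, ∫⁻ y, F x * G y * K x y = 0 := by
  rw [lintegral_eq_zero_iff (by fun_prop)] at h
  have : (fun x => ∫⁻ y, F x * G y * K x y) =ᵐ[volume] fun _ => (0:ℝ≥0∞) := by
    filter_upwards [h] with x hx
    have : F x = 0 := by simpa [ENNReal.rpow_eq_zero_iff, hp, hp.le, not_lt.2 hp.le] using hx
    simp [this]
  rw [lintegral_congr_ae this]; simp

lemma lintegral_bil_zero_right (F G : ℝ → ℝ≥0∞) (K : ℝ → ℝ → ℝ≥0∞) (p : ℝ) (hp : 0 < p)
    (hG : Measurable G) (h : ∫⁻ x, G x ^ p = 0) :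
    ∫⁻ x, ∫⁻ y, F x * G y * K x y = 0 := by
  rw [lintegral_eq_zero_iff (by fun_prop)] at h
  have : ∀ x, ∫⁻ y, F x * G y * K x y = 0 := by
    intro x
    have : (fun y => F x * G y * K x y) =ᵐ[volume] fun _ => (0:ℝ≥0∞) := by
      filter_upwards [h] with y hy
      have : G y = 0 := by simpa [ENNReal.rpow_eq_zero_iff, hp, hp.le, not_lt.2 hp.le] using hy
      simp [this]
    rw [lintegral_congr_ae this]; simp
  simp [this]

lemma normalize_int (F : ℝ → ℝ≥0∞) (p : ℝ) (hp : 0 < p) (hF : Measurable F)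
    (h0 : ∫⁻ x, F x ^ p ≠ 0) (ht : ∫⁻ x, F x ^ p ≠ ∞) :
    ∫⁻ x, (((∫⁻ x, F x ^ p) ^ (1 / p))⁻¹ * F x) ^ p ≤ 1 := by
  set I := ∫⁻ x, F x ^ p
  have : ∀ x, ((I ^ (1 / p))⁻¹ * F x) ^ p = I⁻¹ * F x ^ p := by
    intro x
    rw [ENNReal.mul_rpow_of_nonneg _ _ hp.le, ENNReal.inv_rpow, ← ENNReal.rpow_mul,
      one_div_mul_cancel hp.ne', ENNReal.rpow_one]
  simp only [this]
  rw [lintegral_const_mul _ (by fun_prop), ENNReal.inv_mul_cancel h0 ht]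

lemma hls (p r l : ℝ) (hp : 1 ≤ p) (hr : 1 ≤ r) (hl0 : 0 < l) (hl : l < 1)
    (hpl : p * (1 - l) < 1) (hrl : r * (1 - l) < 1) (hpr : 1 / p + 1 / r + l = 2) :
    ∃ C : ℝ, 0 < C ∧ ∀ F G : ℝ → ℝ≥0∞, Measurable F → Measurable G →
      ∫⁻ x, ∫⁻ y, F x * G y * (ENNReal.ofReal |x - y|) ^ (-l) ≤
        ENNReal.ofReal C * (∫⁻ x, F x ^ p) ^ (1 / p) * (∫⁻ y, G y ^ r) ^ (1 / r) := by
  obtain ⟨C, hC, H⟩ := hls_normalized p r l hp hr hl0 hl hpl hrl hpr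
  refine ⟨C, hC, fun F G hF hG => ?_⟩
  have hp0 : 0 < p := by linarith
  have hr0 : 0 < r := by linarith
  by_cases hF0 : ∫⁻ x, F x ^ p = 0
  · rw [lintegral_bil_zero_left F G (fun x y => (ENNReal.ofReal |x - y|) ^ (-l)) p hp0 hF hF0]
    exact zero_le
  by_cases hG0 : ∫⁻ x, G x ^ r = 0
  · rw [lintegral_bil_zero_right F G (fun x y => (ENNReal.ofReal |x - y|) ^ (-l)) r hr0 hG hG0]
    exact zero_le
  have hC' : ENNReal.ofReal C ≠ 0 := by simpa using hC
  have hFp : (∫⁻ x, F x ^ p) ^ (1 / p) ≠ 0 := by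
    simp [ENNReal.rpow_eq_zero_iff, hF0, hp0, hp0.le]
  have hGp : (∫⁻ x, G x ^ r) ^ (1 / r) ≠ 0 := by
    simp [ENNReal.rpow_eq_zero_iff, hG0, hr0, hr0.le]
  by_cases hFt : ∫⁻ x, F x ^ p = ∞
  · rw [hFt, ENNReal.top_rpow_of_pos (by positivity), ENNReal.mul_top hC', ENNReal.top_mul hGp]
    exact le_top
  by_cases hGt : ∫⁻ x, G x ^ r = ∞
  · rw [hGt, ENNReal.top_rpow_of_pos (by positivity), ENNReal.mul_top (mul_ne_zero hC' hFp)]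
    exact le_top
  have := H (fun x => ((∫⁻ x, F x ^ p) ^ (1 / p))⁻¹ * F x)
    (fun x => ((∫⁻ x, G x ^ r) ^ (1 / r))⁻¹ * G x) (by fun_prop) (by fun_prop)
    (normalize_int F p hp0 hF hF0 hFt) (normalize_int G r hr0 hG hG0 hGt)
  have hFpt : (∫⁻ x, F x ^ p) ^ (1 / p) ≠ ∞ := ENNReal.rpow_ne_top_of_nonneg (by positivity) hFt
  have hGpt : (∫⁻ x, G x ^ r) ^ (1 / r) ≠ ∞ := ENNReal.rpow_ne_top_of_nonneg (by positivity) hGt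
  set a := (∫⁻ x, F x ^ p) ^ (1 / p)
  set b := (∫⁻ x, G x ^ r) ^ (1 / r)
  have e : ∫⁻ x, ∫⁻ y, (a⁻¹ * F x) * (b⁻¹ * G y) * (ENNReal.ofReal |x - y|) ^ (-l)
      = a⁻¹ * b⁻¹ * ∫⁻ x, ∫⁻ y, F x * G y * (ENNReal.ofReal |x - y|) ^ (-l) := by
    have hm : Measurable fun z : ℝ × ℝ => F z.1 * G z.2 * (ENNReal.ofReal |z.1 - z.2|) ^ (-l) := by
      fun_prop
    rw [← lintegral_const_mul _ hm.lintegral_prod_right']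
    refine lintegral_congr fun x => ?_
    rw [← lintegral_const_mul _ (by fun_prop)]
    refine lintegral_congr fun y => ?_
    ring
  rw [e] at this
  set J := ∫⁻ x, ∫⁻ y, F x * G y * (ENNReal.ofReal |x - y|) ^ (-l)
  calc J = (a * a⁻¹) * (b * b⁻¹) * J := by
        rw [ENNReal.mul_inv_cancel hFp hFpt, ENNReal.mul_inv_cancel hGp hGpt]; simp
    _ = a * b * (a⁻¹ * b⁻¹ * J) := by ring
    _ ≤ a * b * ENNReal.ofReal C := by gcongr
    _ = _ := by ring

/-- The one-dimensional bilinear estimate. -/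
lemma bil1 (a b : ℝ) (ha : 0 ≤ a) (ha2 : a < 1 / 2) (hba : b ≤ 1 - a) (hb0 : a = 0 → b < 1) :
    ∃ C : ℝ, 0 < C ∧ ∀ R : ℝ, 0 < R → ∀ F G : ℝ → ℝ≥0∞, Measurable F → Measurable G →
      ∫⁻ x, ∫⁻ y, G x * F y * ker1 b R (x - y) ≤
        ENNReal.ofReal (C * R ^ (1 - a - b)) * (∫⁻ x, F x ^ (2:ℝ)) ^ (1 / (2:ℝ))
          * (∫⁻ y, G y ^ (1 / (1 / 2 + a))) ^ (1 / 2 + a) := by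
  rcases ha.eq_or_lt with h0 | h0
  · subst h0
    have hb : b < 1 := hb0 rfl
    refine ⟨2 / (1 - b), div_pos two_pos (by linarith), fun R hR F G hF hG => ?_⟩
    have hk : Measurable fun z : ℝ × ℝ => ker1 b R (z.1 - z.2) :=
      (measurable_ker1 b R).comp (by fun_prop)
    have hm : Measurable fun z : ℝ × ℝ => G z.1 ^ (2:ℝ) * ker1 b R (z.1 - z.2) :=
      Measurable.mul (by fun_prop) hk
    have hm' : Measurable fun z : ℝ × ℝ => F z.2 ^ (2:ℝ) * ker1 b R (z.1 - z.2) :=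
      Measurable.mul (by fun_prop) hk
    set I := ∫⁻ z, ker1 b R z with hI
    have hG2 : ∫⁻ z : ℝ × ℝ, G z.1 ^ (2:ℝ) * ker1 b R (z.1 - z.2) = I * ∫⁻ x, G x ^ (2:ℝ) := by
      rw [Measure.volume_eq_prod, lintegral_prod _ hm.aemeasurable,
        ← lintegral_const_mul _ (by fun_prop)]
      refine lintegral_congr fun x => ?_
      rw [lintegral_const_mul (G x ^ (2:ℝ)) (f := fun y => ker1 b R (x - y))
        ((measurable_ker1 b R).comp (by fun_prop)),
        lintegral_sub_left_eq_self (fun z => ker1 b R z), mul_comm]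
    have hF2 : ∫⁻ z : ℝ × ℝ, F z.2 ^ (2:ℝ) * ker1 b R (z.1 - z.2) = I * ∫⁻ x, F x ^ (2:ℝ) := by
      rw [Measure.volume_eq_prod, lintegral_prod_symm _ hm'.aemeasurable,
        ← lintegral_const_mul _ (by fun_prop)]
      refine lintegral_congr fun x => ?_
      rw [lintegral_const_mul (F x ^ (2:ℝ)) (f := fun y => ker1 b R (y - x))
        ((measurable_ker1 b R).comp (by fun_prop)),
        lintegral_sub_right_eq_self (fun z => ker1 b R z), mul_comm]
    calc ∫⁻ x, ∫⁻ y, G x * F y * ker1 b R (x - y)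
        = ∫⁻ z : ℝ × ℝ, (F z.2 ^ (2:ℝ) * ker1 b R (z.1 - z.2)) ^ (1 / (2:ℝ)) *
            (G z.1 ^ (2:ℝ) * ker1 b R (z.1 - z.2)) ^ (1 / (2:ℝ)) := by
          rw [Measure.volume_eq_prod, lintegral_prod]
          · refine lintegral_congr fun x => lintegral_congr fun y => ?_
            simp only []
            rw [← ENNReal.mul_rpow_of_nonneg _ _ (by norm_num)]
            have : F y ^ (2:ℝ) * ker1 b R (x - y) * (G x ^ (2:ℝ) * ker1 b R (x - y))
                = (G x * F y * ker1 b R (x - y)) ^ (2:ℝ) := by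
              rw [ENNReal.mul_rpow_of_nonneg _ _ (by norm_num),
                ENNReal.mul_rpow_of_nonneg _ _ (by norm_num)]
              simp only [ENNReal.rpow_two]; ring
            rw [this, ← ENNReal.rpow_mul]; norm_num
          · exact ((hm'.pow_const _).mul (hm.pow_const _)).aemeasurable
      _ ≤ (∫⁻ z : ℝ × ℝ, F z.2 ^ (2:ℝ) * ker1 b R (z.1 - z.2)) ^ (1 / (2:ℝ)) *
            (∫⁻ z : ℝ × ℝ, G z.1 ^ (2:ℝ) * ker1 b R (z.1 - z.2)) ^ (1 / (2:ℝ)) :=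
          ENNReal.lintegral_mul_norm_pow_le hm'.aemeasurable hm.aemeasurable (by norm_num)
            (by norm_num) (by norm_num)
      _ = I * (∫⁻ x, F x ^ (2:ℝ)) ^ (1 / (2:ℝ)) * (∫⁻ x, G x ^ (2:ℝ)) ^ (1 / (2:ℝ)) := by
          rw [hG2, hF2, ENNReal.mul_rpow_of_nonneg _ _ (by norm_num),
            ENNReal.mul_rpow_of_nonneg _ _ (by norm_num)]
          have : I ^ (1 / (2:ℝ)) * I ^ (1 / (2:ℝ)) = I := by
            rw [← ENNReal.rpow_add_of_nonneg _ _ (by norm_num) (by norm_num)]; norm_num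
          calc _ = (I ^ (1 / (2:ℝ)) * I ^ (1 / (2:ℝ))) * (∫⁻ x, F x ^ (2:ℝ)) ^ (1 / (2:ℝ)) *
                (∫⁻ x, G x ^ (2:ℝ)) ^ (1 / (2:ℝ)) := by ring
            _ = _ := by rw [this]
      _ ≤ _ := by
          have := ker1_int b R hb hR
          have e : (1 / (1 / 2 + 0) : ℝ) = 2 := by norm_num
          rw [e, add_zero, sub_zero]
          gcongr
  · obtain ⟨C, hC, H⟩ := hls (1 / (1 / 2 + a)) 2 (1 - a)
      (by rw [le_div_iff₀ (by linarith)]; linarith) (by norm_num) (by linarith) (by linarith)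
      (by rw [div_mul_eq_mul_div, div_lt_one (by linarith)]; linarith) (by linarith)
      (by rw [one_div_one_div]; ring)
    refine ⟨C, hC, fun R hR F G hF hG => ?_⟩
    have hm : Measurable fun z : ℝ × ℝ =>
        G z.1 * F z.2 * (ENNReal.ofReal |z.1 - z.2|) ^ (-(1 - a)) := by fun_prop
    calc ∫⁻ x, ∫⁻ y, G x * F y * ker1 b R (x - y)
        ≤ ∫⁻ x, ∫⁻ y, ENNReal.ofReal (R ^ (1 - a - b)) *
            (G x * F y * (ENNReal.ofReal |x - y|) ^ (-(1 - a))) := by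
          refine lintegral_mono fun x => lintegral_mono fun y => ?_
          rw [mul_left_comm]
          refine mul_le_mul_right ?_ _
          unfold ker1
          split_ifs with h
          · by_cases hxy : x - y = 0
            · rw [hxy]
              simp only [abs_zero, ENNReal.ofReal_zero]
              rw [ENNReal.zero_rpow_of_neg (y := -(1 - a)) (by linarith), ENNReal.mul_top]
              · exact le_top
              · simpa using Real.rpow_pos_of_pos hR _
            · have hpos : 0 < |x - y| := abs_pos.2 hxy
              rw [ENNReal.ofReal_rpow_of_pos hpos, ENNReal.ofReal_rpow_of_pos hpos,
                ← ENNReal.ofReal_mul (Real.rpow_nonneg hR.le _)]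
              apply ENNReal.ofReal_le_ofReal
              calc |x - y| ^ (-b) = |x - y| ^ (1 - a - b) * |x - y| ^ (-(1 - a)) := by
                    rw [← Real.rpow_add hpos]; congr 1; ring
                _ ≤ _ := by
                    refine mul_le_mul_of_nonneg_right ?_ (Real.rpow_nonneg hpos.le _)
                    exact Real.rpow_le_rpow hpos.le h.le (by linarith)
          · exact zero_le
      _ = ENNReal.ofReal (R ^ (1 - a - b)) *
            ∫⁻ x, ∫⁻ y, G x * F y * (ENNReal.ofReal |x - y|) ^ (-(1 - a)) := by
          rw [← lintegral_const_mul _ hm.lintegral_prod_right']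
          refine lintegral_congr fun x => ?_
          rw [lintegral_const_mul _ (by fun_prop)]
      _ ≤ ENNReal.ofReal (R ^ (1 - a - b)) * _ := mul_le_mul_right (H G F hG hF) _
      _ = _ := by
          rw [one_div_one_div, ENNReal.ofReal_mul hC.le]; ring

/-! ### Tensorization -/

/-- A bilinear one-dimensional estimate with constant `C`. -/
def Bil (k : ℝ → ℝ≥0∞) (C : ℝ≥0∞) (ρ : ℝ) : Prop :=
  ∀ F G : ℝ → ℝ≥0∞, Measurable F → Measurable G →
    ∫⁻ x, ∫⁻ y, G x * F y * k (x - y) ≤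
      C * (∫⁻ x, F x ^ (2:ℝ)) ^ (1 / (2:ℝ)) * (∫⁻ y, G y ^ (1 / ρ)) ^ ρ

lemma bil_step {X : Type*} [MeasurableSpace X] (μ : Measure X) [SigmaFinite μ]
    (κ : X × X → ℝ≥0∞) (hκ : Measurable κ) (k : ℝ → ℝ≥0∞) (hk : Measurable k)
    (C : ℝ≥0∞) (ρ : ℝ) (hB : Bil k C ρ) (F H : X × ℝ → ℝ≥0∞) (hF : Measurable F)
    (hH : Measurable H) :
    ∫⁻ p, H p * ∫⁻ q, F q * (k (p.2 - q.2) * κ (p.1, q.1)) ∂(μ.prod volume) ∂(μ.prod volume) ≤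
      C * ∫⁻ x, (∫⁻ s, H (x, s) ^ (1 / ρ)) ^ ρ *
        ∫⁻ y, (∫⁻ t, F (y, t) ^ (2:ℝ)) ^ (1 / (2:ℝ)) * κ (x, y) ∂μ ∂μ := by
  have hm0 : Measurable fun z : (X × ℝ) × (X × ℝ) =>
      F z.2 * (k (z.1.2 - z.2.2) * κ (z.1.1, z.2.1)) := by fun_prop
  have hFm : Measurable fun y => (∫⁻ t, F (y, t) ^ (2:ℝ)) ^ (1 / (2:ℝ)) :=
    ((hF.pow_const _).lintegral_prod_right').pow_const _
  have hHm : Measurable fun y => (∫⁻ t, H (y, t) ^ (1 / ρ)) ^ ρ :=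
    ((hH.pow_const _).lintegral_prod_right').pow_const _
  have hmm : Measurable fun p : X × ℝ =>
      H p * ∫⁻ q, F q * (k (p.2 - q.2) * κ (p.1, q.1)) ∂(μ.prod volume) :=
    hH.mul hm0.lintegral_prod_right'
  rw [lintegral_prod _ hmm.aemeasurable]
  have hc : Measurable fun x => (∫⁻ s, H (x, s) ^ (1 / ρ)) ^ ρ *
        ∫⁻ y, (∫⁻ t, F (y, t) ^ (2:ℝ)) ^ (1 / (2:ℝ)) * κ (x, y) ∂μ := by
    refine hHm.mul ?_
    exact Measurable.lintegral_prod_right' (f := fun z : X × X =>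
      (∫⁻ t, F (z.2, t) ^ (2:ℝ)) ^ (1 / (2:ℝ)) * κ z) ((hFm.comp measurable_snd).mul hκ)
  rw [← lintegral_const_mul _ hc]
  refine lintegral_mono fun x => ?_
  have hm1 : Measurable fun z : (ℝ × X) × ℝ =>
      H (x, z.1.1) * F (z.1.2, z.2) * k (z.1.1 - z.2) := by fun_prop
  have hm2 : Measurable fun z : ℝ × X =>
      κ (x, z.2) * ∫⁻ t, H (x, z.1) * F (z.2, t) * k (z.1 - t) :=
    Measurable.mul (by fun_prop) hm1.lintegral_prod_right'
  calc ∫⁻ s, H (x, s) * ∫⁻ q, F q * (k (s - q.2) * κ (x, q.1)) ∂(μ.prod volume)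
      = ∫⁻ s, ∫⁻ y, κ (x, y) * ∫⁻ t, H (x, s) * F (y, t) * k (s - t) ∂volume ∂μ := by
        refine lintegral_congr fun s => ?_
        have hm3 : Measurable fun q : X × ℝ => F q * (k (s - q.2) * κ (x, q.1)) := by fun_prop
        rw [lintegral_prod _ hm3.aemeasurable, ← lintegral_const_mul _ hm3.lintegral_prod_right']
        refine lintegral_congr fun y => ?_
        rw [← lintegral_const_mul _ (by fun_prop), ← lintegral_const_mul _ (by fun_prop)]
        refine lintegral_congr fun t => ?_
        ring
    _ = ∫⁻ y, ∫⁻ s, κ (x, y) * ∫⁻ t, H (x, s) * F (y, t) * k (s - t) ∂volume ∂volume ∂μ := by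
        rw [lintegral_lintegral_swap]
        exact hm2.aemeasurable
    _ ≤ ∫⁻ y, C * (∫⁻ s, H (x, s) ^ (1 / ρ)) ^ ρ *
          ((∫⁻ t, F (y, t) ^ (2:ℝ)) ^ (1 / (2:ℝ)) * κ (x, y)) ∂μ := by
        refine lintegral_mono fun y => ?_
        have hm4 : Measurable fun z : ℝ × ℝ => H (x, z.1) * F (y, z.2) * k (z.1 - z.2) := by
          fun_prop
        rw [lintegral_const_mul _ hm4.lintegral_prod_right']
        calc _ ≤ κ (x, y) * _ := mul_le_mul_right (hB (fun t => F (y, t)) (fun s => H (x, s))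
              (by fun_prop) (by fun_prop)) _
          _ = _ := by ring
    _ = _ := by
        have hm5 : Measurable fun y => (∫⁻ t, F (y, t) ^ (2:ℝ)) ^ (1 / (2:ℝ)) * κ (x, y) :=
          hFm.mul (by fun_prop)
        rw [lintegral_const_mul _ hm5, mul_assoc]

lemma bil3 (k1 k2 k3 : ℝ → ℝ≥0∞) (hk1 : Measurable k1) (hk2 : Measurable k2) (hk3 : Measurable k3)
    (C1 C2 C3 : ℝ≥0∞) (ρ1 ρ2 ρ3 : ℝ) (h1 : Bil k1 C1 ρ1) (h2 : Bil k2 C2 ρ2) (h3 : Bil k3 C3 ρ3)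
    (F H : (ℝ × ℝ) × ℝ → ℝ≥0∞) (hF : Measurable F) (hH : Measurable H) :
    ∫⁻ p, H p * ∫⁻ q, F q * (k1 (p.2 - q.2) * (k2 (p.1.2 - q.1.2) * k3 (p.1.1 - q.1.1))) ≤
      C1 * C2 * C3 * (∫⁻ q, F q ^ (2:ℝ)) ^ (1 / (2:ℝ)) *
        (∫⁻ x3, ((∫⁻ x2, ((∫⁻ x1, H ((x3, x2), x1) ^ (1 / ρ1)) ^ ρ1) ^ (1 / ρ2)) ^ ρ2)
          ^ (1 / ρ3)) ^ ρ3 := by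
  have hF1 : Measurable fun y : ℝ × ℝ => (∫⁻ t, F (y, t) ^ (2:ℝ)) ^ (1 / (2:ℝ)) :=
    ((hF.pow_const _).lintegral_prod_right').pow_const _
  have hH1 : Measurable fun y : ℝ × ℝ => (∫⁻ t, H (y, t) ^ (1 / ρ1)) ^ ρ1 :=
    ((hH.pow_const _).lintegral_prod_right').pow_const _
  have hF2 : Measurable fun y : ℝ =>
      (∫⁻ u, ((∫⁻ t, F ((y, u), t) ^ (2:ℝ)) ^ (1 / (2:ℝ))) ^ (2:ℝ)) ^ (1 / (2:ℝ)) :=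
    ((hF1.pow_const _).lintegral_prod_right').pow_const _
  have hH2 : Measurable fun y : ℝ =>
      (∫⁻ u, ((∫⁻ t, H ((y, u), t) ^ (1 / ρ1)) ^ ρ1) ^ (1 / ρ2)) ^ ρ2 :=
    ((hH1.pow_const _).lintegral_prod_right').pow_const _
  have s1 := bil_step (X := ℝ × ℝ) volume
    (fun z => k2 (z.1.2 - z.2.2) * k3 (z.1.1 - z.2.1)) (by fun_prop) k1 hk1 C1 ρ1 h1 F H hF hH
  have s2 := bil_step (X := ℝ) volume (fun z => k3 (z.1 - z.2)) (by fun_prop) k2 hk2 C2 ρ2 h2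
    (fun y => (∫⁻ t, F (y, t) ^ (2:ℝ)) ^ (1 / (2:ℝ)))
    (fun y => (∫⁻ t, H (y, t) ^ (1 / ρ1)) ^ ρ1) hF1 hH1
  have s3 := h3 _ _ hF2 hH2
  have hFF : ∫⁻ x3, ((∫⁻ u, ((∫⁻ t, F ((x3, u), t) ^ (2:ℝ)) ^ (1 / (2:ℝ))) ^ (2:ℝ))
      ^ (1 / (2:ℝ))) ^ (2:ℝ) = ∫⁻ q, F q ^ (2:ℝ) := by
    have e : ∀ a : ℝ≥0∞, (a ^ (1 / (2:ℝ))) ^ (2:ℝ) = a := by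
      intro a; rw [← ENNReal.rpow_mul]; norm_num
    simp only [e]
    have hm := hF.pow_const (2:ℝ)
    rw [Measure.volume_eq_prod, lintegral_prod _ hm.aemeasurable, Measure.volume_eq_prod,
      lintegral_prod _ hm.lintegral_prod_right'.aemeasurable]
  rw [hFF] at s3
  calc _ ≤ _ := s1
    _ ≤ C1 * _ := mul_le_mul_right s2 _
    _ ≤ C1 * (C2 * (C3 * (∫⁻ q, F q ^ (2:ℝ)) ^ (1 / (2:ℝ)) * _)) := by
        refine mul_le_mul_right (mul_le_mul_right (le_trans (le_of_eq ?_) s3) _) _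
        refine lintegral_congr fun x => ?_
        have hm5 : Measurable fun y : ℝ =>
            (∫⁻ u, ((∫⁻ t, F ((y, u), t) ^ (2:ℝ)) ^ (1 / (2:ℝ))) ^ (2:ℝ)) ^ (1 / (2:ℝ)) *
              k3 (x - y) := hF2.mul (by fun_prop)
        change _ * ∫⁻ y : ℝ, (∫⁻ u, ((∫⁻ t, F ((y, u), t) ^ (2:ℝ)) ^ (1 / (2:ℝ))) ^ (2:ℝ))
          ^ (1 / (2:ℝ)) * k3 (x - y) = _
        rw [← lintegral_const_mul _ hm5]
        refine lintegral_congr fun y => ?_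
        ring
    _ = _ := by ring

/-! ### Duality -/

lemma rpow_mul_rpow_fin (A : ℝ≥0∞) (hA : A ≠ ∞) (u v : ℝ) (hu : 0 < u) (huv : 0 < u + v) :
    A ^ u * A ^ v = A ^ (u + v) := by
  by_cases h : A = 0
  · rw [h, ENNReal.zero_rpow_of_pos hu, ENNReal.zero_rpow_of_pos huv, zero_mul]
  · rw [ENNReal.rpow_add _ _ h hA]

lemma lintegral_box_ne_top (g : ℝ → ℝ≥0∞) (K : ℝ≥0∞) (hK : K ≠ ∞) (T : ℝ)
    (h : ∀ x, g x ≤ K) (h0 : ∀ x, T ≤ |x| → g x = 0) :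
    ∫⁻ x, g x ≤ K * ENNReal.ofReal (2 * T) := by
  calc ∫⁻ x, g x ≤ ∫⁻ x, (Ioo (-T) T).indicator (fun _ => K) x := by
        refine lintegral_mono fun x => ?_
        by_cases hx : |x| < T
        · rw [indicator_of_mem]
          · exact h x
          · exact abs_lt.1 hx
        · rw [h0 x (not_lt.1 hx)]; exact zero_le
    _ = _ := by
        rw [lintegral_indicator measurableSet_Ioo, setLIntegral_const, Real.volume_Ioo]
        congr 2; ring

lemma dual3 (φ : (ℝ × ℝ) × ℝ → ℝ≥0∞) (hφ : Measurable φ) (K : ℝ≥0∞) (hK : K ≠ ∞) (T : ℝ)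
    (hφK : ∀ p, φ p ≤ K) (h1 : ∀ p, T ≤ |p.2| → φ p = 0) (h2 : ∀ p, T ≤ |p.1.2| → φ p = 0)
    (h3 : ∀ p, T ≤ |p.1.1| → φ p = 0)
    (q1 q2 q3 : ℝ) (hq1 : 2 ≤ q1) (hq2 : 2 ≤ q2) (hq3 : 2 ≤ q3) (M : ℝ≥0∞)
    (hM : ∀ H : (ℝ × ℝ) × ℝ → ℝ≥0∞, Measurable H →
      ∫⁻ p, H p * φ p ≤ M * (∫⁻ x3, ((∫⁻ x2, ((∫⁻ x1, H ((x3, x2), x1) ^ (1 / (1 - 1 / q1)))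
        ^ (1 - 1 / q1)) ^ (1 / (1 - 1 / q2))) ^ (1 - 1 / q2)) ^ (1 / (1 - 1 / q3)))
          ^ (1 - 1 / q3)) :
    (∫⁻ x3, (∫⁻ x2, (∫⁻ x1, φ ((x3, x2), x1) ^ q1) ^ (q2 / q1)) ^ (q3 / q2)) ^ (1 / q3) ≤ M := by
  have p1 : 0 < q1 := by linarith
  have p2 : 0 < q2 := by linarith
  have p3 : 0 < q3 := by linarith
  have hr : ∀ q : ℝ, 2 ≤ q → 0 < 1 - 1 / q := by
    intro q hq
    have : 1 / q ≤ 1 / 2 := one_div_le_one_div_of_le two_pos hq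
    linarith
  have r1 := hr q1 hq1
  have r2 := hr q2 hq2
  have r3 := hr q3 hq3
  set A : ℝ × ℝ → ℝ≥0∞ := fun y => ∫⁻ x1, φ (y, x1) ^ q1 with hA
  have hAm : Measurable A := (hφ.pow_const _).lintegral_prod_right'
  set B : ℝ → ℝ≥0∞ := fun x3 => ∫⁻ x2, A (x3, x2) ^ (q2 / q1) with hB
  have hBm : Measurable B := (hAm.pow_const _).lintegral_prod_right'
  set N := ∫⁻ x3, B x3 ^ (q3 / q2) with hN
  set KA := K ^ q1 * ENNReal.ofReal (2 * T) with hKA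
  have hKAt : KA ≠ ∞ := ENNReal.mul_ne_top (ENNReal.rpow_ne_top_of_nonneg p1.le hK)
    ENNReal.ofReal_ne_top
  have hAK : ∀ y, A y ≤ KA := fun y =>
    lintegral_box_ne_top _ _ (ENNReal.rpow_ne_top_of_nonneg p1.le hK) T
      (fun x => ENNReal.rpow_le_rpow (hφK _) p1.le)
      (fun x hx => by rw [h1 _ hx, ENNReal.zero_rpow_of_pos p1])
  have hA2 : ∀ y : ℝ × ℝ, T ≤ |y.2| → A y = 0 := by
    intro y hy
    have : ∀ x, φ (y, x) ^ q1 = 0 := fun x => by rw [h2 _ hy, ENNReal.zero_rpow_of_pos p1]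
    simp [hA, this]
  have hA3 : ∀ y : ℝ × ℝ, T ≤ |y.1| → A y = 0 := by
    intro y hy
    have : ∀ x, φ (y, x) ^ q1 = 0 := fun x => by rw [h3 _ hy, ENNReal.zero_rpow_of_pos p1]
    simp [hA, this]
  have e21 : 0 < q2 / q1 := div_pos p2 p1
  have e32 : 0 < q3 / q2 := div_pos p3 p2
  set KB := KA ^ (q2 / q1) * ENNReal.ofReal (2 * T) with hKB
  have hKBt : KB ≠ ∞ := ENNReal.mul_ne_top (ENNReal.rpow_ne_top_of_nonneg e21.le hKAt)
    ENNReal.ofReal_ne_top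
  have hBK : ∀ y, B y ≤ KB := fun y =>
    lintegral_box_ne_top _ _ (ENNReal.rpow_ne_top_of_nonneg e21.le hKAt) T
      (fun x => ENNReal.rpow_le_rpow (hAK _) e21.le)
      (fun x hx => by rw [hA2 _ hx, ENNReal.zero_rpow_of_pos e21])
  have hB3 : ∀ y : ℝ, T ≤ |y| → B y = 0 := by
    intro y hy
    have : ∀ x, A (y, x) ^ (q2 / q1) = 0 := fun x => by
      rw [hA3 _ hy, ENNReal.zero_rpow_of_pos e21]
    simp [hB, this]
  have hNt : N ≠ ∞ := by
    refine ne_top_of_le_ne_top (ENNReal.mul_ne_top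
      (ENNReal.rpow_ne_top_of_nonneg e32.le hKBt) (ENNReal.ofReal_ne_top (r := 2 * T))) ?_
    exact lintegral_box_ne_top _ _ (ENNReal.rpow_ne_top_of_nonneg e32.le hKBt) T
      (fun x => ENNReal.rpow_le_rpow (hBK _) e32.le)
      (fun x hx => by rw [hB3 _ hx, ENNReal.zero_rpow_of_pos e32])
  have hAt : ∀ y, A y ≠ ∞ := fun y => ne_top_of_le_ne_top hKAt (hAK y)
  have hBt : ∀ y, B y ≠ ∞ := fun y => ne_top_of_le_ne_top hKBt (hBK y)
  change N ^ (1 / q3) ≤ M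
  set H : (ℝ × ℝ) × ℝ → ℝ≥0∞ := fun p =>
    φ p ^ (q1 - 1) * (A p.1 ^ (q2 / q1 - 1) * B p.1.1 ^ (q3 / q2 - 1)) with hH
  have hHm : Measurable H := by fun_prop
  have key := hM H hHm
  -- left side
  have hL : ∫⁻ p, H p * φ p = N := by
    have hmm : Measurable fun p => H p * φ p := hHm.mul hφ
    rw [Measure.volume_eq_prod, lintegral_prod _ hmm.aemeasurable]
    have : ∀ y : ℝ × ℝ, ∫⁻ s, H (y, s) * φ (y, s) = A y ^ (q2 / q1) * B y.1 ^ (q3 / q2 - 1) := by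
      intro y
      have : ∀ s, H (y, s) * φ (y, s) =
          φ (y, s) ^ q1 * (A y ^ (q2 / q1 - 1) * B y.1 ^ (q3 / q2 - 1)) := by
        intro s
        have e : φ (y, s) ^ (q1 - 1) * φ (y, s) = φ (y, s) ^ q1 := by
          conv_lhs => rw [← ENNReal.rpow_one (φ (y, s)), ← ENNReal.rpow_mul, one_mul]
          rw [← ENNReal.rpow_add_of_nonneg _ _ (by linarith) (by norm_num), sub_add_cancel]
        rw [← e]; simp only [hH]; ring
      simp only [this]
      rw [lintegral_mul_const _ (by fun_prop), ← mul_assoc]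
      congr 1
      change A y * _ = _
      conv_lhs => rw [← ENNReal.rpow_one (A y), ← ENNReal.rpow_mul, one_mul]
      rw [rpow_mul_rpow_fin _ (hAt y) _ _ one_pos (by linarith)]
      congr 1; ring
    simp only [this]
    have hm : Measurable fun y : ℝ × ℝ => A y ^ (q2 / q1) * B y.1 ^ (q3 / q2 - 1) := by fun_prop
    rw [Measure.volume_eq_prod, lintegral_prod _ hm.aemeasurable]
    refine lintegral_congr fun x3 => ?_
    simp only []
    rw [lintegral_mul_const _ (by fun_prop)]
    change B x3 * _ = _
    conv_lhs => rw [← ENNReal.rpow_one (B x3), ← ENNReal.rpow_mul, one_mul]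
    rw [rpow_mul_rpow_fin _ (hBt x3) _ _ one_pos (by linarith)]
    congr 1; ring
  have hR1 : ∀ y : ℝ × ℝ, (∫⁻ x1, H (y, x1) ^ (1 / (1 - 1 / q1))) ^ (1 - 1 / q1)
      = A y ^ ((q2 - 1) / q1) * B y.1 ^ (q3 / q2 - 1) := by
    intro y
    have : ∀ s, H (y, s) ^ (1 / (1 - 1 / q1)) =
        φ (y, s) ^ q1 * (A y ^ (q2 / q1 - 1) * B y.1 ^ (q3 / q2 - 1)) ^ (1 / (1 - 1 / q1)) := by
      intro s
      simp only [hH]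
      rw [ENNReal.mul_rpow_of_nonneg _ _ (by positivity), ← ENNReal.rpow_mul]
      congr 2
      have : q1 - 1 ≠ 0 := by linarith
      field_simp
    simp only [this]
    rw [lintegral_mul_const _ (by fun_prop), ENNReal.mul_rpow_of_nonneg _ _ r1.le,
      ← ENNReal.rpow_mul, one_div_mul_cancel r1.ne', ENNReal.rpow_one, ← mul_assoc]
    congr 1
    change A y ^ _ * _ = _
    have e : 1 - 1 / q1 + (q2 / q1 - 1) = (q2 - 1) / q1 := by field_simp; ring
    rw [rpow_mul_rpow_fin _ (hAt y) _ _ r1 (by rw [e]; exact div_pos (by linarith) p1), e]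
  have hR2 : ∀ x3 : ℝ, (∫⁻ x2, ((∫⁻ x1, H ((x3, x2), x1) ^ (1 / (1 - 1 / q1)))
        ^ (1 - 1 / q1)) ^ (1 / (1 - 1 / q2))) ^ (1 - 1 / q2) = B x3 ^ ((q3 - 1) / q2) := by
    intro x3
    have : ∀ x2, ((∫⁻ x1, H ((x3, x2), x1) ^ (1 / (1 - 1 / q1)))
        ^ (1 - 1 / q1)) ^ (1 / (1 - 1 / q2)) =
        A (x3, x2) ^ (q2 / q1) * (B x3 ^ (q3 / q2 - 1)) ^ (1 / (1 - 1 / q2)) := by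
      intro x2
      rw [hR1, ENNReal.mul_rpow_of_nonneg _ _ (by positivity), ← ENNReal.rpow_mul]
      congr 2
      have : q2 - 1 ≠ 0 := by linarith
      field_simp
    simp only [this]
    rw [lintegral_mul_const _ (by fun_prop), ENNReal.mul_rpow_of_nonneg _ _ r2.le,
      ← ENNReal.rpow_mul, one_div_mul_cancel r2.ne', ENNReal.rpow_one]
    change B x3 ^ _ * _ = _
    have e : 1 - 1 / q2 + (q3 / q2 - 1) = (q3 - 1) / q2 := by field_simp; ring
    rw [rpow_mul_rpow_fin _ (hBt x3) _ _ r2 (by rw [e]; exact div_pos (by linarith) p2), e]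
  simp only [hR2] at key
  have hR3 : ∫⁻ x3, (B x3 ^ ((q3 - 1) / q2)) ^ (1 / (1 - 1 / q3)) = N := by
    refine lintegral_congr fun x3 => ?_
    rw [← ENNReal.rpow_mul]
    congr 1
    have : q3 - 1 ≠ 0 := by linarith
    field_simp
  rw [hR3, hL] at key
  by_cases hN0 : N = 0
  · rw [hN0, ENNReal.zero_rpow_of_pos (by positivity)]; exact zero_le
  calc N ^ (1 / q3) = N * N ^ (-(1 - 1 / q3)) := by
        conv_rhs => rw [← ENNReal.rpow_one N, ← ENNReal.rpow_mul, one_mul]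
        rw [← ENNReal.rpow_add _ _ hN0 hNt]; congr 1; ring
    _ ≤ (M * N ^ (1 - 1 / q3)) * N ^ (-(1 - 1 / q3)) := by gcongr
    _ = M := by
        rw [mul_assoc, ← ENNReal.rpow_add _ _ hN0 hNt]; simp

/-! ### Coordinates -/

lemma MeasureTheory.MeasurePreserving.congr_fun {X Y : Type*} [MeasurableSpace X]
    [MeasurableSpace Y] {μ : Measure X} {ν : Measure Y} {f g : X → Y}
    (hf : MeasurePreserving f μ ν) (h : f = g) : MeasurePreserving g μ ν := h ▸ hf

lemma mp_pt3_s8 : MeasurePreserving (fun p : (ℝ × ℝ) × ℝ => pt3 p.2 p.1.2 p.1.1) volume volume := by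
  have a1 : MeasurePreserving (Prod.swap : (ℝ × ℝ) × ℝ → ℝ × (ℝ × ℝ)) volume volume :=
    Measure.measurePreserving_swap
  have a2 : MeasurePreserving (Prod.map id Prod.swap : ℝ × (ℝ × ℝ) → ℝ × (ℝ × ℝ)) volume volume :=
    (MeasurePreserving.id volume).prod Measure.measurePreserving_swap
  have a3 : MeasurePreserving (Prod.map id (MeasurableEquiv.finTwoArrow (α := ℝ)).symm)
      (volume : Measure (ℝ × (ℝ × ℝ))) volume :=
    (MeasurePreserving.id volume).prod
      ((volume_preserving_finTwoArrow ℝ).symm (MeasurableEquiv.finTwoArrow (α := ℝ)))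
  have a4 : MeasurePreserving (MeasurableEquiv.piFinSuccAbove (fun _ : Fin 3 => ℝ) 0).symm
      volume volume :=
    (volume_preserving_piFinSuccAbove (fun _ : Fin 3 => ℝ) 0).symm _
  have a5 := (EuclideanSpace.volume_preserving_symm_measurableEquiv_toLp (Fin 3)).symm _
  have := a5.comp (a4.comp (a3.comp (a2.comp a1)))
  refine (this : MeasurePreserving _ volume volume).congr_fun ?_
  funext p
  apply PiLp.ext
  intro i
  fin_cases i <;> rfl

lemma measurable_pt3 : Measurable (fun p : (ℝ × ℝ) × ℝ => pt3 p.2 p.1.2 p.1.1) :=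
  mp_pt3_s8.measurable

lemma lintegral_pt3 (g : E3 → ℝ≥0∞) (hg : Measurable g) :
    ∫⁻ p : (ℝ × ℝ) × ℝ, g (pt3 p.2 p.1.2 p.1.1) = ∫⁻ x, g x :=
  mp_pt3_s8.lintegral_comp hg

lemma pt3_0 (a b c : ℝ) : pt3 a b c 0 = a := rfl
lemma pt3_1 (a b c : ℝ) : pt3 a b c 1 = b := rfl
lemma pt3_2 (a b c : ℝ) : pt3 a b c 2 = c := rfl

lemma abs_coord_le (w : E3) (i : Fin 3) : |w i| ≤ ‖w‖ := PiLp.norm_apply_le w i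

/-! ### Kernel bounds -/

lemma kernel_bound (b1 b2 b3 R : ℝ) (h1 : 0 < b1) (h2 : 0 < b2) (h3 : 0 < b3)
    (hs : b1 + b2 + b3 = 2) (w : E3) (hw : ‖w‖ < R) :
    ENNReal.ofReal ‖w‖ ^ (-2:ℝ) ≤ ker1 b1 R (w 0) * (ker1 b2 R (w 1) * ker1 b3 R (w 2)) := by
  have hk : ∀ (b : ℝ) (i : Fin 3), 0 < b → ENNReal.ofReal ‖w‖ ^ (-b) ≤ ker1 b R (w i) := by
    intro b i hb
    have := abs_coord_le w i
    rw [ker1, if_pos (by linarith)]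
    rw [ENNReal.rpow_neg, ENNReal.rpow_neg]
    apply ENNReal.inv_le_inv.2
    exact ENNReal.rpow_le_rpow (ENNReal.ofReal_le_ofReal this) hb.le
  refine le_trans (le_of_eq ?_) (mul_le_mul' (hk b1 0 h1) (mul_le_mul' (hk b2 1 h2) (hk b3 2 h3)))
  by_cases h : ‖w‖ = 0
  · rw [h]; simp [ENNReal.zero_rpow_of_neg, h1, h2, h3]
  · have h0 : ENNReal.ofReal ‖w‖ ≠ 0 := by
      simp only [ne_eq, ENNReal.ofReal_eq_zero, not_le]
      exact lt_of_le_of_ne (norm_nonneg _) (Ne.symm h)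
    rw [← ENNReal.rpow_add _ _ h0 ENNReal.ofReal_ne_top,
      ← ENNReal.rpow_add _ _ h0 ENNReal.ofReal_ne_top]
    congr 1; linarith

lemma kernel_bound_zero (R : ℝ) (w : E3) (hw : ‖w‖ < R) :
    1 ≤ ker1 0 R (w 0) * (ker1 0 R (w 1) * ker1 0 R (w 2)) := by
  have hk : ∀ (i : Fin 3), ker1 0 R (w i) = 1 := by
    intro i
    have := abs_coord_le w i
    rw [ker1, if_pos (by linarith)]
    simp
  simp [hk]
/-! ### Pointwise potential estimate -/

lemma ftc_bound (f : E3 → ℝ) (hf : ContDiff ℝ (⊤ : ℕ∞) f) (x z : E3) :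
    ENNReal.ofReal |f x| ≤ ENNReal.ofReal |f (x + z)| +
      ∫⁻ t in Ioc (0:ℝ) 1, ENNReal.ofReal ‖fderiv ℝ f (x + t • z)‖ * ENNReal.ofReal ‖z‖ := by
  have hd : ∀ t ∈ uIcc (0:ℝ) 1, HasDerivAt (fun t : ℝ => f (x + t • z))
      (fderiv ℝ f (x + t • z) z) t := by
    intro t _
    have h1 : HasFDerivAt f (fderiv ℝ f (x + t • z)) (x + t • z) :=
      (hf.differentiable (by simp) _).hasFDerivAt
    have h2 : HasDerivAt (fun t : ℝ => x + t • z) z t := by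
      simpa using ((hasDerivAt_id t).smul_const z).const_add x
    exact h1.comp_hasDerivAt t h2
  have hc : Continuous (fderiv ℝ f) := hf.continuous_fderiv (by simp)
  have hcont : Continuous fun t : ℝ => fderiv ℝ f (x + t • z) z := by fun_prop
  have h := intervalIntegral.integral_eq_sub_of_hasDerivAt hd (hcont.intervalIntegrable 0 1)
  simp only [one_smul, zero_smul, add_zero] at h
  rw [intervalIntegral.integral_of_le zero_le_one] at h
  have h3 : ‖∫ t in Ioc (0:ℝ) 1, fderiv ℝ f (x + t • z) z‖ₑ ≤
      ∫⁻ t in Ioc (0:ℝ) 1, ENNReal.ofReal ‖fderiv ℝ f (x + t • z)‖ * ENNReal.ofReal ‖z‖ := by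
    refine (enorm_integral_le_lintegral_enorm _).trans (lintegral_mono fun t => ?_)
    rw [← ofReal_norm, ← ENNReal.ofReal_mul (norm_nonneg _)]
    exact ENNReal.ofReal_le_ofReal (ContinuousLinearMap.le_opNorm _ _)
  rw [h] at h3
  refine le_trans ?_ (add_le_add_right h3 _)
  rw [← ofReal_norm, ← ENNReal.ofReal_add (abs_nonneg _) (norm_nonneg _)]
  apply ENNReal.ofReal_le_ofReal
  have := abs_sub_abs_le_abs_sub (f x) (f (x + z))
  rw [Real.norm_eq_abs, abs_sub_comm]
  linarith

lemma lintegral_smul3 (t : ℝ) (ht : 0 < t) (H : E3 → ℝ≥0∞) (hH : Measurable H) :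
    ∫⁻ z, H (t • z) = ENNReal.ofReal (t ^ (-3:ℝ)) * ∫⁻ w, H w := by
  have h := Measure.map_addHaar_smul (volume : Measure E3) ht.ne'
  rw [← lintegral_map (f := H) (g := fun z : E3 => t • z) hH (by fun_prop), h,
    lintegral_smul_measure]
  simp only [finrank_euclideanSpace, Fintype.card_fin, smul_eq_mul]
  congr 2
  rw [abs_of_pos (by positivity), Real.rpow_neg ht.le]
  norm_cast

lemma int_pow_four (c : ℝ) (hc : 0 < c) :
    ∫⁻ t in Ioi c, ENNReal.ofReal (t ^ (-4:ℝ)) = ENNReal.ofReal (c ^ (-3:ℝ) / 3) := by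
  rw [← ofReal_integral_eq_lintegral_ofReal (integrableOn_Ioi_rpow_of_lt (by norm_num) hc),
    integral_Ioi_rpow_of_lt (by norm_num) hc]
  · congr 1; norm_num
  filter_upwards [ae_restrict_mem measurableSet_Ioi] with t ht
  exact Real.rpow_nonneg (hc.trans ht).le _

lemma cone_bound (g : E3 → ℝ≥0∞) (hg : Measurable g) (R : ℝ) (hR : 0 < R) :
    ∫⁻ z in ball (0:E3) R, ∫⁻ t in Ioc (0:ℝ) 1, g (t • z) * ENNReal.ofReal ‖z‖ ≤
      ENNReal.ofReal (R ^ 3 / 3) * ∫⁻ w in ball (0:E3) R, g w * ENNReal.ofReal ‖w‖ ^ (-2:ℝ) := by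
  have hmI : Measurable fun z : E3 × ℝ => g (z.2 • z.1) * ENNReal.ofReal ‖z.1‖ := by fun_prop
  rw [lintegral_lintegral_swap hmI.aemeasurable]
  -- the joint function
  set J : E3 × ℝ → ℝ≥0∞ := fun p =>
    {p : E3 × ℝ | ‖p.1‖ < p.2 * R}.indicator
      (fun p => g p.1 * ENNReal.ofReal ‖p.1‖ * ENNReal.ofReal (p.2 ^ (-4:ℝ))) p with hJ
  have hJm : Measurable J := by
    refine Measurable.indicator (by fun_prop) (measurableSet_lt (by fun_prop) (by fun_prop))
  have step1 : ∀ t ∈ Ioc (0:ℝ) 1, ∫⁻ z in ball (0:E3) R, g (t • z) * ENNReal.ofReal ‖z‖ =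
      ∫⁻ w, J (w, t) := by
    intro t ht
    have t0 := ht.1
    set H : E3 → ℝ≥0∞ := fun w => (ball (0:E3) (t * R)).indicator
      (fun w => g w * ENNReal.ofReal (t⁻¹ * ‖w‖)) w with hH
    have hHm : Measurable H := Measurable.indicator (by fun_prop) measurableSet_ball
    have e1 : ∫⁻ z in ball (0:E3) R, g (t • z) * ENNReal.ofReal ‖z‖ = ∫⁻ z, H (t • z) := by
      rw [← lintegral_indicator measurableSet_ball]
      refine lintegral_congr fun z => ?_
      simp only [hH, indicator, mem_ball_zero_iff, norm_smul, Real.norm_eq_abs, abs_of_pos t0,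
        mul_lt_mul_iff_right₀ t0]
      rw [inv_mul_cancel_left₀ t0.ne']
    rw [e1, lintegral_smul3 t t0 H hHm, ← lintegral_const_mul _ hHm]
    refine lintegral_congr fun w => ?_
    simp only [hH, hJ, indicator, mem_ball_zero_iff, mem_ofPred_eq]
    split_ifs
    · rw [ENNReal.ofReal_mul (by positivity)]
      have : ENNReal.ofReal (t ^ (-4:ℝ)) = ENNReal.ofReal (t ^ (-3:ℝ)) * ENNReal.ofReal t⁻¹ := by
        rw [← ENNReal.ofReal_mul (by positivity), ← Real.rpow_neg_one, ← Real.rpow_add t0]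
        norm_num
      rw [this]; ring
    · simp
  rw [setLIntegral_congr_fun measurableSet_Ioc step1]
  rw [lintegral_lintegral_swap (by exact (hJm.comp measurable_swap).aemeasurable)]
  rw [← lintegral_const_mul' _ _ ENNReal.ofReal_ne_top, ← lintegral_indicator measurableSet_ball]
  refine lintegral_mono fun w => ?_
  by_cases hw : ‖w‖ < R
  · rw [indicator_of_mem (by simpa using hw)]
    by_cases hw0 : ‖w‖ = 0
    · have hz : ∀ t, J (w, t) = 0 := by
        intro t
        simp only [hJ, indicator, hw0]
        simp
      simp only [hz]
      simp
    have w0 : 0 < ‖w‖ := lt_of_le_of_ne (norm_nonneg _) (Ne.symm hw0)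
    calc ∫⁻ t in Ioc (0:ℝ) 1, J (w, t)
        ≤ ∫⁻ t, J (w, t) := setLIntegral_le_lintegral _ _
      _ = ∫⁻ t in Ioi (‖w‖ / R), g w * ENNReal.ofReal ‖w‖ * ENNReal.ofReal (t ^ (-4:ℝ)) := by
          rw [← lintegral_indicator measurableSet_Ioi]
          refine lintegral_congr fun t => ?_
          simp only [hJ, indicator, mem_ofPred_eq, mem_Ioi, div_lt_iff₀ hR]
      _ = g w * ENNReal.ofReal ‖w‖ * ENNReal.ofReal ((‖w‖ / R) ^ (-3:ℝ) / 3) := by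
          rw [lintegral_const_mul _ (by fun_prop), int_pow_four _ (by positivity)]
      _ = _ := by
          rw [ENNReal.ofReal_rpow_of_pos w0, mul_assoc, ← ENNReal.ofReal_mul w0.le,
            mul_left_comm, ← ENNReal.ofReal_mul (by positivity)]
          congr 2
          rw [Real.rpow_neg (by positivity), Real.rpow_neg (by positivity)]
          norm_cast
          field_simp
  · have : ∀ t ∈ Ioc (0:ℝ) 1, J (w, t) = 0 := by
      intro t ht
      simp only [hJ]
      rw [indicator_of_notMem]
      simp only [mem_ofPred_eq, not_lt]
      nlinarith [ht.2]
    rw [setLIntegral_congr_fun measurableSet_Ioc this]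
    simp

lemma potential (f : E3 → ℝ) (hf : ContDiff ℝ (⊤ : ℕ∞) f) (x : E3) (R : ℝ) (hR : 0 < R) :
    ENNReal.ofReal |f x| ≤
      (∫⁻ w in ball (0:E3) R, ENNReal.ofReal ‖fderiv ℝ f (x + w)‖ * ENNReal.ofReal ‖w‖ ^ (-2:ℝ)) +
      ENNReal.ofReal (R ^ (-3:ℝ)) * ∫⁻ w in ball (0:E3) R, ENNReal.ofReal |f (x + w)| := by
  have hc : Continuous (fderiv ℝ f) := hf.continuous_fderiv (by simp)
  have hfc : Continuous f := hf.continuous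
  set I1 := ∫⁻ w in ball (0:E3) R, ENNReal.ofReal ‖fderiv ℝ f (x + w)‖ *
    ENNReal.ofReal ‖w‖ ^ (-2:ℝ) with hI1
  set I2 := ∫⁻ w in ball (0:E3) R, ENNReal.ofReal |f (x + w)| with hI2
  have h1 : ENNReal.ofReal |f x| * volume (ball (0:E3) R) ≤
      I2 + ENNReal.ofReal (R ^ 3 / 3) * I1 := by
    have hcb := cone_bound (fun y => ENNReal.ofReal ‖fderiv ℝ f (x + y)‖) (by fun_prop) R hR
    refine le_trans ?_ (add_le_add_right hcb _)
    rw [hI2, ← lintegral_add_left (by fun_prop), ← setLIntegral_const]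
    exact lintegral_mono fun z => ftc_bound f hf x z
  have hv : ENNReal.ofReal (R ^ 3) ≤ volume (ball (0:E3) R) := by
    rw [EuclideanSpace.volume_ball_fin_three, ← ENNReal.ofReal_pow hR.le,
      ← ENNReal.ofReal_mul (by positivity)]
    apply ENNReal.ofReal_le_ofReal
    have := Real.pi_gt_three
    have h3 : 0 < R ^ 3 := by positivity
    nlinarith
  have e : ENNReal.ofReal (R ^ (-3:ℝ)) * ENNReal.ofReal (R ^ 3) = 1 := by
    rw [← ENNReal.ofReal_mul (by positivity), Real.rpow_neg hR.le]
    norm_cast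
    rw [inv_mul_cancel₀ (by positivity)]; simp
  calc ENNReal.ofReal |f x|
      = ENNReal.ofReal (R ^ (-3:ℝ)) * (ENNReal.ofReal |f x| * ENNReal.ofReal (R ^ 3)) := by
        rw [mul_left_comm, e, mul_one]
    _ ≤ ENNReal.ofReal (R ^ (-3:ℝ)) * (I2 + ENNReal.ofReal (R ^ 3) * I1) := by
        gcongr
        refine le_trans (by gcongr) (h1.trans ?_)
        gcongr
        have h3 : 0 < R ^ 3 := by positivity
        linarith
    _ = _ := by
        rw [mul_add, ← mul_assoc, e, one_mul, add_comm]
/-! ### Main estimate with free radius -/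

lemma Bil_ker (q b : ℝ) (hq : 2 ≤ q) (hb : b ≤ 1 / 2 + 1 / q) (hb' : q = 2 → b < 1) :
    ∃ C : ℝ, 0 < C ∧ ∀ R : ℝ, 0 < R →
      Bil (ker1 b R) (ENNReal.ofReal (C * R ^ (1 / 2 + 1 / q - b))) (1 - 1 / q) := by
  have hq0 : 0 < q := by linarith
  have hqi : 0 < 1 / q := by positivity
  have hq2 : 1 / q ≤ 1 / 2 := one_div_le_one_div_of_le two_pos hq
  obtain ⟨C, hC, h⟩ := bil1 (1 / 2 - 1 / q) b (by linarith) (by linarith) (by linarith) (by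
    intro h
    apply hb'
    have : 1 / q = 1 / 2 := by linarith
    field_simp at this
    linarith)
  refine ⟨C, hC, fun R hR F G hF hG => ?_⟩
  have hfin := h R hR F G hF hG
  rw [show 1 - (1 / 2 - 1 / q) - b = 1 / 2 + 1 / q - b by ring,
    show 1 / 2 + (1 / 2 - 1 / q) = 1 - 1 / q by ring] at hfin
  exact hfin

/-- The product kernel. -/
def ker3 (b1 b2 b3 R : ℝ) (w : E3) : ℝ≥0∞ :=
  ker1 b1 R (w 0) * (ker1 b2 R (w 1) * ker1 b3 R (w 2))

lemma measurable_ker3 (b1 b2 b3 R : ℝ) : Measurable (ker3 b1 b2 b3 R) := by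
  unfold ker3
  have h : ∀ (b : ℝ) (i : Fin 3), Measurable fun w : E3 => ker1 b R (w i) := fun b i =>
    (measurable_ker1 b R).comp (by fun_prop)
  exact (h b1 0).mul ((h b2 1).mul (h b3 2))

/-- The conjugate mixed norm. -/
def mixN (ρ1 ρ2 ρ3 : ℝ) (H : (ℝ × ℝ) × ℝ → ℝ≥0∞) : ℝ≥0∞ :=
  (∫⁻ x3, ((∫⁻ x2, ((∫⁻ x1, H ((x3, x2), x1) ^ (1 / ρ1)) ^ ρ1) ^ (1 / ρ2)) ^ ρ2)
    ^ (1 / ρ3)) ^ ρ3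

lemma conv_eq (b1 b2 b3 R : ℝ) (F : E3 → ℝ≥0∞) (hF : Measurable F) (p : (ℝ × ℝ) × ℝ) :
    ∫⁻ w, F (pt3 p.2 p.1.2 p.1.1 + w) * ker3 b1 b2 b3 R w =
    ∫⁻ q : (ℝ × ℝ) × ℝ, F (pt3 q.2 q.1.2 q.1.1) * (ker1 b1 R (p.2 - q.2) *
      (ker1 b2 R (p.1.2 - q.1.2) * ker1 b3 R (p.1.1 - q.1.1))) := by
  have hk := measurable_ker3 b1 b2 b3 R
  set P := pt3 p.2 p.1.2 p.1.1 with hP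
  have e1 : ∫⁻ w, F (P + w) * ker3 b1 b2 b3 R w = ∫⁻ y, F y * ker3 b1 b2 b3 R (y - P) := by
    rw [← lintegral_add_left_eq_self (fun y => F y * ker3 b1 b2 b3 R (y - P)) P]
    simp
  rw [e1, ← lintegral_pt3 _ (by fun_prop)]
  refine lintegral_congr fun q => ?_
  have : ∀ b x y : ℝ, ker1 b R (x - y) = ker1 b R (y - x) := by
    intro b x y; rw [← ker1_neg, neg_sub]
  rw [this b1 p.2, this b2 p.1.2, this b3 p.1.1]
  rfl

lemma conv_pair (b1 b2 b3 R : ℝ) (C1 C2 C3 : ℝ≥0∞) (ρ1 ρ2 ρ3 : ℝ)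
    (h1 : Bil (ker1 b1 R) C1 ρ1) (h2 : Bil (ker1 b2 R) C2 ρ2) (h3 : Bil (ker1 b3 R) C3 ρ3)
    (F : E3 → ℝ≥0∞) (hF : Measurable F) (H : (ℝ × ℝ) × ℝ → ℝ≥0∞) (hH : Measurable H) :
    ∫⁻ p, H p * ∫⁻ w, F (pt3 p.2 p.1.2 p.1.1 + w) * ker3 b1 b2 b3 R w ≤
      C1 * C2 * C3 * (∫⁻ x, F x ^ (2:ℝ)) ^ (1 / (2:ℝ)) * mixN ρ1 ρ2 ρ3 H := by
  simp only [conv_eq b1 b2 b3 R F hF]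
  rw [← lintegral_pt3 _ (hF.pow_const _)]
  exact bil3 _ _ _ (measurable_ker1 _ _) (measurable_ker1 _ _) (measurable_ker1 _ _) C1 C2 C3
    ρ1 ρ2 ρ3 h1 h2 h3 _ H (hF.comp measurable_pt3) hH

lemma l2On_eq_s8 (s : Set E3) (hs : MeasurableSet s) (g : E3 → ℝ) :
    (∫⁻ x, (s.indicator (fun x => ENNReal.ofReal |g x|) x) ^ (2:ℝ)) ^ (1 / (2:ℝ)) = l2On s g := by
  rw [l2On, ← lintegral_indicator hs]
  congr 1
  refine lintegral_congr fun x => ?_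
  by_cases hx : x ∈ s
  · simp [hx]
  · simp [hx]

lemma core_s8 (q1 q2 q3 : ℝ) (hq1 : 2 ≤ q1) (hq2 : 2 ≤ q2) (hq3 : 2 ≤ q3)
    (s : ℝ) (hs : s = 3 / 2 - (1 / q1 + 1 / q2 + 1 / q3)) (hs1 : s ≤ 1) :
    ∃ C : ℝ, 0 < C ∧ ∀ (ϱ : ℝ), 0 < ϱ → ∀ f : E3 → ℝ, ContDiff ℝ (⊤ : ℕ∞) f →
      ∀ R : ℝ, 0 < R → R ≤ 2 / 5 * ϱ →
        anisoNorm q1 q2 q3 (ball (0 : E3) ϱ) f ≤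
          ENNReal.ofReal (C * R ^ (1 - s)) *
            l2On (ball (0 : E3) (Real.sqrt 2 * ϱ)) (fun x => ‖fderiv ℝ f x‖) +
          ENNReal.ofReal (C * R ^ (-s)) * l2On (ball (0 : E3) (Real.sqrt 2 * ϱ)) f := by
  have hpos : ∀ q : ℝ, 2 ≤ q → 0 < 1 / q ∧ 1 / q ≤ 1 / 2 := fun q hq =>
    ⟨by positivity, one_div_le_one_div_of_le two_pos hq⟩
  obtain ⟨i1, j1⟩ := hpos q1 hq1
  obtain ⟨i2, j2⟩ := hpos q2 hq2
  obtain ⟨i3, j3⟩ := hpos q3 hq3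
  have d0 : 0 < 3 - s := by linarith
  set θ := 2 / (3 - s) with hθ
  have θ0 : 0 < θ := by positivity
  have θ1 : θ ≤ 1 := by rw [hθ, div_le_one d0]; linarith
  have hθs : θ * (3 - s) = 2 := by rw [hθ]; field_simp
  have hle : ∀ q : ℝ, 2 ≤ q → θ * (1 / 2 + 1 / q) ≤ 1 / 2 + 1 / q := by
    intro q hq
    have := (hpos q hq).1
    nlinarith
  have hlt : s < 1 → ∀ q : ℝ, q = 2 → θ * (1 / 2 + 1 / q) < 1 := by
    intro h q hq
    have : θ < 1 := by rw [hθ, div_lt_one d0]; linarith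
    rw [hq]; norm_num; exact this
  obtain ⟨A1, A1p, hA1⟩ := Bil_ker q1 (θ * (1 / 2 + 1 / q1)) hq1 (hle q1 hq1)
    (fun h => hlt (by subst h; linarith) _ h)
  obtain ⟨A2, A2p, hA2⟩ := Bil_ker q2 (θ * (1 / 2 + 1 / q2)) hq2 (hle q2 hq2)
    (fun h => hlt (by subst h; linarith) _ h)
  obtain ⟨A3, A3p, hA3⟩ := Bil_ker q3 (θ * (1 / 2 + 1 / q3)) hq3 (hle q3 hq3)
    (fun h => hlt (by subst h; linarith) _ h)
  obtain ⟨B1, B1p, hB1⟩ := Bil_ker q1 0 hq1 (by linarith) (fun _ => by norm_num)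
  obtain ⟨B2, B2p, hB2⟩ := Bil_ker q2 0 hq2 (by linarith) (fun _ => by norm_num)
  obtain ⟨B3, B3p, hB3⟩ := Bil_ker q3 0 hq3 (by linarith) (fun _ => by norm_num)
  refine ⟨A1 * A2 * A3 + B1 * B2 * B3, by positivity, fun ϱ hϱ f hf R hR hRϱ => ?_⟩
  have hc : Continuous (fderiv ℝ f) := hf.continuous_fderiv (by simp)
  have hfc : Continuous f := hf.continuous
  have hsq : (7:ℝ) / 5 ≤ Real.sqrt 2 := Real.le_sqrt_of_sq_le (by norm_num)
  set Ω := ball (0 : E3) (Real.sqrt 2 * ϱ) with hΩ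
  have hΩm : MeasurableSet Ω := measurableSet_ball
  set F1 : E3 → ℝ≥0∞ := Ω.indicator (fun x => ENNReal.ofReal |‖fderiv ℝ f x‖|) with hF1
  set F2 : E3 → ℝ≥0∞ := Ω.indicator (fun x => ENNReal.ofReal |f x|) with hF2
  have hF1m : Measurable F1 := Measurable.indicator (by fun_prop) hΩm
  have hF2m : Measurable F2 := Measurable.indicator (by fun_prop) hΩm
  set K1 := ker3 (θ * (1 / 2 + 1 / q1)) (θ * (1 / 2 + 1 / q2)) (θ * (1 / 2 + 1 / q3)) R with hK1
  set K2 := ker3 0 0 0 R with hK2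
  have hK1m : Measurable K1 := measurable_ker3 _ _ _ _
  have hK2m : Measurable K2 := measurable_ker3 _ _ _ _
  set φ : (ℝ × ℝ) × ℝ → ℝ≥0∞ := fun p =>
    ENNReal.ofReal |(ball (0 : E3) ϱ).indicator f (pt3 p.2 p.1.2 p.1.1)| with hφ
  have hφm : Measurable φ := by
    have : Measurable ((ball (0 : E3) ϱ).indicator f) :=
      hfc.measurable.indicator measurableSet_ball
    exact ENNReal.measurable_ofReal.comp
      (measurable_norm.comp (this.comp measurable_pt3))
  obtain ⟨K, hK⟩ := (isCompact_closedBall (0:E3) ϱ).exists_bound_of_continuousOn hfc.continuousOn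
  have hφK : ∀ p, φ p ≤ ENNReal.ofReal K := by
    intro p
    simp only [hφ]
    by_cases hx : pt3 p.2 p.1.2 p.1.1 ∈ ball (0 : E3) ϱ
    · rw [indicator_of_mem hx]
      exact ENNReal.ofReal_le_ofReal (hK _ (ball_subset_closedBall hx))
    · rw [indicator_of_notMem hx]; simp
  have hφ0 : ∀ (i : Fin 3) (p : (ℝ × ℝ) × ℝ), ϱ ≤ |pt3 p.2 p.1.2 p.1.1 i| → φ p = 0 := by
    intro i p hp
    have := abs_coord_le (pt3 p.2 p.1.2 p.1.1) i
    simp only [hφ]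
    rw [indicator_of_notMem]
    · simp
    · rw [mem_ball_zero_iff, not_lt]; linarith
  -- pointwise bound
  have hpt : ∀ p, φ p ≤ (∫⁻ w, F1 (pt3 p.2 p.1.2 p.1.1 + w) * K1 w) +
      ENNReal.ofReal (R ^ (-3:ℝ)) * ∫⁻ w, F2 (pt3 p.2 p.1.2 p.1.1 + w) * K2 w := by
    intro p
    set x := pt3 p.2 p.1.2 p.1.1 with hx
    by_cases hxb : x ∈ ball (0 : E3) ϱ
    · have hφx : φ p = ENNReal.ofReal |f x| := by
        simp only [hφ]; rw [indicator_of_mem hxb]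
      rw [hφx]
      refine (potential f hf x R hR).trans ?_
      have hin : ∀ w ∈ ball (0:E3) R, x + w ∈ Ω := by
        intro w hw
        rw [mem_ball_zero_iff] at hw hxb
        rw [hΩ, mem_ball_zero_iff]
        have := norm_add_le x w
        nlinarith
      refine add_le_add ?_ (mul_le_mul_right ?_ _)
      · refine le_trans (setLIntegral_mono_ae' measurableSet_ball
          (Eventually.of_forall fun w hw => ?_)) (setLIntegral_le_lintegral (ball (0:E3) R) _)
        rw [hF1, indicator_of_mem (hin w hw), abs_of_nonneg (norm_nonneg _)]
        refine mul_le_mul_right ?_ _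
        refine kernel_bound _ _ _ R (by positivity) (by positivity) (by positivity) ?_ w
          (by simpa using hw)
        linear_combination hθs + θ * hs
      · refine le_trans (setLIntegral_mono_ae' measurableSet_ball
          (Eventually.of_forall fun w hw => ?_)) (setLIntegral_le_lintegral (ball (0:E3) R) _)
        rw [hF2, indicator_of_mem (hin w hw)]
        exact le_mul_of_one_le_right' (kernel_bound_zero R w (by simpa using hw))
    · have hφx : φ p = 0 := by
        simp only [hφ]; rw [indicator_of_notMem hxb]; simp
      rw [hφx]; exact zero_le
  have hconvm : ∀ (F K : E3 → ℝ≥0∞), Measurable F → Measurable K →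
      Measurable fun p : (ℝ × ℝ) × ℝ => ∫⁻ w, F (pt3 p.2 p.1.2 p.1.1 + w) * K w := by
    intro F K hF hK
    have hP := measurable_pt3
    have : Measurable fun z : ((ℝ × ℝ) × ℝ) × E3 =>
        F (pt3 z.1.2 z.1.1.2 z.1.1.1 + z.2) * K z.2 :=
      (hF.comp ((hP.comp measurable_fst).add measurable_snd)).mul (hK.comp measurable_snd)
    exact this.lintegral_prod_right'
  set D := l2On Ω (fun x => ‖fderiv ℝ f x‖) with hD
  set L := l2On Ω f with hL
  have hDe : (∫⁻ x, F1 x ^ (2:ℝ)) ^ (1 / (2:ℝ)) = D := l2On_eq_s8 Ω hΩm _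
  have hLe : (∫⁻ x, F2 x ^ (2:ℝ)) ^ (1 / (2:ℝ)) = L := l2On_eq_s8 Ω hΩm _
  have hcomb : ∀ (c1 c2 c3 e1 e2 e3 : ℝ), 0 < c1 → 0 < c2 → 0 < c3 →
      ENNReal.ofReal (c1 * R ^ e1) * ENNReal.ofReal (c2 * R ^ e2) * ENNReal.ofReal (c3 * R ^ e3) =
      ENNReal.ofReal (c1 * c2 * c3 * R ^ (e1 + e2 + e3)) := by
    intro c1 c2 c3 e1 e2 e3 h1 h2 h3
    rw [← ENNReal.ofReal_mul (by positivity), ← ENNReal.ofReal_mul (by positivity),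
      Real.rpow_add hR, Real.rpow_add hR]
    congr 1; ring
  refine dual3 φ hφm (ENNReal.ofReal K) ENNReal.ofReal_ne_top ϱ hφK (hφ0 0) (hφ0 1) (hφ0 2)
    q1 q2 q3 hq1 hq2 hq3 _ ?_
  intro H hH
  change _ ≤ _ * mixN (1 - 1 / q1) (1 - 1 / q2) (1 - 1 / q3) H
  have c1 := conv_pair _ _ _ R _ _ _ _ _ _ (hA1 R hR) (hA2 R hR) (hA3 R hR) F1 hF1m H hH
  have c2 := conv_pair _ _ _ R _ _ _ _ _ _ (hB1 R hR) (hB2 R hR) (hB3 R hR) F2 hF2m H hH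
  rw [hcomb _ _ _ _ _ _ A1p A2p A3p, hDe] at c1
  rw [hcomb _ _ _ _ _ _ B1p B2p B3p, hLe] at c2
  have ex1 : 1 / 2 + 1 / q1 - θ * (1 / 2 + 1 / q1) + (1 / 2 + 1 / q2 - θ * (1 / 2 + 1 / q2)) +
      (1 / 2 + 1 / q3 - θ * (1 / 2 + 1 / q3)) = 1 - s := by
    have : 1 / 2 + 1 / q1 + (1 / 2 + 1 / q2) + (1 / 2 + 1 / q3) = 3 - s := by rw [hs]; ring
    linear_combination (1 - θ) * this - hθs
  have ex2 : 1 / 2 + 1 / q1 - 0 + (1 / 2 + 1 / q2 - 0) + (1 / 2 + 1 / q3 - 0) = 3 + -s := by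
    rw [hs]; ring
  rw [ex1] at c1
  rw [ex2] at c2
  have hm1 : Measurable fun p : (ℝ × ℝ) × ℝ =>
      H p * ∫⁻ w, F1 (pt3 p.2 p.1.2 p.1.1 + w) * K1 w := hH.mul (hconvm F1 K1 hF1m hK1m)
  have hm2 : Measurable fun p : (ℝ × ℝ) × ℝ =>
      H p * ∫⁻ w, F2 (pt3 p.2 p.1.2 p.1.1 + w) * K2 w := hH.mul (hconvm F2 K2 hF2m hK2m)
  calc ∫⁻ p, H p * φ p
      ≤ ∫⁻ p, (H p * (∫⁻ w, F1 (pt3 p.2 p.1.2 p.1.1 + w) * K1 w) +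
          ENNReal.ofReal (R ^ (-3:ℝ)) *
            (H p * ∫⁻ w, F2 (pt3 p.2 p.1.2 p.1.1 + w) * K2 w)) := by
        refine lintegral_mono fun p => ?_
        refine (mul_le_mul_right (hpt p) (H p)).trans (le_of_eq ?_)
        ring
    _ = (∫⁻ p, H p * (∫⁻ w, F1 (pt3 p.2 p.1.2 p.1.1 + w) * K1 w)) +
          ENNReal.ofReal (R ^ (-3:ℝ)) *
            ∫⁻ p, (H p * ∫⁻ w, F2 (pt3 p.2 p.1.2 p.1.1 + w) * K2 w) := by
        rw [lintegral_add_left hm1, lintegral_const_mul _ hm2]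
    _ ≤ _ := add_le_add c1 (mul_le_mul_right c2 _)
    _ = (ENNReal.ofReal (A1 * A2 * A3 * R ^ (1 - s)) * D +
          ENNReal.ofReal (B1 * B2 * B3 * R ^ (-s)) * L) *
          mixN (1 - 1 / q1) (1 - 1 / q2) (1 - 1 / q3) H := by
        have : ENNReal.ofReal (B1 * B2 * B3 * R ^ (-s)) = ENNReal.ofReal (R ^ (-3:ℝ)) *
            ENNReal.ofReal (B1 * B2 * B3 * R ^ (3 + -s)) := by
          rw [← ENNReal.ofReal_mul (by positivity), mul_left_comm, ← Real.rpow_add hR]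
          congr 3; ring
        rw [this]; ring
    _ ≤ _ := by
        have hA : 0 < A1 * A2 * A3 := by positivity
        have hB : 0 < B1 * B2 * B3 := by positivity
        gcongr <;> linarith
/-! ### Optimization in the radius -/

lemma l2On_ne_top (r : ℝ) (g : E3 → ℝ) (hg : Continuous g) : l2On (ball (0:E3) r) g ≠ ∞ := by
  obtain ⟨K, hK⟩ := (isCompact_closedBall (0:E3) r).exists_bound_of_continuousOn hg.continuousOn
  unfold l2On
  refine ENNReal.rpow_ne_top_of_nonneg (by norm_num) ?_
  refine ne_top_of_le_ne_top (b := ENNReal.ofReal K ^ 2 * volume (ball (0:E3) r))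
    (ENNReal.mul_ne_top (by finiteness) measure_ball_lt_top.ne) ?_
  rw [← setLIntegral_const]
  refine setLIntegral_mono_ae' measurableSet_ball (Eventually.of_forall fun x hx => ?_)
  gcongr
  exact hK x (ball_subset_closedBall hx)

lemma optimize (X : ℝ≥0∞) (C d l s ϱ : ℝ) (hC : 0 < C) (hd : 0 ≤ d) (hl : 0 ≤ l) (hs0 : 0 ≤ s)
    (hs1 : s ≤ 1) (hϱ : 0 < ϱ)
    (h : ∀ R : ℝ, 0 < R → R ≤ 2 / 5 * ϱ →
      X ≤ ENNReal.ofReal (C * R ^ (1 - s)) * ENNReal.ofReal d +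
        ENNReal.ofReal (C * R ^ (-s)) * ENNReal.ofReal l) :
    X ≤ ENNReal.ofReal (5 * C) * ENNReal.ofReal d ^ s * ENNReal.ofReal l ^ (1 - s) +
      ENNReal.ofReal (5 * C) * ENNReal.ofReal (ϱ ^ (-s)) * ENNReal.ofReal l := by
  have h' : ∀ R : ℝ, 0 < R → R ≤ 2 / 5 * ϱ →
      X ≤ ENNReal.ofReal (C * (R ^ (1 - s) * d + R ^ (-s) * l)) := by
    intro R hR hR'
    refine (h R hR hR').trans (le_of_eq ?_)
    rw [← ENNReal.ofReal_mul (by positivity), ← ENNReal.ofReal_mul (by positivity),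
      ← ENNReal.ofReal_add (by positivity) (by positivity)]
    congr 1; ring
  rw [ENNReal.ofReal_rpow_of_nonneg hd hs0, ENNReal.ofReal_rpow_of_nonneg hl (by linarith),
    ← ENNReal.ofReal_mul (by positivity), ← ENNReal.ofReal_mul (by positivity),
    ← ENNReal.ofReal_mul (by positivity), ← ENNReal.ofReal_mul (by positivity),
    ← ENNReal.ofReal_add (by positivity) (by positivity)]
  have R0 : 0 < 2 / 5 * ϱ := by positivity
  have hRs : (2 / 5 * ϱ) ^ (-s) ≤ 5 / 2 * ϱ ^ (-s) := by
    rw [Real.mul_rpow (by norm_num) hϱ.le]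
    gcongr
    rw [Real.rpow_neg (by norm_num), ← Real.inv_rpow (by norm_num)]
    calc ((2 / 5 : ℝ)⁻¹) ^ s ≤ ((2 / 5 : ℝ)⁻¹) ^ (1:ℝ) :=
          Real.rpow_le_rpow_of_exponent_le (by norm_num) hs1
      _ = 5 / 2 := by norm_num
  have hP : 0 ≤ d ^ s * l ^ (1 - s) := by positivity
  have hQ : 0 ≤ ϱ ^ (-s) * l := by positivity
  have hmul : (2 / 5 * ϱ) ^ (-s) * l ≤ 5 / 2 * (ϱ ^ (-s) * l) := by
    rw [← mul_assoc]; gcongr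
  have main : ∀ R : ℝ, 0 < R → R ≤ 2 / 5 * ϱ →
      R ^ (1 - s) * d + R ^ (-s) * l ≤ 5 * (d ^ s * l ^ (1 - s)) + 5 * (ϱ ^ (-s) * l) →
      X ≤ ENNReal.ofReal (5 * C * d ^ s * l ^ (1 - s) + 5 * C * ϱ ^ (-s) * l) := by
    intro R hR hR' hh
    refine (h' R hR hR').trans (ENNReal.ofReal_le_ofReal ?_)
    calc _ ≤ C * (5 * (d ^ s * l ^ (1 - s)) + 5 * (ϱ ^ (-s) * l)) := by gcongr
      _ = _ := by ring
  rcases hs1.eq_or_lt with rfl | hs1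
  · refine main _ R0 le_rfl ?_
    norm_num at hP hmul ⊢
    linarith
  by_cases h1 : 2 / 5 * ϱ * d ≤ l
  · refine main _ R0 le_rfl ?_
    have e : (2 / 5 * ϱ) ^ (1 - s) = (2 / 5 * ϱ) ^ (-s) * (2 / 5 * ϱ) := by
      conv_rhs => rw [← Real.rpow_add_one R0.ne']
      congr 1; ring
    have : (2 / 5 * ϱ) ^ (1 - s) * d ≤ (2 / 5 * ϱ) ^ (-s) * l := by
      rw [e, mul_assoc]; gcongr
    linarith
  push Not at h1
  have d0 : 0 < d := by
    rcases hd.eq_or_lt with rfl | hd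
    · simp at h1; linarith
    · exact hd
  rcases hl.eq_or_lt with rfl | l0
  · have ht : Tendsto (fun R : ℝ => ENNReal.ofReal (C * (R ^ (1 - s) * d + R ^ (-s) * 0)))
        (nhdsWithin 0 (Ioi 0)) (nhds 0) := by
      have h2 : Tendsto (fun R : ℝ => C * (R ^ (1 - s) * d)) (nhds 0)
          (nhds (C * ((0:ℝ) ^ (1 - s) * d))) := by
        refine Tendsto.const_mul _ (Tendsto.mul_const _ ?_)
        exact (Real.continuousAt_rpow_const 0 (1 - s) (Or.inr (by linarith))).tendsto
      rw [Real.zero_rpow (by linarith)] at h2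
      have h3 := ENNReal.tendsto_ofReal (h2.mono_left (nhdsWithin_le_nhds (s := Ioi 0)))
      simpa using h3
    have : X ≤ 0 := by
      refine ge_of_tendsto ht ?_
      filter_upwards [Ioc_mem_nhdsGT R0] with R hR
      exact h' R hR.1 hR.2
    exact this.trans zero_le
  · refine main (l / d) (by positivity) (by rw [div_le_iff₀ d0]; exact h1.le) ?_
    have e1 : (l / d) ^ (1 - s) * d = d ^ s * l ^ (1 - s) := by
      rw [Real.div_rpow hl hd, Real.rpow_sub d0, Real.rpow_one]
      field_simp
    have e2 : (l / d) ^ (-s) * l = d ^ s * l ^ (1 - s) := by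
      rw [Real.div_rpow hl hd, Real.rpow_neg hl, Real.rpow_neg hd, Real.rpow_sub l0,
        Real.rpow_one]
      field_simp
    rw [e1, e2]
    linarith
/-- Lemma 2.3, inequality (2.5): local anisotropic Sobolev inequality: for `q_j ∈ [2,∞)`
with `0 ≤ 1/q̄ − 1/2 ≤ 1` and every `ϱ > 0`, `f ∈ C^∞(ℝ³)`:
`‖f‖_{L^{q⃗}(B(ϱ))} ≤ C ‖∇f‖_{L²(B(√2ϱ))}^{3/2−1/q̄} ‖f‖_{L²(B(√2ϱ))}^{1/q̄−1/2}
  + C ϱ^{−(3/2−1/q̄)} ‖f‖_{L²(B(√2ϱ))}`. -/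
theorem aniso_sobolev_local
    (q1 q2 q3 : ℝ) (hq1 : 2 ≤ q1) (hq2 : 2 ≤ q2) (hq3 : 2 ≤ q3)
    (h0 : 0 ≤ 1/q1 + 1/q2 + 1/q3 - 1/2) (h1 : 1/q1 + 1/q2 + 1/q3 - 1/2 ≤ 1) :
    ∃ C : ℝ, 0 < C ∧
      ∀ (ϱ : ℝ), 0 < ϱ → ∀ f : E3 → ℝ, ContDiff ℝ (⊤ : ℕ∞) f →
        anisoNorm q1 q2 q3 (ball (0 : E3) ϱ) f
          ≤ ENNReal.ofReal C
              * (l2On (ball (0 : E3) (Real.sqrt 2 * ϱ)) (fun x => ‖fderiv ℝ f x‖))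
                  ^ (3/2 - (1/q1 + 1/q2 + 1/q3))
              * (l2On (ball (0 : E3) (Real.sqrt 2 * ϱ)) f) ^ (1/q1 + 1/q2 + 1/q3 - 1/2)
            + ENNReal.ofReal C * ENNReal.ofReal (ϱ ^ (-(3/2 - (1/q1 + 1/q2 + 1/q3))))
              * l2On (ball (0 : E3) (Real.sqrt 2 * ϱ)) f := by
  have hpos : ∀ q : ℝ, 2 ≤ q → 0 < 1 / q ∧ 1 / q ≤ 1 / 2 := fun q hq =>
    ⟨by positivity, one_div_le_one_div_of_le two_pos hq⟩
  set s : ℝ := 3/2 - (1/q1 + 1/q2 + 1/q3) with hs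
  have es : 1/q1 + 1/q2 + 1/q3 - 1/2 = 1 - s := by rw [hs]; ring
  rw [es] at h0 h1 ⊢
  obtain ⟨C, hC, h⟩ := core_s8 q1 q2 q3 hq1 hq2 hq3 s hs (by linarith)
  refine ⟨5 * C, by positivity, fun ϱ hϱ f hf => ?_⟩
  have hc : Continuous (fderiv ℝ f) := hf.continuous_fderiv (by simp)
  have hD := l2On_ne_top (Real.sqrt 2 * ϱ) (fun x => ‖fderiv ℝ f x‖) (by fun_prop)
  have hL := l2On_ne_top (Real.sqrt 2 * ϱ) f hf.continuous
  have h' := h ϱ hϱ f hf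
  rw [← ENNReal.ofReal_toReal hD, ← ENNReal.ofReal_toReal hL] at h' ⊢
  exact optimize _ C _ _ s ϱ hC ENNReal.toReal_nonneg ENNReal.toReal_nonneg (by linarith)
    (by linarith) hϱ h'
end
end
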